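/- There exists a finite set Ω of twenty-one L-sentences, each an instance of the Replacement scheme, and a function F mapping L-formulas to L-formulas, such that: for every set Φ of L-formulas and every countable transitive set M with (M,∈) ⊨ ZC ∪ {Replacement(F(φ)) : φ ∈ Φ} ∪ Ω, there exists a countable transitive set N with M ⊆ N, containing exactly the same ordinals as M, such that (N,∈) ⊨ ZC ∪ {Replacement(φ) : φ ∈ Φ} ∪ {¬CH}. -/

import Mathlib

namespace CtmForcing

open FirstOrder FirstOrder.Language

/-! ### The first-order language of set theory -/

/-- The relation symbols of the language of set theory: a single binary relation `∈`. -/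
inductive memRel : ℕ → Type
  | mem : memRel 2

/-- The first-order language `L` of set theory, with a single binary relation symbol `∈`. -/
def SetLang : Language := ⟨fun _ => Empty, memRel⟩

/-- The membership relation symbol. -/
abbrev memSymb : SetLang.Relations 2 := .mem

/-- `L`-formulas (with no free "unbounded" variables) whose free variables are among
`v₀, …, v_{n-1}`. -/
abbrev BF (n : ℕ) := SetLang.BoundedFormula Empty n

/-- The atomic formula `vᵢ ∈ vⱼ`. -/
def memf {n : ℕ} (i j : Fin n) : BF n :=
  memSymb.boundedFormula₂ (Term.var (Sum.inr i)) (Term.var (Sum.inr j))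

/-- The atomic formula `vᵢ = vⱼ`. -/
def eqf {n : ℕ} (i j : Fin n) : BF n :=
  Term.bdEqual (Term.var (Sum.inr i)) (Term.var (Sum.inr j))

/-- Rename the free variables of a formula along `f`. -/
def reindex {m k : ℕ} (f : Fin m → Fin k) (φ : BF m) : BF k :=
  (BoundedFormula.relabel (Sum.map id f) φ.toFormula : SetLang.BoundedFormula Empty (k + 0))

/-- Conjunction. -/
def andF {n : ℕ} (φ ψ : BF n) : BF n := (φ.imp ψ.not).not

/-- Disjunction. -/
def orF {n : ℕ} (φ ψ : BF n) : BF n := (φ.not).imp ψ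

/-- Biimplication. -/
def iffF {n : ℕ} (φ ψ : BF n) : BF n := andF (φ.imp ψ) (ψ.imp φ)

/-! ### Basic set-theoretic formulas -/

/-- `v₀ ⊆ v₁`. -/
def subF : BF 2 := ((memf 2 0).imp (memf 2 1)).all

/-- `v₀ = ∅`. -/
def emptyF : BF 1 := ((memf 1 0).not).all

/-- `v₂ = {v₀, v₁}`. -/
def pairSetF : BF 3 := (iffF (memf 3 2) (orF (eqf 3 0) (eqf 3 1))).all

/-- `v₁ = {v₀}`. -/
def singF : BF 2 := reindex ![0, 0, 1] pairSetF

/-- `v₂ = ⟨v₀, v₁⟩` (Kuratowski ordered pair). -/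
def opF : BF 3 :=
  (iffF (memf 3 2) (orF (reindex ![0, 3] singF) (reindex ![0, 1, 3] pairSetF))).all

/-- `v₁ = v₀ ∪ {v₀}`. -/
def succF : BF 2 := (iffF (memf 2 1) (orF (memf 2 0) (eqf 2 0))).all

/-- `v₀` is transitive. -/
def transF : BF 1 := ((memf 1 0).imp (reindex ![1, 0] subF)).all

/-- `v₀` is an ordinal (a transitive set of transitive sets). -/
def ordF : BF 1 := andF transF (((memf 1 0).imp (reindex ![1] transF)).all)

/-- `⟨v₀, v₁⟩ ∈ v₂`. -/
def relMemF : BF 3 := (andF (reindex ![0, 1, 3] opF) (memf 3 2)).ex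

/-- `v₂` is a function with domain `v₀` mapping onto `v₁` (a surjection from `v₀` onto `v₁`). -/
def isFuncF : BF 3 :=
  andF
    (andF
      -- v₂ ⊆ v₀ × v₁
      (((memf 3 2).imp
        (((andF (andF (memf 4 0) (memf 5 1)) (reindex ![4, 5, 3] opF)).ex).ex)).all)
      -- total on v₀
      (((memf 3 0).imp ((andF (memf 4 1) (reindex ![3, 4, 2] relMemF)).ex)).all))
    (andF
      -- functional
      ((((andF (reindex ![3, 4, 2] relMemF) (reindex ![3, 5, 2] relMemF)).imp
          (eqf 4 5)).all).all.all)
      -- onto v₁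
      (((memf 3 1).imp ((andF (memf 4 0) (reindex ![4, 3, 2] relMemF)).ex)).all))

/-- `v₂` is injective (as a set of ordered pairs). -/
def injF : BF 3 :=
  ((((andF (reindex ![3, 5, 2] relMemF) (reindex ![4, 5, 2] relMemF)).imp
      (eqf 3 4)).all).all).all

/-- `v₂` is a bijection from `v₀` onto `v₁`. -/
def bijF : BF 3 := andF isFuncF injF

/-! ### The axioms of set theory as `L`-sentences -/

/-- Extensionality. -/
def extAx : SetLang.Sentence :=
  ((((andF subF (reindex ![1, 0] subF)).imp (eqf 0 1)).all).all : BF 0)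

/-- Foundation. -/
def foundAx : SetLang.Sentence :=
  (((((memf 1 0).ex).imp
    ((andF (memf 1 0) (((memf 2 0).imp ((memf 2 1).not)).all)).ex)).all) : BF 0)

/-- Pairing. -/
def pairAx : SetLang.Sentence := (((pairSetF.ex).all).all : BF 0)

/-- Union. -/
def unionAx : SetLang.Sentence :=
  (((((iffF (memf 2 1) ((andF (memf 3 0) (memf 2 3)).ex)).all).ex).all : BF 0))

/-- Powerset. -/
def powF : BF 2 := (iffF (memf 2 1) (reindex ![2, 0] subF)).all

/-- Powerset axiom. -/
def powAx : SetLang.Sentence := (((powF.ex).all) : BF 0)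

/-- Infinity. -/
def infAx : SetLang.Sentence :=
  (((andF ((andF (memf 1 0) (reindex ![1] emptyF)).ex)
    (((memf 1 0).imp ((andF (memf 2 0) (reindex ![1, 2] succF)).ex)).all)).ex) : BF 0)

/-- The instance of the Separation scheme given by `φ`, whose free variables are among
`v₀, …, vₙ`: the parameters are `v₀, …, v_{n-1}` and the tested element is `vₙ`.  It is the
universal closure of `∀A ∃B ∀x (x ∈ B ↔ x ∈ A ∧ φ(params, x))`. -/
def sepAx {n : ℕ} (φ : BF (n + 1)) : SetLang.Sentence :=
  -- context `n+3`: parameters `0,…,n-1`, `A = n`, `B = n+1`, `x = n+2`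
  let A : Fin (n + 3) := ⟨n, by omega⟩
  let B : Fin (n + 3) := ⟨n + 1, by omega⟩
  let x : Fin (n + 3) := ⟨n + 2, by omega⟩
  let φ' : BF (n + 3) := reindex (fun i => if h : (i : ℕ) < n then ⟨i, by omega⟩ else x) φ
  ((((iffF (memf x B) (andF (memf x A) φ')).all).ex).all).alls

/-- The instance of the Replacement scheme given by `φ`, whose free variables are among
`v₀, …, v_{n+1}`: the parameters are `v₀, …, v_{n-1}`, the argument is `x = vₙ`, and the
value is `y = v_{n+1}`.  It is the universal closure of
`∀A [(∀x∈A ∀y ∀y' (φ(x,y) ∧ φ(x,y') → y = y')) → ∃B ∀y (y ∈ B ↔ ∃x∈A φ(x,y))]`. -/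
def replAx {n : ℕ} (φ : BF (n + 2)) : SetLang.Sentence :=
  -- functionality context `n+4`: parameters, `A = n`, `x = n+1`, `y = n+2`, `y' = n+3`
  let A : Fin (n + 4) := ⟨n, by omega⟩
  let x : Fin (n + 4) := ⟨n + 1, by omega⟩
  let y : Fin (n + 4) := ⟨n + 2, by omega⟩
  let y' : Fin (n + 4) := ⟨n + 3, by omega⟩
  let φ₁ : BF (n + 4) :=
    reindex (fun i => if h : (i : ℕ) < n then ⟨i, by omega⟩ else if (i : ℕ) = n then x else y) φ
  let φ₂ : BF (n + 4) :=
    reindex (fun i => if h : (i : ℕ) < n then ⟨i, by omega⟩ else if (i : ℕ) = n then x else y') φ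
  let funcl : BF (n + 1) :=
    ((((andF (memf x A) (andF φ₁ φ₂)).imp (eqf y y')).all).all).all
  -- image context `n+4`: parameters, `A = n`, `B = n+1`, `y = n+2`, `x = n+3`
  let xi : Fin (n + 4) := ⟨n + 3, by omega⟩
  let yi : Fin (n + 4) := ⟨n + 2, by omega⟩
  let B3 : Fin (n + 3) := ⟨n + 1, by omega⟩
  let y3 : Fin (n + 3) := ⟨n + 2, by omega⟩
  let φ₃ : BF (n + 4) :=
    reindex (fun i => if h : (i : ℕ) < n then ⟨i, by omega⟩ else if (i : ℕ) = n then xi else yi) φ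
  let image : BF (n + 1) :=
    (((iffF (memf y3 B3) ((andF (memf xi A) φ₃).ex)).all).ex)
  ((funcl.imp image).all).alls

/-- The Axiom of Choice: every set is the surjective image of an ordinal. -/
def acAx : SetLang.Sentence :=
  ((((andF (reindex ![1] ordF) (reindex ![1, 0, 2] isFuncF)).ex).ex).all : BF 0)

/-- `v₀ = ω`: `v₀` is an ordinal containing `∅`, closed under successors, each of whose
elements is `∅` or a successor. -/
def omegaF : BF 1 :=
  andF (andF ordF ((andF (memf 1 0) (reindex ![1] emptyF)).ex))
    (andF (((memf 1 0).imp ((andF (memf 2 0) (reindex ![1, 2] succF)).ex)).all)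
      (((memf 1 0).imp
        (orF (reindex ![1] emptyF) ((andF (memf 2 1) (reindex ![2, 1] succF)).ex))).all))

/-- Given `v₀ = ω`, `v₁ = ℵ₁`: `v₁` is an ordinal, there is no surjection from `ω` onto `v₁`,
and every element of `v₁` is empty or a surjective image of `ω`. -/
def alephOneF : BF 2 :=
  andF (andF (reindex ![1] ordF) (((reindex ![0, 1, 2] isFuncF).ex).not))
    (((memf 2 1).imp (orF (reindex ![2] emptyF) ((reindex ![0, 2, 3] isFuncF).ex))).all)

/-- The Continuum Hypothesis `ℵ₁ = 2^ℵ₀`: there is a bijection between `𝒫(ω)` and `ℵ₁`. -/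
def chSent : SetLang.Sentence :=
  (((((andF (andF (reindex ![0] omegaF) (reindex ![0, 1] powF))
      (andF (reindex ![0, 2] alephOneF) (reindex ![1, 2, 3] bijF))).ex).ex).ex).ex : BF 0)

/-! ### The theories `Z`, `ZF`, `ZC`, `ZFC` -/

/-- The finitely many non-scheme axioms of `ZF`. -/
def zfFin : SetLang.Theory := {extAx, foundAx, pairAx, unionAx, powAx, infAx}

/-- All instances of the Separation scheme. -/
def sepScheme : SetLang.Theory := Set.range fun p : Σ n, BF (n + 1) => sepAx p.2

/-- All instances of the Replacement scheme. -/
def replScheme : SetLang.Theory := Set.range fun p : Σ n, BF (n + 2) => replAx p.2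

/-- Zermelo set theory. -/
def Z : SetLang.Theory := zfFin ∪ sepScheme

/-- Zermelo–Fraenkel set theory. -/
def ZF : SetLang.Theory := Z ∪ replScheme

/-- Zermelo set theory with Choice. -/
def ZC : SetLang.Theory := Z ∪ {acAx}

/-- Zermelo–Fraenkel set theory with Choice. -/
def ZFC : SetLang.Theory := ZF ∪ {acAx}

/-! ### Satisfaction in a set with the true membership relation -/

/-- The `L`-structure on (the elements of) a `ZFSet` `M`, with `∈` interpreted as true
membership. -/
def zfStruct (M : ZFSet) : SetLang.Structure {x : ZFSet // x ∈ M} where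
  funMap := fun f _ => f.elim
  RelMap | .mem => fun v => ((v 0 : {x : ZFSet // x ∈ M}) : ZFSet) ∈ ((v 1 : {x : ZFSet // x ∈ M}) : ZFSet)

/-- `(M, ∈) ⊨ T`: the structure on `M` with true membership satisfies every sentence of `T`. -/
def ZModels (M : ZFSet) (T : SetLang.Theory) : Prop :=
  ∀ φ ∈ T, letI := zfStruct M; Sentence.Realize (M := {x : ZFSet // x ∈ M}) φ

/-- `(M, ∈) ⊨ φ[v₀, …, v_{k-1}]`: satisfaction of the formula `φ` in `M`, with the
(membership-checked) valuation `v` of its free variables. -/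
def ZRealize (M : ZFSet) {k : ℕ} (φ : BF k) (v : Fin k → ZFSet) : Prop :=
  ∀ h : ∀ i, v i ∈ M,
    letI := zfStruct M
    BoundedFormula.Realize (M := {x : ZFSet // x ∈ M}) φ (fun e => e.elim) (fun i => ⟨v i, h i⟩)

/-- `x` is a (von Neumann) ordinal: a transitive set of transitive sets. -/
def IsOrd (x : ZFSet) : Prop := x.IsTransitive ∧ ∀ y ∈ x, ZFSet.IsTransitive y

section Part1
universe u
set_option linter.style.haveILetI false

/-! ## Satisfaction -/

def tv {n : ℕ} : SetLang.Term (Empty ⊕ Fin n) → Fin n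
  | .var (.inr i) => i
  | .var (.inl e) => e.elim
  | .func f _ => Empty.elim f

def relS {n : ℕ} (v : Fin n → ZFSet.{u}) : ∀ {l : ℕ}, memRel l →
    (Fin l → SetLang.Term (Empty ⊕ Fin n)) → Prop
  | _, .mem, ts => v (tv (ts 0)) ∈ v (tv (ts 1))

abbrev snc {n : ℕ} (v : Fin n → ZFSet.{u}) (x : ZFSet.{u}) : Fin (n + 1) → ZFSet.{u} :=
  Fin.snoc (α := fun _ => ZFSet.{u}) v x

def Sat (M : ZFSet.{u}) : ∀ {n : ℕ}, BF n → (Fin n → ZFSet.{u}) → Prop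
  | _, .falsum, _ => False
  | _, .equal s t, v => v (tv s) = v (tv t)
  | _, .rel R ts, v => relS v R ts
  | _, .imp φ ψ, v => Sat M φ v → Sat M ψ v
  | _, .all φ, v => ∀ x ∈ M, Sat M φ (snc v x)

abbrev El (M : ZFSet.{u}) := {x : ZFSet.{u} // x ∈ M}

/-- Realization in `M`. -/
abbrev Rz (M : ZFSet.{u}) {n : ℕ} (φ : BF n) (v : Fin n → El M) : Prop :=
  letI := zfStruct M
  BoundedFormula.Realize (M := El M) φ (fun e => e.elim) v

theorem term_realize {M : ZFSet.{u}} {n : ℕ} (t : SetLang.Term (Empty ⊕ Fin n))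
    (e : Empty → El M) (v : Fin n → El M) :
    (letI := zfStruct M; t.realize (Sum.elim e v)) = v (tv t) := by
  match t with
  | .var (.inr i) => rfl
  | .var (.inl e) => exact e.elim
  | .func f _ => exact Empty.elim f

theorem rz_iff {M : ZFSet.{u}} {n : ℕ} (φ : BF n) (v : Fin n → El M) :
    Rz M φ v ↔ Sat M φ (fun i => (v i).1) := by
  induction φ with
  | falsum => rfl
  | equal s t =>
    simp only [Rz, BoundedFormula.Realize, Sat, term_realize]
    exact Subtype.ext_iff
  | rel R ts =>
    cases R
    simp only [Rz, BoundedFormula.Realize, Sat, term_realize]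
    rfl
  | imp φ ψ h1 h2 => exact imp_congr (h1 v) (h2 v)
  | all φ h =>
    have : Rz M φ.all v ↔ ∀ x : El M, Rz M φ (Fin.snoc v x) := Iff.rfl
    rw [this]
    constructor
    · intro H x hx
      have := (h _).1 (H ⟨x, hx⟩)
      convert this using 1
      funext i
      refine Fin.lastCases ?_ (fun i => ?_) i <;> simp [snc]
    · intro H x
      refine (h _).2 ?_
      have := H x.1 x.2
      convert this using 1
      funext i
      refine Fin.lastCases ?_ (fun i => ?_) i <;> simp [snc]

theorem sat_iff {M : ZFSet.{u}} {n : ℕ} (φ : BF n) (v : Fin n → ZFSet.{u}) (h : ∀ i, v i ∈ M) :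
    Sat M φ v ↔ Rz M φ (fun i => ⟨v i, h i⟩) :=
  (rz_iff φ (fun i => (⟨v i, h i⟩ : El M))).symm

section
variable {M : ZFSet.{u}} {n : ℕ} (v : Fin n → El M)

theorem rz_memf (i j : Fin n) : Rz M (memf i j) v ↔ (v i).1 ∈ (v j).1 := rz_iff _ _
theorem rz_eqf (i j : Fin n) : Rz M (eqf i j) v ↔ (v i).1 = (v j).1 := rz_iff _ _
theorem rz_imp (φ ψ : BF n) : Rz M (φ.imp ψ) v ↔ (Rz M φ v → Rz M ψ v) := Iff.rfl
theorem rz_not (φ : BF n) : Rz M φ.not v ↔ ¬ Rz M φ v := Iff.rfl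
theorem rz_and (φ ψ : BF n) : Rz M (andF φ ψ) v ↔ (Rz M φ v ∧ Rz M ψ v) := by
  simp only [andF, rz_not, rz_imp]; tauto
theorem rz_or (φ ψ : BF n) : Rz M (orF φ ψ) v ↔ (Rz M φ v ∨ Rz M ψ v) := by
  simp only [orF, rz_not, rz_imp]; tauto
theorem rz_iffF (φ ψ : BF n) : Rz M (iffF φ ψ) v ↔ (Rz M φ v ↔ Rz M ψ v) := by
  simp only [iffF, rz_and, rz_imp]; tauto
theorem rz_all (φ : BF (n + 1)) : Rz M φ.all v ↔ ∀ x : El M, Rz M φ (Fin.snoc v x) := Iff.rfl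
theorem rz_ex (φ : BF (n + 1)) : Rz M φ.ex v ↔ ∃ x : El M, Rz M φ (Fin.snoc v x) := by
  letI := zfStruct M
  exact BoundedFormula.realize_ex
theorem rz_reindex {m : ℕ} (f : Fin m → Fin n) (φ : BF m) :
    Rz M (reindex f φ) v ↔ Rz M φ (v ∘ f) := by
  letI := zfStruct M
  unfold Rz reindex
  refine (BoundedFormula.realize_relabel (n := 0)).trans ?_
  have : (v ∘ Fin.natAdd n : Fin 0 → El M) = default := Subsingleton.elim _ _
  erw [this]
  refine (BoundedFormula.realize_toFormula φ _).trans ?_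
  apply iff_of_eq
  congr 1
theorem rz_alls (φ : BF n) : Rz M φ.alls (default : Fin 0 → El M) ↔ ∀ v : Fin n → El M, Rz M φ v := by
  letI := zfStruct M
  unfold Rz
  have := BoundedFormula.realize_alls (φ := φ) (v := (fun e => e.elim : Empty → El M))
  exact this
end

theorem zmodels_iff (M : ZFSet.{u}) (T : SetLang.Theory) :
    ZModels M T ↔ ∀ φ ∈ T, Rz M (n := 0) φ default := by
  unfold ZModels
  refine forall₂_congr fun φ _ => ?_
  letI := zfStruct M
  apply iff_of_eq
  unfold Rz
  change Sentence.Realize (El M) φ = _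
  unfold Sentence.Realize Formula.Realize
  congr 1
  funext e; exact e.elim

/-! ## Uniform definability over transitive sets -/

class UD {n : ℕ} (R : ZFSet.{u} → (Fin n → ZFSet.{u}) → Prop) : Prop where
  out : ∃ φ : BF n, ∀ M : ZFSet.{u}, M.IsTransitive → ∀ v, (∀ i, v i ∈ M) → (Sat M φ v ↔ R M v)

class Proj {n : ℕ} (t : ZFSet.{u} → (Fin n → ZFSet.{u}) → ZFSet.{u}) : Prop where
  out : ∃ i, ∀ M v, t M v = v i

section
variable {n : ℕ} {A B : ZFSet.{u} → (Fin n → ZFSet.{u}) → Prop}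
  {R : ZFSet.{u} → (Fin n → ZFSet.{u}) → ZFSet.{u} → Prop}
  {s t r : ZFSet.{u} → (Fin n → ZFSet.{u}) → ZFSet.{u}}

instance projVar (i : Fin n) : Proj (fun (_ : ZFSet.{u}) v => v i) := ⟨i, fun _ _ => rfl⟩

theorem UD.congr [h : UD A] (H : ∀ M : ZFSet.{u}, M.IsTransitive → ∀ v, (∀ i, v i ∈ M) →
    (B M v ↔ A M v)) : UD B := by
  obtain ⟨φ, hφ⟩ := h.out
  exact ⟨φ, fun M hM v hv => (hφ M hM v hv).trans (H M hM v hv).symm⟩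

instance udFalse : UD (n := n) (fun (_ : ZFSet.{u}) _ => False) := ⟨.falsum, fun _ _ _ _ => Iff.rfl⟩

instance udImp [ha : UD A] [hb : UD B] : UD (fun M v => A M v → B M v) := by
  obtain ⟨φ, hφ⟩ := ha.out
  obtain ⟨ψ, hψ⟩ := hb.out
  exact ⟨φ.imp ψ, fun M hM v hv => imp_congr (hφ M hM v hv) (hψ M hM v hv)⟩

instance udNot [ha : UD A] : UD (fun M v => ¬ A M v) := udImp (B := fun _ _ => False)

instance udAnd [ha : UD A] [hb : UD B] : UD (fun M v => A M v ∧ B M v) :=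
  UD.congr (A := fun M v => ¬ (A M v → ¬ B M v)) (by intros; tauto)

instance udOr [ha : UD A] [hb : UD B] : UD (fun M v => A M v ∨ B M v) :=
  UD.congr (A := fun M v => ¬ A M v → B M v) (by intros; tauto)

instance udIff [ha : UD A] [hb : UD B] : UD (fun M v => A M v ↔ B M v) :=
  UD.congr (A := fun M v => (A M v → B M v) ∧ (B M v → A M v)) (by intros; tauto)

theorem snc_cast (v : Fin n → ZFSet.{u}) (x : ZFSet.{u}) : (fun i => snc v x (Fin.castSucc i)) = v := by
  funext i; simp [snc]

theorem snc_last (v : Fin n → ZFSet.{u}) (x : ZFSet.{u}) : snc v x (Fin.last n) = x := by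
  simp [snc]

theorem snc_mem {M : ZFSet.{u}} {v : Fin n → ZFSet.{u}} (hv : ∀ i, v i ∈ M) {x : ZFSet.{u}}
    (hx : x ∈ M) : ∀ i, snc v x i ∈ M := by
  intro i
  refine Fin.lastCases ?_ (fun i => ?_) i
  · simpa [snc] using hx
  · simpa [snc] using hv i

instance udAll [h : UD (fun M (w : Fin (n+1) → ZFSet.{u}) => R M (fun i => w (Fin.castSucc i)) (w (Fin.last n)))] :
    UD (fun M v => ∀ x, x ∈ M → R M v x) := by
  obtain ⟨φ, hφ⟩ := h.out
  refine ⟨φ.all, fun M hM v hv => forall₂_congr fun x hx => ?_⟩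
  have := hφ M hM (snc v x) (snc_mem hv hx)
  rw [this, snc_cast, snc_last]

instance udEx [h : UD (fun M (w : Fin (n+1) → ZFSet.{u}) => R M (fun i => w (Fin.castSucc i)) (w (Fin.last n)))] :
    UD (fun M v => ∃ x, x ∈ M ∧ R M v x) :=
  UD.congr (A := fun M v => ¬ ∀ x, x ∈ M → ¬ R M v x) (by intros; push Not; rfl)

instance udMem [hs : Proj s] [ht : Proj t] : UD (fun M v => s M v ∈ t M v) := by
  obtain ⟨i, hi⟩ := hs.out
  obtain ⟨j, hj⟩ := ht.out
  exact ⟨memf i j, fun M _ v _ => by rw [hi, hj]; rfl⟩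

instance udEq [hs : Proj s] [ht : Proj t] : UD (fun M v => s M v = t M v) := by
  obtain ⟨i, hi⟩ := hs.out
  obtain ⟨j, hj⟩ := ht.out
  exact ⟨eqf i j, fun M _ v _ => by rw [hi, hj]; rfl⟩

theorem UD.sub {m : ℕ} {Q : ZFSet.{u} → (Fin m → ZFSet.{u}) → Prop} (hQ : UD Q)
    (f : Fin m → Fin n) : UD (fun M v => Q M (fun i => v (f i))) := by
  obtain ⟨φ, hφ⟩ := hQ.out
  refine ⟨reindex f φ, fun M hM v hv => ?_⟩
  rw [sat_iff _ _ hv, rz_reindex, ← hφ M hM (fun i => v (f i)) (fun i => hv _), rz_iff]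
  rfl

theorem Proj.mem [ht : Proj t] {M : ZFSet.{u}} {v} (hv : ∀ i, v i ∈ M) : t M v ∈ M := by
  obtain ⟨i, hi⟩ := ht.out
  rw [hi]; exact hv i

theorem UD.app {m : ℕ} {Q : ZFSet.{u} → (Fin m → ZFSet.{u}) → Prop} (hQ : UD Q)
    (t : Fin m → ZFSet.{u} → (Fin n → ZFSet.{u}) → ZFSet.{u}) (ht : ∀ i, Proj (t i)) :
    UD (fun M v => Q M (fun i => t i M v)) := by
  choose f hf using fun i => (ht i).out
  have := hQ.sub f
  refine this.congr fun M _ v _ => ?_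
  simp only [hf]

theorem UD.app1 {Q : ZFSet.{u} → ZFSet.{u} → Prop} (hQ : UD (n := 1) fun M v => Q M (v 0))
    [hs : Proj s] : UD (fun M v => Q M (s M v)) :=
  hQ.app ![s] (by simpa using hs)
theorem UD.app2 {Q : ZFSet.{u} → ZFSet.{u} → ZFSet.{u} → Prop}
    (hQ : UD (n := 2) fun M v => Q M (v 0) (v 1))
    [hs : Proj s] [ht : Proj t] : UD (fun M v => Q M (s M v) (t M v)) :=
  hQ.app ![s, t] (by simp [Fin.forall_fin_succ]; exact ⟨hs, ht⟩)
theorem UD.app3 {Q : ZFSet.{u} → ZFSet.{u} → ZFSet.{u} → ZFSet.{u} → Prop}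
    (hQ : UD (n := 3) fun M v => Q M (v 0) (v 1) (v 2))
    [hs : Proj s] [ht : Proj t] [hr : Proj r] : UD (fun M v => Q M (s M v) (t M v) (r M v)) :=
  hQ.app ![s, t, r] (by simp [Fin.forall_fin_succ]; exact ⟨hs, ht, hr⟩)
theorem UD.app4 {q : ZFSet.{u} → (Fin n → ZFSet.{u}) → ZFSet.{u}}
    {Q : ZFSet.{u} → ZFSet.{u} → ZFSet.{u} → ZFSet.{u} → ZFSet.{u} → Prop}
    (hQ : UD (n := 4) fun M v => Q M (v 0) (v 1) (v 2) (v 3))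
    [hs : Proj s] [ht : Proj t] [hr : Proj r] [hq : Proj q] :
    UD (fun M v => Q M (s M v) (t M v) (r M v) (q M v)) :=
  hQ.app ![s, t, r, q] (by simp [Fin.forall_fin_succ]; exact ⟨hs, ht, hr, hq⟩)
end

theorem trans_mem {M x y : ZFSet.{u}} (hM : M.IsTransitive) (h : x ∈ y) (hy : y ∈ M) : x ∈ M :=
  hM.subset_of_mem hy h

section
variable {n : ℕ} 
  {R : ZFSet.{u} → (Fin n → ZFSet.{u}) → ZFSet.{u} → Prop}
  {s t r q : ZFSet.{u} → (Fin n → ZFSet.{u}) → ZFSet.{u}}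

-- bounded quantifiers
instance (priority := 900) udAllIn [ht : Proj t] 
    [h : UD (fun M (w : Fin (n+1) → ZFSet.{u}) => R M (fun i => w (Fin.castSucc i)) (w (Fin.last n)))] :
    UD (fun M v => ∀ x, x ∈ t M v → R M v x) := by
  obtain ⟨i, hi⟩ := ht.out
  refine UD.congr (A := fun M v => ∀ x, x ∈ M → x ∈ v i → R M v x) ?_
  intro M hM v hv
  simp only [hi]
  exact ⟨fun H x _ hx => H x hx, fun H x hx => H x (trans_mem hM hx (hv i)) hx⟩

instance (priority := 900) udExIn [ht : Proj t] 
    [h : UD (fun M (w : Fin (n+1) → ZFSet.{u}) => R M (fun i => w (Fin.castSucc i)) (w (Fin.last n)))] :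
    UD (fun M v => ∃ x, x ∈ t M v ∧ R M v x) := 
  UD.congr (A := fun M v => ¬ ∀ x, x ∈ t M v → ¬ R M v x) (by intros; push Not; rfl)

instance udSub [Proj s] [Proj t] : UD (fun M v => s M v ⊆ t M v) :=
  UD.app2 (Q := fun _ x y => x ⊆ y) <|
    UD.congr (n := 2) (A := fun _ v => ∀ x, x ∈ v 0 → x ∈ v 1) (by intros; rfl)

instance udEmpty [Proj s] : UD (fun M v => s M v = ∅) :=
  UD.app1 (Q := fun _ x => x = ∅) <|
    UD.congr (n := 1) (A := fun _ v => ∀ x, x ∈ v 0 → False) (by intros; exact ZFSet.eq_empty _)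

instance udUpair [Proj s] [Proj t] [Proj r] : UD (fun M v => s M v = {t M v, r M v}) :=
  UD.app3 (Q := fun _ x y z => x = {y, z}) <|
    UD.congr (n := 3) (A := fun _ v => (v 1 ∈ v 0 ∧ v 2 ∈ v 0) ∧ ∀ x, x ∈ v 0 → x = v 1 ∨ x = v 2) (by
      intro M hM v _
      rw [ZFSet.ext_iff]; simp only [ZFSet.mem_pair]
      constructor
      · intro h; exact ⟨⟨(h _).2 (.inl rfl), (h _).2 (.inr rfl)⟩, fun x => (h x).1⟩
      · rintro ⟨⟨h1, h2⟩, h3⟩ z; exact ⟨h3 z, by rintro (rfl | rfl) <;> assumption⟩)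

instance udPair [Proj s] [Proj t] [Proj r] : UD (fun M v => s M v = ZFSet.pair (t M v) (r M v)) :=
  UD.app3 (Q := fun _ x y z => x = ZFSet.pair y z) <|
    UD.congr (n := 3) (A := fun _ v => ∃ a, a ∈ v 0 ∧ ∃ b, b ∈ v 0 ∧ a = {v 1, v 1} ∧ b = {v 1, v 2} ∧
        v 0 = {a, b}) (by
      intro M hM v _
      simp only [ZFSet.pair, ZFSet.pair_eq_singleton]
      constructor
      · intro h; rw [h]; exact ⟨_, by simp, _, by simp, rfl, rfl, rfl⟩
      · rintro ⟨a, _, b, _, rfl, rfl, h⟩; exact h)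

instance udPairMem [Proj s] [Proj t] [Proj r] : UD (fun M v => ZFSet.pair (t M v) (r M v) ∈ s M v) :=
  UD.app3 (Q := fun _ x y z => ZFSet.pair y z ∈ x) <|
    UD.congr (n := 3) (A := fun _ v => ∃ a, a ∈ v 0 ∧ a = ZFSet.pair (v 1) (v 2)) (by
      intro M hM v _; simp)

instance udTrans [Proj s] : UD (fun M v => (s M v).IsTransitive) :=
  UD.app1 (Q := fun _ x => x.IsTransitive) <|
    UD.congr (n := 1) (A := fun _ v => ∀ x, x ∈ v 0 → x ⊆ v 0) (by intros; rfl)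

instance udOrd [Proj s] : UD (fun M v => IsOrd (s M v)) :=
  UD.app1 (Q := fun _ x => IsOrd x) <|
    UD.congr (n := 1) (A := fun _ v => (v 0).IsTransitive ∧ ∀ x, x ∈ v 0 → x.IsTransitive)
      (by intros; rfl)
end

theorem pair_mem_of {M x y z : ZFSet.{u}} (hM : M.IsTransitive) (h : ZFSet.pair x y ∈ z) (hz : z ∈ M) :
    x ∈ M ∧ y ∈ M := by
  have h1 := trans_mem hM h hz
  have h2 : ({x, y} : ZFSet) ∈ M := trans_mem hM (by simp [ZFSet.pair]) h1
  exact ⟨trans_mem hM (by simp) h2, trans_mem hM (by simp) h2⟩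

section
variable {n : ℕ} {s t r q : ZFSet.{u} → (Fin n → ZFSet.{u}) → ZFSet.{u}}
instance udTripMem [Proj s] [Proj t] [Proj r] [Proj q] :
    UD (fun M v => ZFSet.pair (t M v) (ZFSet.pair (r M v) (q M v)) ∈ s M v) :=
  UD.app4 (Q := fun _ w x y z => ZFSet.pair x (ZFSet.pair y z) ∈ w) <|
    UD.congr (n := 4) (A := fun M v => ∃ a, a ∈ M ∧ a = ZFSet.pair (v 2) (v 3) ∧ ZFSet.pair (v 1) a ∈ v 0) (by
      intro M hM v hv
      constructor
      · intro h; exact ⟨_, (pair_mem_of hM h (hv 0)).2, rfl, h⟩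
      · rintro ⟨a, _, rfl, h⟩; exact h)
instance udPairMem2 [Proj s] [Proj t] [Proj r] [Proj q] :
    UD (fun M v => ZFSet.pair (ZFSet.pair (t M v) (r M v)) (q M v) ∈ s M v) :=
  UD.app4 (Q := fun _ w x y z => ZFSet.pair (ZFSet.pair x y) z ∈ w) <|
    UD.congr (n := 4) (A := fun M v => ∃ a, a ∈ M ∧ a = ZFSet.pair (v 1) (v 2) ∧ ZFSet.pair a (v 3) ∈ v 0) (by
      intro M hM v hv
      constructor
      · intro h; exact ⟨_, (pair_mem_of hM h (hv 0)).1, rfl, h⟩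
      · rintro ⟨a, _, rfl, h⟩; exact h)

-- test
example : UD (n := 2) (fun M v => ∃ x ∈ M, ∀ y ∈ x, ∃ z ∈ v 0, ZFSet.pair x y ∈ z ∧ ¬ ZFSet.pair (v 0) (ZFSet.pair z y) ∈ v 1) := inferInstance
end
end Part1

section Part2
universe u
set_option linter.unusedVariables false
variable {M : ZFSet.{u}} 

theorem el_all (hM : M.IsTransitive) {a : ZFSet.{u}} (ha : a ∈ M) {p : ZFSet.{u} → Prop} :
    (∀ x : El M, x.1 ∈ a → p x.1) ↔ ∀ x ∈ a, p x :=
  ⟨fun h x hx => h ⟨x, trans_mem hM hx ha⟩ hx, fun h x hx => h _ hx⟩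
theorem el_ex (hM : M.IsTransitive) {a : ZFSet.{u}} (ha : a ∈ M) {p : ZFSet.{u} → Prop} :
    (∃ x : El M, x.1 ∈ a ∧ p x.1) ↔ ∃ x ∈ a, p x :=
  ⟨fun ⟨x, h⟩ => ⟨_, h⟩, fun ⟨x, h, h'⟩ => ⟨⟨x, trans_mem hM h ha⟩, h, h'⟩⟩

theorem el_ext (hM : M.IsTransitive) {a : ZFSet.{u}} (ha : a ∈ M) {b : ZFSet.{u}} (hb : ∀ z ∈ b, z ∈ M) :
    (∀ x : El M, x.1 ∈ a ↔ x.1 ∈ b) ↔ a = b := by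
  constructor
  · intro h; ext z; exact ⟨fun hz => (h ⟨z, trans_mem hM hz ha⟩).1 hz, fun hz => (h ⟨z, hb z hz⟩).2 hz⟩
  · rintro rfl x; rfl

theorem rz_subF (hM : M.IsTransitive) (v : Fin 2 → El M) : Rz M subF v ↔ (v 0).1 ⊆ (v 1).1 := by
  simp only [subF, rz_all, rz_imp, rz_memf]
  exact el_all hM (v 0).2 (p := fun x => x ∈ (v 1).1)
theorem rz_emptyF (hM : M.IsTransitive) (v : Fin 1 → El M) : Rz M emptyF v ↔ (v 0).1 = ∅ := by
  simp only [emptyF, rz_all, rz_not, rz_memf]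
  exact (el_all hM (v 0).2 (p := fun _ => False)).trans (ZFSet.eq_empty _).symm
theorem rz_pairSetF (hM : M.IsTransitive) (v : Fin 3 → El M) :
    Rz M pairSetF v ↔ (v 2).1 = {(v 0).1, (v 1).1} := by
  simp only [pairSetF, rz_all, rz_iffF, rz_or, rz_memf, rz_eqf]
  refine Iff.trans ?_ (el_ext hM (v 2).2 (b := {(v 0).1, (v 1).1}) ?_)
  · refine forall_congr' fun x => ?_
    rw [ZFSet.mem_pair]; rfl
  · simp
theorem rz_singF (hM : M.IsTransitive) (v : Fin 2 → El M) :
    Rz M singF v ↔ (v 1).1 = {(v 0).1} := by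
  simp only [singF, rz_reindex, rz_pairSetF hM]
  simp


def PairCl (M : ZFSet.{u}) : Prop := ∀ x ∈ M, ∀ y ∈ M, ({x, y} : ZFSet.{u}) ∈ M

theorem PairCl.sing (hp : PairCl M) {x : ZFSet.{u}} (hx : x ∈ M) : ({x} : ZFSet.{u}) ∈ M := by
  simpa using hp x hx x hx
theorem PairCl.pair (hp : PairCl M) {x y : ZFSet.{u}} (hx : x ∈ M) (hy : y ∈ M) :
    ZFSet.pair x y ∈ M := hp _ (hp.sing hx) _ (hp _ hx _ hy)

theorem rz_opF (hM : M.IsTransitive) (hp : PairCl M) (v : Fin 3 → El M) :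
    Rz M opF v ↔ (v 2).1 = ZFSet.pair (v 0).1 (v 1).1 := by
  simp only [opF, rz_all, rz_iffF, rz_or, rz_memf, rz_reindex, rz_singF hM, rz_pairSetF hM]
  refine Iff.trans ?_ (el_ext hM (v 2).2 (b := ZFSet.pair (v 0).1 (v 1).1) ?_)
  · refine forall_congr' fun x => ?_
    simp [ZFSet.pair, Fin.snoc]; rfl
  · simp only [ZFSet.pair, ZFSet.mem_pair]
    rintro z (rfl | rfl)
    · exact hp.sing (v 0).2
    · exact hp _ (v 0).2 _ (v 1).2
theorem rz_succF (hM : M.IsTransitive) (v : Fin 2 → El M) :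
    Rz M succF v ↔ (v 1).1 = insert (v 0).1 (v 0).1 := by
  simp only [succF, rz_all, rz_iffF, rz_or, rz_memf, rz_eqf]
  refine Iff.trans ?_ (el_ext hM (v 1).2 (b := insert (v 0).1 (v 0).1) ?_)
  · refine forall_congr' fun x => ?_
    simp [Fin.snoc, or_comm]
  · simp only [ZFSet.mem_insert_iff]
    rintro z (rfl | h)
    · exact (v 0).2
    · exact trans_mem hM h (v 0).2
theorem rz_transF (hM : M.IsTransitive) (v : Fin 1 → El M) :
    Rz M transF v ↔ (v 0).1.IsTransitive := by
  simp only [transF, rz_all, rz_imp, rz_memf, rz_reindex, rz_subF hM]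
  exact el_all hM (v 0).2 (p := fun x => x ⊆ (v 0).1)
theorem rz_ordF (hM : M.IsTransitive) (v : Fin 1 → El M) :
    Rz M ordF v ↔ IsOrd (v 0).1 := by
  simp only [ordF, rz_and, rz_all, rz_imp, rz_memf, rz_reindex, rz_transF hM]
  exact and_congr Iff.rfl (el_all hM (v 0).2 (p := fun x => x.IsTransitive))
theorem rz_relMemF (hM : M.IsTransitive) (hp : PairCl M) (v : Fin 3 → El M) :
    Rz M relMemF v ↔ ZFSet.pair (v 0).1 (v 1).1 ∈ (v 2).1 := by
  simp only [relMemF, rz_ex, rz_and, rz_memf, rz_reindex, rz_opF hM hp]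
  constructor
  · rintro ⟨x, h1, h2⟩
    change x.1 = ZFSet.pair (v 0).1 (v 1).1 at h1
    rw [← h1]; exact h2
  · intro h
    exact ⟨⟨_, trans_mem hM h (v 2).2⟩, rfl, h⟩

/-- `f` is a function from `a` onto `b`. -/
def Surj (f a b : ZFSet.{u}) : Prop :=
  (∀ z ∈ f, ∃ x ∈ a, ∃ y ∈ b, z = ZFSet.pair x y) ∧ (∀ x ∈ a, ∃ y ∈ b, ZFSet.pair x y ∈ f) ∧
  (∀ x y y', ZFSet.pair x y ∈ f → ZFSet.pair x y' ∈ f → y = y') ∧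
  (∀ y ∈ b, ∃ x ∈ a, ZFSet.pair x y ∈ f)

theorem rz_isFuncF (hM : M.IsTransitive) (hp : PairCl M) (v : Fin 3 → El M) :
    Rz M isFuncF v ↔ Surj (v 2).1 (v 0).1 (v 1).1 := by
  simp only [isFuncF, rz_ex, rz_all, rz_imp, rz_and, rz_memf, rz_eqf, rz_reindex, rz_opF hM hp,
    rz_relMemF hM hp, Surj, and_assoc]
  refine and_congr ?_ (and_congr ?_ (and_congr ?_ ?_))
  · refine Iff.trans (forall_congr' fun x => imp_congr Iff.rfl ?_)
      (el_all hM (v 2).2 (p := fun z => ∃ x ∈ (v 0).1, ∃ y ∈ (v 1).1, z = ZFSet.pair x y))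
    constructor
    · rintro ⟨a, b, h1, h2, h3⟩; exact ⟨a, h1, b, h2, h3⟩
    · rintro ⟨a, h1, b, h2, h3⟩
      exact ⟨⟨a, trans_mem hM h1 (v 0).2⟩, ⟨b, trans_mem hM h2 (v 1).2⟩, h1, h2, h3⟩
  · refine Iff.trans (forall_congr' fun x => imp_congr Iff.rfl ?_)
      (el_all hM (v 0).2 (p := fun x => ∃ y ∈ (v 1).1, ZFSet.pair x y ∈ (v 2).1))
    exact el_ex hM (v 1).2 (p := fun y => ZFSet.pair x.1 y ∈ (v 2).1)
  · constructor
    · intro h x y y' h1 h2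
      obtain ⟨hx, hy⟩ := pair_mem_of hM h1 (v 2).2
      obtain ⟨_, hy'⟩ := pair_mem_of hM h2 (v 2).2
      exact h ⟨x, hx⟩ ⟨y, hy⟩ ⟨y', hy'⟩ ⟨h1, h2⟩
    · intro h x y y' hh
      exact h x.1 y.1 y'.1 hh.1 hh.2
  · refine Iff.trans (forall_congr' fun x => imp_congr Iff.rfl ?_)
      (el_all hM (v 1).2 (p := fun y => ∃ x ∈ (v 0).1, ZFSet.pair x y ∈ (v 2).1))
    exact el_ex hM (v 0).2 (p := fun y => ZFSet.pair y x.1 ∈ (v 2).1)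

theorem rz_injF (hM : M.IsTransitive) (hp : PairCl M) (v : Fin 3 → El M) :
    Rz M injF v ↔ ∀ x x' y, ZFSet.pair x y ∈ (v 2).1 → ZFSet.pair x' y ∈ (v 2).1 → x = x' := by
  simp only [injF, rz_all, rz_imp, rz_and, rz_eqf, rz_reindex, rz_relMemF hM hp]
  constructor
  · intro h x x' y h1 h2
    obtain ⟨hx, hy⟩ := pair_mem_of hM h1 (v 2).2
    obtain ⟨hx', _⟩ := pair_mem_of hM h2 (v 2).2
    exact h ⟨x, hx⟩ ⟨x', hx'⟩ ⟨y, hy⟩ ⟨h1, h2⟩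
  · intro h x y y' hh
    exact h x.1 y.1 y'.1 hh.1 hh.2

theorem rz_powF (hM : M.IsTransitive) (v : Fin 2 → El M) :
    Rz M powF v ↔ ∀ z, z ∈ (v 1).1 ↔ z ∈ M ∧ z ⊆ (v 0).1 := by
  simp only [powF, rz_all, rz_iffF, rz_memf, rz_reindex, rz_subF hM]
  constructor
  · intro h z
    constructor
    · intro hz
      have hz' := trans_mem hM hz (v 1).2
      exact ⟨hz', (h ⟨z, hz'⟩).1 hz⟩
    · rintro ⟨hz', hz⟩
      exact (h ⟨z, hz'⟩).2 hz
  · intro h z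
    exact (h z.1).trans ⟨fun h => h.2, fun h => ⟨z.2, h⟩⟩

/-- Being the first infinite ordinal, internally. -/
def IsOm (w : ZFSet.{u}) : Prop :=
  (IsOrd w ∧ ∅ ∈ w) ∧ (∀ x ∈ w, insert x x ∈ w) ∧ (∀ x ∈ w, x = ∅ ∨ ∃ y ∈ x, x = insert y y)

theorem rz_omegaF (hM : M.IsTransitive) (v : Fin 1 → El M) (h : Rz M omegaF v) : IsOm (v 0).1 := by
  simp only [omegaF, rz_ex, rz_all, rz_imp, rz_and, rz_or, rz_memf, rz_reindex, rz_ordF hM,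
    rz_emptyF hM, rz_succF hM] at h
  obtain ⟨⟨h1, h2⟩, h3, h4⟩ := h
  refine ⟨⟨h1, ?_⟩, ?_, ?_⟩
  · obtain ⟨x, hx, h⟩ := h2
    change x.1 = ∅ at h
    rw [← h]; exact hx
  · intro x hx
    obtain ⟨y, hy, h⟩ := h3 ⟨x, trans_mem hM hx (v 0).2⟩ hx
    change y.1 = insert x x at h
    rw [← h]; exact hy
  · intro x hx
    rcases h4 ⟨x, trans_mem hM hx (v 0).2⟩ hx with h | ⟨y, hy, h⟩
    · exact .inl h
    · exact .inr ⟨y.1, hy, h⟩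

def IsA1 (M w a : ZFSet.{u}) : Prop :=
  (IsOrd a ∧ ¬ ∃ f ∈ M, Surj f w a) ∧ ∀ b ∈ a, b = ∅ ∨ ∃ f ∈ M, Surj f w b

theorem rz_alephOneF (hM : M.IsTransitive) (hp : PairCl M) (v : Fin 2 → El M)
    (h : Rz M alephOneF v) : IsA1 M (v 0).1 (v 1).1 := by
  simp only [alephOneF, rz_ex, rz_all, rz_imp, rz_and, rz_or, rz_not, rz_memf, rz_reindex,
    rz_ordF hM, rz_emptyF hM, rz_isFuncF hM hp] at h
  obtain ⟨⟨h1, h2⟩, h3⟩ := h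
  refine ⟨⟨h1, ?_⟩, ?_⟩
  · rintro ⟨f, hf, h⟩; exact h2 ⟨⟨f, hf⟩, h⟩
  · intro b hb
    rcases h3 ⟨b, trans_mem hM hb (v 1).2⟩ hb with h | ⟨f, h⟩
    · exact .inl h
    · exact .inr ⟨f.1, f.2, h⟩

theorem rz_ch (hM : M.IsTransitive) (hp : PairCl M) (h : Rz M (n := 0) chSent default) :
    ∃ w ∈ M, ∃ c ∈ M, ∃ a ∈ M, ∃ f ∈ M, IsOm w ∧ (∀ z, z ∈ c ↔ z ∈ M ∧ z ⊆ w) ∧ IsA1 M w a ∧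
      Surj f c a ∧ ∀ x x' y, ZFSet.pair x y ∈ f → ZFSet.pair x' y ∈ f → x = x' := by
  unfold chSent bijF at h
  simp only [rz_ex, rz_and, rz_reindex, rz_powF hM, rz_isFuncF hM hp, rz_injF hM hp] at h
  obtain ⟨w, c, a, f, ⟨h1, h2⟩, h3, h4, h5⟩ := h
  exact ⟨w, w.2, c, c.2, a, a.2, f, f.2, rz_omegaF hM _ h1, h2, rz_alephOneF hM hp _ h3, h4, h5⟩
end Part2

section Part3
universe u
set_option linter.unusedVariables false
variable {M : ZFSet.{u}} 

structure ZM0 (M : ZFSet.{u}) : Prop where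
  tr : M.IsTransitive
  pair : PairCl M
  un : ∀ x ∈ M, (ZFSet.sUnion x : ZFSet.{u}) ∈ M
  pow : ∀ x ∈ M, ZFSet.sep (· ∈ M) (ZFSet.powerset x) ∈ M
  inf : ∃ x ∈ M, ∅ ∈ x ∧ ∀ y ∈ x, insert y y ∈ x
  sep : ∀ (n : ℕ) (φ : BF (n + 1)) (v : Fin n → ZFSet.{u}), (∀ i, v i ∈ M) → ∀ a ∈ M,
    ZFSet.sep (fun x => Sat M φ (snc v x)) a ∈ M
structure ZM (M : ZFSet.{u}) : Prop extends ZM0 M where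
  ac : ∀ x ∈ M, ∃ α ∈ M, IsOrd α ∧ ∃ f ∈ M, Surj f α x

/-- Replacement, semantically. -/
def Repl (M : ZFSet.{u}) {n : ℕ} (φ : BF (n + 2)) : Prop :=
  ∀ v : Fin n → ZFSet.{u}, (∀ i, v i ∈ M) → ∀ A ∈ M,
    (∀ x ∈ A, ∀ y ∈ M, ∀ y' ∈ M, Sat M φ (snc (snc v x) y) → Sat M φ (snc (snc v x) y') → y = y') →
    ∃ B ∈ M, ∀ y, y ∈ B ↔ y ∈ M ∧ ∃ x ∈ A, Sat M φ (snc (snc v x) y)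

theorem rz_ext (hM : M.IsTransitive) : Rz M (n := 0) extAx default := by
  unfold extAx
  simp only [rz_all, rz_imp, rz_and, rz_reindex, rz_subF hM, rz_eqf]
  rintro x y ⟨h1, h2⟩
  exact le_antisymm (α := ZFSet) h1 h2

theorem rz_found (hM : M.IsTransitive) : Rz M (n := 0) foundAx default := by
  unfold foundAx
  simp only [rz_all, rz_ex, rz_imp, rz_and, rz_not, rz_memf]
  rintro x ⟨y, hy⟩
  change y.1 ∈ x.1 at hy
  obtain ⟨z, hz, h⟩ := ZFSet.regularity x.1 (by rintro h; rw [h] at hy; simp at hy)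
  refine ⟨⟨z, trans_mem hM hz x.2⟩, hz, fun w hw hw' => ?_⟩
  have : w.1 ∈ x.1 ∩ z := ZFSet.mem_inter.2 ⟨hw, hw'⟩
  rw [h] at this; simp at this

theorem rz_pair (hM : M.IsTransitive) : Rz M (n := 0) pairAx default ↔ PairCl M := by
  unfold pairAx
  simp only [rz_all, rz_ex, rz_pairSetF hM]
  constructor
  · intro h x hx y hy
    obtain ⟨z, hz⟩ := h ⟨x, hx⟩ ⟨y, hy⟩
    change z.1 = {x, y} at hz
    rw [← hz]; exact z.2
  · intro h x y
    exact ⟨⟨_, h x.1 x.2 y.1 y.2⟩, rfl⟩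

theorem rz_union (hM : M.IsTransitive) :
    Rz M (n := 0) unionAx default ↔ ∀ x ∈ M, (ZFSet.sUnion x : ZFSet.{u}) ∈ M := by
  unfold unionAx
  simp only [rz_all, rz_ex, rz_and, rz_iffF, rz_memf]
  constructor
  · intro h x hx
    obtain ⟨z, hz⟩ := h ⟨x, hx⟩
    have : z.1 = ZFSet.sUnion x := by
      rw [← el_ext hM z.2]
      · intro y
        refine (hz y).trans ?_
        rw [ZFSet.mem_sUnion]
        exact el_ex hM hx (p := fun z => y.1 ∈ z)
      · intro z hz
        obtain ⟨w, hw, h⟩ := ZFSet.mem_sUnion.1 hz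
        exact trans_mem hM h (trans_mem hM hw hx)
    rw [← this]; exact z.2
  · intro h x
    refine ⟨⟨_, h x.1 x.2⟩, fun y => ?_⟩
    refine Iff.trans (Iff.trans Iff.rfl ZFSet.mem_sUnion) ?_
    exact (el_ex hM x.2 (p := fun z => y.1 ∈ z)).symm

theorem rz_pow (hM : M.IsTransitive) :
    Rz M (n := 0) powAx default ↔ ∀ x ∈ M, ZFSet.sep (· ∈ M) (ZFSet.powerset x) ∈ M := by
  unfold powAx
  simp only [rz_all, rz_ex, rz_powF hM]
  constructor
  · intro h x hx
    obtain ⟨z, hz⟩ := h ⟨x, hx⟩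
    have : z.1 = ZFSet.sep (· ∈ M) (ZFSet.powerset x) := by
      ext w
      refine (hz w).trans ?_
      rw [ZFSet.mem_sep, ZFSet.mem_powerset]
      exact and_comm
    rw [← this]; exact z.2
  · intro h x
    refine ⟨⟨_, h x.1 x.2⟩, fun y => ?_⟩
    refine Iff.trans (Iff.trans Iff.rfl ZFSet.mem_sep) ?_
    rw [ZFSet.mem_powerset]
    exact and_comm

theorem rz_inf (hM : M.IsTransitive) :
    Rz M (n := 0) infAx default ↔ ∃ x ∈ M, ∅ ∈ x ∧ ∀ y ∈ x, insert y y ∈ x := by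
  unfold infAx
  simp only [rz_all, rz_ex, rz_imp, rz_and, rz_reindex, rz_memf, rz_emptyF hM, rz_succF hM]
  constructor
  · rintro ⟨x, ⟨y, hy, hy'⟩, h⟩
    refine ⟨x.1, x.2, ?_, ?_⟩
    · change y.1 = ∅ at hy'
      rw [← hy']; exact hy
    · intro z hz
      obtain ⟨w, hw, hw'⟩ := h ⟨z, trans_mem hM hz x.2⟩ hz
      change w.1 = insert z z at hw'
      rw [← hw']; exact hw
  · rintro ⟨x, hx, h1, h2⟩
    refine ⟨⟨x, hx⟩, ⟨⟨∅, trans_mem hM h1 hx⟩, h1, rfl⟩, fun y hy => ?_⟩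
    exact ⟨⟨_, trans_mem hM (h2 y.1 hy) hx⟩, h2 y.1 hy, rfl⟩

theorem rz_ac (hM : M.IsTransitive) (hp : PairCl M) :
    Rz M (n := 0) acAx default ↔ ∀ x ∈ M, ∃ α ∈ M, IsOrd α ∧ ∃ f ∈ M, Surj f α x := by
  unfold acAx
  simp only [rz_all, rz_ex, rz_and, rz_reindex, rz_ordF hM, rz_isFuncF hM hp]
  constructor
  · intro h x hx
    obtain ⟨a, f, h1, h2⟩ := h ⟨x, hx⟩
    exact ⟨a, a.2, h1, f, f.2, h2⟩
  · intro h x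
    obtain ⟨a, ha, h1, f, hf, h2⟩ := h x.1 x.2
    exact ⟨⟨a, ha⟩, ⟨f, hf⟩, h1, h2⟩

theorem snoc_last' {n : ℕ} (v : Fin n → El M) (x : El M) (k : ℕ) (hk : k = n) (h : k < n + 1) :
    (Fin.snoc v x : Fin (n+1) → El M) ⟨k, h⟩ = x := by
  subst hk; exact Fin.snoc_last (α := fun _ => El M) x v
theorem snoc_lt' {n : ℕ} (v : Fin n → El M) (x : El M) (k : ℕ) (hk : k < n) (h : k < n + 1) :
    (Fin.snoc v x : Fin (n+1) → El M) ⟨k, h⟩ = v ⟨k, hk⟩ :=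
  Fin.snoc_castSucc (α := fun _ => El M) x v ⟨k, hk⟩

theorem snc_val {n : ℕ} (v : Fin n → El M) (x : El M) :
    (fun i => ((Fin.snoc v x : Fin (n+1) → El M) i).1) = snc (fun i => (v i).1) x.1 := by
  funext i
  refine Fin.lastCases ?_ (fun i => ?_) i <;> simp [snc]

theorem rz_sep (hM : M.IsTransitive) {n : ℕ} (φ : BF (n + 1)) :
    Rz M (n := 0) (sepAx φ) default ↔ ∀ v : Fin n → ZFSet.{u}, (∀ i, v i ∈ M) → ∀ a ∈ M,
    ZFSet.sep (fun x => Sat M φ (snc v x)) a ∈ M := by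
  unfold sepAx
  simp only [rz_alls, rz_all, rz_ex, rz_and, rz_iffF, rz_reindex, rz_memf]
  have key : ∀ (v : Fin n → El M) (a b x : El M),
      ((Fin.snoc (Fin.snoc (Fin.snoc v a : Fin (n+1) → El M) b : Fin (n+2) → El M) x : Fin (n+3) → El M)
        ∘ fun i : Fin (n+1) => if h : (i : ℕ) < n then (⟨i, by omega⟩ : Fin (n+3)) else ⟨n+2, by omega⟩)
        = Fin.snoc v x := by
    intro v a b x
    funext i
    refine Fin.lastCases ?_ (fun i => ?_) i
    · simp [snoc_last']
    · have := i.2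
      simp
      rw [snoc_lt' _ _ _ (by omega), snoc_lt' _ _ _ (by omega), snoc_lt' _ _ _ this]
  simp only [key, rz_iff, snc_val]
  simp only [snoc_last', snoc_lt', Nat.lt_succ_self]
  have h1 : ∀ (v : Fin n → El M) (a b : El M), (Fin.snoc (Fin.snoc v a : Fin (n+1) → El M) b : Fin (n+2) → El M)
      ⟨n, by omega⟩ = a := by
    intro v a b
    rw [snoc_lt' _ _ _ (by omega), snoc_last' _ _ _ rfl]
  constructor
  · intro h v hv a ha
    obtain ⟨b, hb⟩ := h (fun i => ⟨v i, hv i⟩) ⟨a, ha⟩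
    have : b.1 = ZFSet.sep (fun x => Sat M φ (snc v x)) a := by
      rw [← el_ext hM b.2]
      · intro x
        have := hb x
        rw [snoc_lt' _ _ n (by omega), h1] at this
        rw [this, ZFSet.mem_sep]
      · intro z hz
        exact trans_mem hM (ZFSet.mem_sep.1 hz).1 ha
      
    rw [← this]; exact b.2
  · intro h v a
    refine ⟨⟨_, h (fun i => (v i).1) (fun i => (v i).2) a.1 a.2⟩, fun x => ?_⟩
    rw [snoc_lt' _ _ n (by omega), h1 v a _]
    simp only [ZFSet.mem_sep]

theorem rz_repl (hM : M.IsTransitive) {n : ℕ} (φ : BF (n + 2)) :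
    Rz M (n := 0) (replAx φ) default ↔ Repl M φ := by
  unfold replAx Repl
  simp only [rz_alls, rz_all, rz_ex, rz_and, rz_imp, rz_iffF, rz_reindex, rz_memf, rz_eqf]
  have key : ∀ (v : Fin n → El M) (w : Fin (n+4) → El M) (a b : Fin (n+4)),
      (∀ i : Fin n, w ⟨i, by omega⟩ = v i) → 
      (w ∘ fun i : Fin (n+2) => if h : (i : ℕ) < n then (⟨i, by omega⟩ : Fin (n+4)) else if (i : ℕ) = n then a else b)
        = Fin.snoc (Fin.snoc v (w a) : Fin (n+1) → El M) (w b) := by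
    intro v w a b h
    funext i
    refine Fin.lastCases ?_ (fun i => ?_) i
    · simp
    · refine Fin.lastCases ?_ (fun i => ?_) i
      · simp
      · simp [h]
  have k0 : ∀ (v : Fin n → El M) (a b c d : El M) (i : Fin n),
      (Fin.snoc (Fin.snoc (Fin.snoc (Fin.snoc v a : Fin (n+1) → El M) b : Fin (n+2) → El M) c : Fin (n+3) → El M)
        d : Fin (n+4) → El M) ⟨i, by omega⟩ = v i := by
    intro v a b c d i
    rw [snoc_lt' _ _ _ (by omega), snoc_lt' _ _ _ (by omega), snoc_lt' _ _ _ (by omega), snoc_lt' _ _ _ i.2]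
  have k1 : ∀ (v : Fin n → El M) (a b c d : El M),
      (Fin.snoc (Fin.snoc (Fin.snoc (Fin.snoc v a : Fin (n+1) → El M) b : Fin (n+2) → El M) c : Fin (n+3) → El M)
        d : Fin (n+4) → El M) ⟨n, by omega⟩ = a := by
    intro v a b c d
    rw [snoc_lt' _ _ _ (by omega), snoc_lt' _ _ _ (by omega), snoc_lt' _ _ _ (by omega), snoc_last' _ _ _ rfl]
  have k2 : ∀ (v : Fin n → El M) (a b c d : El M),
      (Fin.snoc (Fin.snoc (Fin.snoc (Fin.snoc v a : Fin (n+1) → El M) b : Fin (n+2) → El M) c : Fin (n+3) → El M)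
        d : Fin (n+4) → El M) ⟨n+1, by omega⟩ = b := by
    intro v a b c d
    rw [snoc_lt' _ _ _ (by omega), snoc_lt' _ _ _ (by omega), snoc_last' _ _ _ rfl]
  have k3 : ∀ (v : Fin n → El M) (a b c d : El M),
      (Fin.snoc (Fin.snoc (Fin.snoc (Fin.snoc v a : Fin (n+1) → El M) b : Fin (n+2) → El M) c : Fin (n+3) → El M)
        d : Fin (n+4) → El M) ⟨n+2, by omega⟩ = c := by
    intro v a b c d
    rw [snoc_lt' _ _ _ (by omega), snoc_last' _ _ _ rfl]
  have k4 : ∀ (v : Fin n → El M) (a b c d : El M),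
      (Fin.snoc (Fin.snoc (Fin.snoc (Fin.snoc v a : Fin (n+1) → El M) b : Fin (n+2) → El M) c : Fin (n+3) → El M)
        d : Fin (n+4) → El M) ⟨n+3, by omega⟩ = d := by
    intro v a b c d
    rw [snoc_last' _ _ _ rfl]
  have k5 : ∀ (v : Fin n → El M) (a b c : El M),
      (Fin.snoc (Fin.snoc (Fin.snoc v a : Fin (n+1) → El M) b : Fin (n+2) → El M) c : Fin (n+3) → El M)
         ⟨n+1, by omega⟩ = b := by
    intro v a b c
    rw [snoc_lt' _ _ _ (by omega), snoc_last' _ _ _ rfl]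
  have k6 : ∀ (v : Fin n → El M) (a b c : El M),
      (Fin.snoc (Fin.snoc (Fin.snoc v a : Fin (n+1) → El M) b : Fin (n+2) → El M) c : Fin (n+3) → El M)
         ⟨n+2, by omega⟩ = c := by
    intro v a b c
    rw [snoc_last' _ _ _ rfl]
  simp only [key _ _ _ _ (k0 _ _ _ _ _), k1, k2, k3, k4, k5, k6, rz_iff, snc_val]
  constructor
  · intro h v hv A hA hf
    obtain ⟨B, hB⟩ := h (fun i => ⟨v i, hv i⟩) ⟨A, hA⟩ (fun x y y' hh =>
      hf x.1 hh.1 y.1 y.2 y'.1 y'.2 hh.2.1 hh.2.2)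
    refine ⟨B.1, B.2, fun y => ⟨fun hy => ?_, ?_⟩⟩
    · have hyM := trans_mem hM hy B.2
      obtain ⟨x, h1, h2⟩ := (hB ⟨y, hyM⟩).1 hy
      exact ⟨hyM, x.1, h1, h2⟩
    · rintro ⟨hy, x, hx, h2⟩
      exact (hB ⟨y, hy⟩).2 ⟨⟨x, trans_mem hM hx hA⟩, hx, h2⟩
  · intro h v A hf
    obtain ⟨B, hB, h'⟩ := h (fun i => (v i).1) (fun i => (v i).2) A.1 A.2 (fun x hx y hy y' hy' h1 h2 =>
      hf ⟨x, trans_mem hM hx A.2⟩ ⟨y, hy⟩ ⟨y', hy'⟩ ⟨hx, h1, h2⟩)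
    refine ⟨⟨B, hB⟩, fun y => (h' y.1).trans ⟨?_, ?_⟩⟩
    · rintro ⟨_, x, hx, h2⟩
      exact ⟨⟨x, trans_mem hM hx A.2⟩, hx, h2⟩
    · rintro ⟨x, hx, h2⟩
      exact ⟨y.2, x.1, hx, h2⟩

theorem ZM.iff (hM : M.IsTransitive) : ZModels M ZC ↔ ZM M := by
  rw [zmodels_iff]
  constructor
  · intro h
    have hp : PairCl M := (rz_pair hM).1 (h _ (by simp [ZC, Z, zfFin]))
    exact ⟨⟨hM, hp, (rz_union hM).1 (h _ (by simp [ZC, Z, zfFin])),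
      (rz_pow hM).1 (h _ (by simp [ZC, Z, zfFin])), (rz_inf hM).1 (h _ (by simp [ZC, Z, zfFin])),
      fun n φ => (rz_sep hM φ).1 (h _ (.inl (.inr ⟨⟨n, φ⟩, rfl⟩)))⟩, 
      (rz_ac hM hp).1 (h _ (.inr rfl))⟩
  · rintro h φ ((hφ | ⟨⟨n, φ⟩, rfl⟩) | rfl)
    · rcases hφ with rfl | rfl | rfl | rfl | rfl | rfl
      · exact rz_ext hM
      · exact rz_found hM
      · exact (rz_pair hM).2 h.pair
      · exact (rz_union hM).2 h.un
      · exact (rz_pow hM).2 h.pow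
      · exact (rz_inf hM).2 h.inf
    · exact (rz_sep hM φ).2 (h.sep n φ)
    · exact (rz_ac hM h.pair).2 h.ac
end Part3

section Part4
universe u
set_option linter.unusedVariables false
variable {M : ZFSet.{u}} 

theorem ZM0.sepU (hM : ZM0 M) {n : ℕ} {R : ZFSet.{u} → (Fin (n+1) → ZFSet.{u}) → Prop} [h : UD R]
    {v : Fin n → ZFSet.{u}} (hv : ∀ i, v i ∈ M) {a : ZFSet.{u}} (ha : a ∈ M) :
    ZFSet.sep (fun x => R M (snc v x)) a ∈ M := by
  obtain ⟨φ, hφ⟩ := h.out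
  have := hM.sep n φ v hv a ha
  convert this using 1
  ext x
  rw [ZFSet.mem_sep, ZFSet.mem_sep]
  refine and_congr_right fun hx => ?_
  exact (hφ M hM.tr _ (snc_mem hv (trans_mem hM.tr hx ha))).symm

theorem ZM0.sep0 (hM : ZM0 M) (R : ZFSet.{u} → ZFSet.{u} → Prop) [h : UD (n := 1) fun M v => R M (v 0)]
    {a : ZFSet.{u}} (ha : a ∈ M) : ZFSet.sep (fun x => R M x) a ∈ M :=
  hM.sepU (v := ![]) (R := fun M v => R M (v 0)) (by simp) ha
theorem ZM0.sep1 (hM : ZM0 M) (R : ZFSet.{u} → ZFSet.{u} → ZFSet.{u} → Prop)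
    [h : UD (n := 2) fun M v => R M (v 0) (v 1)] {p : ZFSet.{u}} (hp : p ∈ M)
    {a : ZFSet.{u}} (ha : a ∈ M) : ZFSet.sep (fun x => R M p x) a ∈ M :=
  hM.sepU (v := ![p]) (R := fun M v => R M (v 0) (v 1)) (by simpa using hp) ha
theorem ZM0.sep2 (hM : ZM0 M) (R : ZFSet.{u} → ZFSet.{u} → ZFSet.{u} → ZFSet.{u} → Prop)
    [h : UD (n := 3) fun M v => R M (v 0) (v 1) (v 2)] {p q : ZFSet.{u}} (hp : p ∈ M) (hq : q ∈ M)
    {a : ZFSet.{u}} (ha : a ∈ M) : ZFSet.sep (fun x => R M p q x) a ∈ M :=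
  hM.sepU (v := ![p, q]) (R := fun M v => R M (v 0) (v 1) (v 2))
    (by simp [Fin.forall_fin_succ]; exact ⟨hp, hq⟩) ha
theorem ZM0.sep3 (hM : ZM0 M) (R : ZFSet.{u} → ZFSet.{u} → ZFSet.{u} → ZFSet.{u} → ZFSet.{u} → Prop)
    [h : UD (n := 4) fun M v => R M (v 0) (v 1) (v 2) (v 3)] {p q r : ZFSet.{u}} (hp : p ∈ M)
    (hq : q ∈ M) (hr : r ∈ M)
    {a : ZFSet.{u}} (ha : a ∈ M) : ZFSet.sep (fun x => R M p q r x) a ∈ M :=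
  hM.sepU (v := ![p, q, r]) (R := fun M v => R M (v 0) (v 1) (v 2) (v 3))
    (by simp [Fin.forall_fin_succ]; exact ⟨hp, hq, hr⟩) ha
theorem ZM0.sep4 (hM : ZM0 M)
    (R : ZFSet.{u} → ZFSet.{u} → ZFSet.{u} → ZFSet.{u} → ZFSet.{u} → ZFSet.{u} → Prop)
    [h : UD (n := 5) fun M v => R M (v 0) (v 1) (v 2) (v 3) (v 4)] {p q r s : ZFSet.{u}} (hp : p ∈ M)
    (hq : q ∈ M) (hr : r ∈ M) (hs : s ∈ M)
    {a : ZFSet.{u}} (ha : a ∈ M) : ZFSet.sep (fun x => R M p q r s x) a ∈ M :=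
  hM.sepU (v := ![p, q, r, s]) (R := fun M v => R M (v 0) (v 1) (v 2) (v 3) (v 4))
    (by simp [Fin.forall_fin_succ]; exact ⟨hp, hq, hr, hs⟩) ha

/-- power set inside `M` -/
def PM (M x : ZFSet.{u}) : ZFSet.{u} := ZFSet.sep (· ∈ M) (ZFSet.powerset x)
theorem mem_PM {x y : ZFSet.{u}} : y ∈ PM M x ↔ y ∈ M ∧ y ⊆ x := by
  rw [PM, ZFSet.mem_sep, ZFSet.mem_powerset, and_comm]
theorem ZM0.PM (hM : ZM0 M) {x : ZFSet.{u}} (hx : x ∈ M) : PM M x ∈ M := hM.pow x hx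
theorem ZM0.empty (hM : ZM0 M) : ∅ ∈ M := by
  obtain ⟨x, hx, h, _⟩ := hM.inf
  exact trans_mem hM.tr h hx
theorem ZM0.sing (hM : ZM0 M) {x : ZFSet.{u}} (hx : x ∈ M) : ({x} : ZFSet.{u}) ∈ M := hM.pair.sing hx
theorem ZM0.union (hM : ZM0 M) {x y : ZFSet.{u}} (hx : x ∈ M) (hy : y ∈ M) : x ∪ y ∈ M :=
  hM.un _ (hM.pair _ hx _ hy)
theorem ZM0.insert (hM : ZM0 M) {x y : ZFSet.{u}} (hx : x ∈ M) (hy : y ∈ M) : insert x y ∈ M := by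
  have := hM.union (hM.sing hx) hy
  convert this using 1
  ext z; simp
theorem ZM0.opair (hM : ZM0 M) {x y : ZFSet.{u}} (hx : x ∈ M) (hy : y ∈ M) : ZFSet.pair x y ∈ M :=
  hM.pair.pair hx hy
theorem ZM0.prod (hM : ZM0 M) {x y : ZFSet.{u}} (hx : x ∈ M) (hy : y ∈ M) : ZFSet.prod x y ∈ M := by
  have := hM.sep2 (fun M p q z => ∃ a ∈ p, ∃ b ∈ q, z = ZFSet.pair a b) hx hy
    (hM.PM (hM.PM (hM.union hx hy)))
  convert this using 1
  ext z
  rw [ZFSet.mem_sep, ZFSet.mem_prod, mem_PM]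
  constructor
  · rintro ⟨a, ha, b, hb, rfl⟩
    have ha' := trans_mem hM.tr ha hx
    have hb' := trans_mem hM.tr hb hy
    refine ⟨⟨hM.opair ha' hb', fun w hw => ?_⟩, a, ha, b, hb, rfl⟩
    rw [mem_PM]
    simp only [ZFSet.pair, ZFSet.mem_pair] at hw
    rcases hw with rfl | rfl
    · refine ⟨hM.sing ha', fun w hw => ?_⟩
      simp at hw; subst hw; simp [ha]
    · refine ⟨hM.pair _ ha' _ hb', fun w hw => ?_⟩
      simp at hw; rcases hw with rfl | rfl <;> simp [*]
  · exact fun h => h.2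
theorem ZM0.finset (hM : ZM0 M) (s : Finset ZFSet.{u}) (h : ∀ x ∈ s, x ∈ M) :
    ∃ t ∈ M, ∀ x, x ∈ t ↔ x ∈ s := by
  classical
  induction s using Finset.induction_on with
  | empty => exact ⟨∅, hM.empty, by simp⟩
  | insert a s ha ih =>
    obtain ⟨t, ht, h'⟩ := ih (fun x hx => h x (by simp [hx]))
    exact ⟨_, hM.insert (h a (by simp)) ht, fun x => by simp [h']⟩

/-! ### natural numbers -/
def nn : ℕ → ZFSet.{u}
  | 0 => ∅
  | k + 1 => insert (nn k) (nn k)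
noncomputable def om : ZFSet.{u} := ZFSet.range (fun k : ULift.{u} ℕ => nn k.down)
theorem mem_om {x : ZFSet.{u}} : x ∈ om ↔ ∃ k, x = nn k := by
  simp only [om, ZFSet.mem_range]
  exact ⟨fun ⟨k, h⟩ => ⟨_, h.symm⟩, fun ⟨k, h⟩ => ⟨⟨k⟩, h.symm⟩⟩
theorem nn_mem_om (k : ℕ) : nn k ∈ (om : ZFSet.{u}) := mem_om.2 ⟨k, rfl⟩
theorem mem_nn {k : ℕ} {x : ZFSet.{u}} : x ∈ nn k ↔ ∃ j < k, x = nn j := by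
  induction k with
  | zero => simp [nn]
  | succ k ih =>
    rw [nn, ZFSet.mem_insert_iff, ih]
    constructor
    · rintro (rfl | ⟨j, hj, rfl⟩)
      · exact ⟨k, by omega, rfl⟩
      · exact ⟨j, by omega, rfl⟩
    · rintro ⟨j, hj, rfl⟩
      rcases Nat.lt_succ_iff_lt_or_eq.1 hj with h | rfl
      · exact .inr ⟨j, h, rfl⟩
      · exact .inl rfl
theorem nn_inj {j k : ℕ} (h : (nn j : ZFSet.{u}) = nn k) : j = k := by
  by_contra hne
  rcases Nat.lt_or_gt_of_ne hne with hh | hh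
  · have : (nn j : ZFSet.{u}) ∈ nn k := mem_nn.2 ⟨j, hh, rfl⟩
    rw [h] at this; exact ZFSet.mem_irrefl _ this
  · have : (nn k : ZFSet.{u}) ∈ nn j := mem_nn.2 ⟨k, hh, rfl⟩
    rw [h] at this; exact ZFSet.mem_irrefl _ this
theorem nn_mem_nn {j k : ℕ} : (nn j : ZFSet.{u}) ∈ nn k ↔ j < k := by
  rw [mem_nn]
  exact ⟨fun ⟨i, hi, h⟩ => nn_inj h ▸ hi, fun h => ⟨j, h, rfl⟩⟩
theorem nn_trans (k : ℕ) : (nn k : ZFSet.{u}).IsTransitive := by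
  intro x hx y hy
  obtain ⟨j, hj, rfl⟩ := mem_nn.1 hx
  obtain ⟨i, hi, rfl⟩ := mem_nn.1 hy
  exact nn_mem_nn.2 (by omega)
theorem nn_ord (k : ℕ) : IsOrd (nn k : ZFSet.{u}) := by
  refine ⟨nn_trans k, fun y hy => ?_⟩
  obtain ⟨j, hj, rfl⟩ := mem_nn.1 hy
  exact nn_trans j
theorem om_ord : IsOrd (om : ZFSet.{u}) := by
  refine ⟨fun x hx y hy => ?_, fun x hx => ?_⟩
  · obtain ⟨j, rfl⟩ := mem_om.1 hx
    obtain ⟨i, hi, rfl⟩ := mem_nn.1 hy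
    exact nn_mem_om i
  · obtain ⟨j, rfl⟩ := mem_om.1 hx
    exact nn_trans j

theorem IsOm.eq_om {w : ZFSet.{u}} (h : IsOm w) : w = om := by
  obtain ⟨⟨h1, h2⟩, h3, h4⟩ := h
  ext x
  rw [mem_om]
  constructor
  · induction x using ZFSet.inductionOn with
    | h x ih =>
      intro hx
      rcases h4 x hx with rfl | ⟨y, hy, hxy⟩
      · exact ⟨0, rfl⟩
      · obtain ⟨k, rfl⟩ := ih y hy (trans_mem h1.1 hy hx)
        exact ⟨k + 1, hxy⟩
  · rintro ⟨k, rfl⟩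
    induction k with
    | zero => exact h2
    | succ k ih => exact h3 _ ih

instance udInsert {n : ℕ} {s t r : ZFSet.{u} → (Fin n → ZFSet.{u}) → ZFSet.{u}} [Proj s] [Proj t] [Proj r] :
    UD (fun M v => s M v = insert (t M v) (r M v)) :=
  UD.app3 (Q := fun _ x y z => x = insert y z) <|
    UD.congr (n := 3) (A := fun _ v => v 1 ∈ v 0 ∧ v 2 ⊆ v 0 ∧ ∀ x ∈ v 0, x = v 1 ∨ x ∈ v 2) (by
      intro M hM v _
      rw [ZFSet.ext_iff]; simp only [ZFSet.mem_insert_iff]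
      constructor
      · intro h; exact ⟨(h _).2 (.inl rfl), fun z hz => (h z).2 (.inr hz), fun x => (h x).1⟩
      · rintro ⟨h1, h2, h3⟩ z; exact ⟨h3 z, by rintro (rfl | h); exacts [h1, h2 h]⟩)

def NatP (y : ZFSet.{u}) : Prop := IsOrd y ∧ (y = ∅ ∨ ∃ w ∈ y, y = insert w w) ∧
  ∀ z ∈ y, z = ∅ ∨ ∃ w ∈ z, z = insert w w
instance udNatP {n : ℕ} {s : ZFSet.{u} → (Fin n → ZFSet.{u}) → ZFSet.{u}} [Proj s] :
    UD (fun M v => NatP (s M v)) :=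
  UD.app1 (Q := fun _ y => NatP y) <| by unfold NatP; infer_instance

theorem natP_iff {y : ZFSet.{u}} : NatP y ↔ ∃ k, y = nn k := by
  constructor
  · induction y using ZFSet.inductionOn with
    | h x ih =>
      rintro ⟨h1, h2, h3⟩
      rcases h2 with rfl | ⟨y, hy, hxy⟩
      · exact ⟨0, rfl⟩
      · obtain ⟨k, rfl⟩ := ih y hy ⟨⟨h1.2 y hy, fun z hz => h1.2 _ (trans_mem h1.1 hz hy)⟩,
          h3 y hy, fun z hz => h3 _ (trans_mem h1.1 hz hy)⟩
        exact ⟨k + 1, hxy⟩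
  · rintro ⟨k, rfl⟩
    have : ∀ k, nn k = ∅ ∨ ∃ w ∈ nn k, (nn k : ZFSet.{u}) = insert w w := by
      rintro (_ | k)
      · exact .inl rfl
      · exact .inr ⟨nn k, nn_mem_nn.2 (by omega), rfl⟩
    refine ⟨nn_ord k, this k, fun z hz => ?_⟩
    obtain ⟨j, hj, rfl⟩ := mem_nn.1 hz
    exact this j

theorem ZM0.om (hM : ZM0 M) : om ∈ M := by
  obtain ⟨x, hx, h1, h2⟩ := hM.inf
  have := hM.sep0 (fun M y => NatP y) hx
  convert this using 1
  ext y
  rw [ZFSet.mem_sep, natP_iff, mem_om]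
  refine ⟨?_, fun h => h.2⟩
  rintro ⟨k, rfl⟩
  refine ⟨?_, k, rfl⟩
  induction k with
  | zero => exact h1
  | succ k ih => exact h2 _ ih
theorem ZM0.nn (hM : ZM0 M) (k : ℕ) : nn k ∈ M := trans_mem hM.tr (nn_mem_om k) hM.om

/-- chosen defining formula -/
noncomputable def fm {n : ℕ} (R : ZFSet.{u} → (Fin n → ZFSet.{u}) → Prop) [h : UD R] : BF n :=
  Classical.choose h.out
theorem fm_spec {n : ℕ} (R : ZFSet.{u} → (Fin n → ZFSet.{u}) → Prop) [h : UD R] (hM : M.IsTransitive)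
    {v : Fin n → ZFSet.{u}} (hv : ∀ i, v i ∈ M) : Sat M (fm R) v ↔ R M v :=
  Classical.choose_spec h.out M hM v hv

/-- parameter-free replacement for the definable relation `Q` -/
theorem Repl.use (hM : M.IsTransitive) {Q : ZFSet.{u} → ZFSet.{u} → ZFSet.{u} → Prop}
    [h : UD (n := 2) fun M v => Q M (v 0) (v 1)]
    (hr : Repl M (n := 0) (fm (n := 2) fun M v => Q M (v 0) (v 1))) {A : ZFSet.{u}} (hA : A ∈ M)
    (H : ZFSet.{u} → ZFSet.{u}) (hH : ∀ x ∈ A, ∀ y ∈ M, Q M x y ↔ y = H x) (hH' : ∀ x ∈ A, H x ∈ M) :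
    ∃ B ∈ M, ∀ y, y ∈ B ↔ ∃ x ∈ A, y = H x := by
  have key : ∀ x ∈ A, ∀ y ∈ M, Sat M (fm (n := 2) fun M v => Q M (v 0) (v 1)) (snc (snc ![] x) y) ↔ y = H x := by
    intro x hx y hy
    rw [fm_spec _ hM]
    · exact hH x hx y hy
    · exact snc_mem (snc_mem (by simp) (trans_mem hM hx hA)) hy
  obtain ⟨B, hB, h'⟩ := hr ![] (by simp) A hA (by
    intro x hx y hy y' hy' h1 h2
    rw [key x hx y hy] at h1
    rw [key x hx y' hy'] at h2
    rw [h1, h2])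
  refine ⟨B, hB, fun y => (h' y).trans ⟨?_, ?_⟩⟩
  · rintro ⟨hy, x, hx, h⟩; exact ⟨x, hx, (key x hx y hy).1 h⟩
  · rintro ⟨x, hx, rfl⟩; exact ⟨hH' x hx, x, hx, (key x hx _ (hH' x hx)).2 rfl⟩
end Part4

section Part5
universe u
set_option linter.unusedVariables false
variable {M : ZFSet.{u}} 

/-! ### transitive closure -/
def TcQ (M y z : ZFSet.{u}) : Prop :=
  z.IsTransitive ∧ y ∈ z ∧ ∀ w ∈ M, w.IsTransitive → y ∈ w → z ⊆ w
instance udTcQ {n : ℕ} {s t : ZFSet.{u} → (Fin n → ZFSet.{u}) → ZFSet.{u}} [Proj s] [Proj t] :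
    UD (fun M v => TcQ M (s M v) (t M v)) :=
  UD.app2 (Q := TcQ) <| by unfold TcQ; infer_instance

theorem tc_exists (hM : ZM M) (hr : Repl M (n := 0) (fm (n := 2) fun M v => TcQ.{u} M (v 0) (v 1)))
    (x : ZFSet.{u}) : x ∈ M → ∃ T ∈ M, TcQ M x T ∧ ∀ y ∈ T, y = x ∨ y.rank < x.rank := by
  induction x using ZFSet.inductionOn with
  | h x ih =>
  intro hx
  have : ∀ y, ∃ T, y ∈ x → T ∈ M ∧ TcQ M y T ∧ ∀ z ∈ T, z = y ∨ z.rank < y.rank := by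
    intro y
    by_cases hy : y ∈ x
    · obtain ⟨T, h⟩ := ih y hy (trans_mem hM.tr hy hx)
      exact ⟨T, fun _ => h⟩
    · exact ⟨∅, fun h => absurd h hy⟩
  choose H hH using this
  obtain ⟨B, hB, hB'⟩ := hr.use hM.tr hx H (by
    intro y hy z hz
    constructor
    · intro h
      exact le_antisymm (α := ZFSet) (h.2.2 _ (hH y hy).1 (hH y hy).2.1.1 (hH y hy).2.1.2.1)
        ((hH y hy).2.1.2.2 z hz h.1 h.2.1)
    · rintro rfl; exact (hH y hy).2.1) (fun y hy => (hH y hy).1)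
  refine ⟨insert x (ZFSet.sUnion B), hM.insert hx (hM.un _ hB), ⟨?_, by simp, ?_⟩, ?_⟩
  · intro y hy z hz
    rw [ZFSet.mem_insert_iff] at hy ⊢
    right
    rw [ZFSet.mem_sUnion]
    rcases hy with rfl | hy
    · exact ⟨H z, (hB' _).2 ⟨z, hz, rfl⟩, (hH z hz).2.1.2.1⟩
    · obtain ⟨w, hw, hyw⟩ := ZFSet.mem_sUnion.1 hy
      obtain ⟨a, ha, rfl⟩ := (hB' _).1 hw
      exact ⟨_, hw, trans_mem (hH a ha).2.1.1 hz hyw⟩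
  · intro w hw hwt hxw y hy
    rw [ZFSet.mem_insert_iff] at hy
    rcases hy with rfl | hy
    · exact hxw
    · obtain ⟨v, hv, hyw⟩ := ZFSet.mem_sUnion.1 hy
      obtain ⟨a, ha, rfl⟩ := (hB' _).1 hv
      exact (hH a ha).2.1.2.2 w hw hwt (trans_mem hwt ha hxw) hyw
  · intro y hy
    rw [ZFSet.mem_insert_iff] at hy
    refine hy.imp id fun hy => ?_
    obtain ⟨v, hv, hyw⟩ := ZFSet.mem_sUnion.1 hy
    obtain ⟨a, ha, rfl⟩ := (hB' _).1 hv
    rcases (hH a ha).2.2 y hyw with rfl | h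
    · exact ZFSet.rank_lt_of_mem ha
    · exact h.trans (ZFSet.rank_lt_of_mem ha)

/-! ### recursion -/
def RecOK (Step : ZFSet.{u} → ZFSet.{u} → ZFSet.{u} → ZFSet.{u} → Prop) (M f : ZFSet.{u}) : Prop :=
  ∀ x ∈ M, ∀ z ∈ M, ZFSet.pair x z ∈ f → (∀ y ∈ x, ∃ w ∈ M, ZFSet.pair y w ∈ f) ∧ Step M f x z
def RecQ (Step : ZFSet.{u} → ZFSet.{u} → ZFSet.{u} → ZFSet.{u} → Prop) (M x z : ZFSet.{u}) : Prop :=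
  ∃ f ∈ M, RecOK Step M f ∧ ZFSet.pair x z ∈ f

class UD3 (Q : ZFSet.{u} → ZFSet.{u} → ZFSet.{u} → ZFSet.{u} → Prop) : Prop where
  out : UD (n := 3) fun M v => Q M (v 0) (v 1) (v 2)

theorem udRecOK {Step : ZFSet.{u} → ZFSet.{u} → ZFSet.{u} → ZFSet.{u} → Prop} [hS : UD3 Step]
    {n : ℕ} {s : ZFSet.{u} → (Fin n → ZFSet.{u}) → ZFSet.{u}} [Proj s] :
    UD (fun M v => RecOK Step M (s M v)) :=
  UD.app1 (Q := RecOK Step) <| by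
    have : ∀ {n : ℕ} {s t r : ZFSet.{u} → (Fin n → ZFSet.{u}) → ZFSet.{u}} [Proj s] [Proj t] [Proj r],
        UD (fun M v => Step M (s M v) (t M v) (r M v)) := fun {n s t r} _ _ _ => UD.app3 hS.out
    unfold RecOK; infer_instance
instance udRecQ {Step : ZFSet.{u} → ZFSet.{u} → ZFSet.{u} → ZFSet.{u} → Prop} [hS : UD3 Step]
    {n : ℕ} {s t : ZFSet.{u} → (Fin n → ZFSet.{u}) → ZFSet.{u}} [Proj s] [Proj t] :
    UD (fun M v => RecQ Step M (s M v) (t M v)) :=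
  UD.app2 (Q := RecQ Step) <| by
    have : ∀ {n : ℕ} {s : ZFSet.{u} → (Fin n → ZFSet.{u}) → ZFSet.{u}} [Proj s],
        UD (fun M v => RecOK Step M (s M v)) := udRecOK
    unfold RecQ; infer_instance

section
variable {Step : ZFSet.{u} → ZFSet.{u} → ZFSet.{u} → ZFSet.{u} → Prop} [hUD : UD3 Step] (hM : ZM M)
  (tc : ∀ x ∈ M, ∃ T ∈ M, T.IsTransitive ∧ x ∈ T ∧ ∀ y ∈ T, y = x ∨ y.rank < x.rank)
  (hr : Repl M (n := 0) (fm (n := 2) fun M v => RecQ Step M (v 0) (v 1)))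
  (H : ZFSet.{u} → ZFSet.{u})
  (hS : ∀ f ∈ M, ∀ x ∈ M, ∀ z ∈ M, (∀ y ∈ x, ∃ w ∈ M, ZFSet.pair y w ∈ f) →
    (∀ y ∈ x, ∀ w ∈ M, ZFSet.pair y w ∈ f → w = H y) → (Step M f x z ↔ z = H x))
  (hE : ∀ x ∈ M, ∀ Y ∈ M, (∀ y ∈ x, H y ∈ Y) → ∀ f ∈ M,
    (∀ y ∈ x, ∀ w, ZFSet.pair y w ∈ f ↔ w = H y) → H x ∈ M)
include hM tc hr hS hE

omit tc hr hE hUD in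
theorem recOK_unique {f : ZFSet.{u}} (hf : f ∈ M) (h : RecOK Step M f) (x : ZFSet.{u}) :
    ∀ z, ZFSet.pair x z ∈ f → z = H x := by
  induction x using ZFSet.inductionOn with
  | h x ih =>
  intro z hz
  obtain ⟨hx, hz'⟩ := pair_mem_of hM.tr hz hf
  obtain ⟨h1, h2⟩ := h x hx z hz' hz
  exact (hS f hf x hx z hz' h1 (fun y hy w hw => ih y hy w)).1 h2

theorem rec_main (x : ZFSet.{u}) (hx : x ∈ M) : H x ∈ M ∧ ∀ z ∈ M, RecQ Step M x z ↔ z = H x := by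
  suffices h : H x ∈ M ∧ RecQ Step M x (H x) by
    refine ⟨h.1, fun z hz => ⟨?_, ?_⟩⟩
    · rintro ⟨f, hf, h1, h2⟩; exact recOK_unique hM H hS hf h1 x z h2
    · rintro rfl; exact h.2
  induction hα : x.rank using WellFoundedLT.induction generalizing x with
  | _ α ih =>
  subst hα
  obtain ⟨T, hT, hTt, hxT, hTr⟩ := tc x hx
  have hT' := hM.sep1 (fun M p y => y ≠ p) hx hT
  set T' := ZFSet.sep (fun y => y ≠ x) T with hdef
  have mT : ∀ y ∈ T', y ∈ M ∧ y ∈ T ∧ y.rank < x.rank := by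
    intro y hy
    have h := ZFSet.mem_sep.1 hy
    exact ⟨trans_mem hM.tr h.1 hT, h.1, (hTr y h.1).resolve_left h.2⟩
  have hcl : ∀ y ∈ T, ∀ z ∈ y, z ∈ T' := by
    intro y hy z hz
    refine ZFSet.mem_sep.2 ⟨trans_mem hTt hz hy, ?_⟩
    rintro rfl
    have h1 := ZFSet.rank_lt_of_mem hz
    rcases hTr y hy with rfl | h
    · exact h1.false
    · exact (h1.trans h).false
  have IH : ∀ y ∈ T', H y ∈ M ∧ RecQ Step M y (H y) := fun y hy => ih _ (mT y hy).2.2 y (mT y hy).1 rfl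
  have IH' : ∀ y ∈ T', ∀ z ∈ M, RecQ Step M y z ↔ z = H y := by
    intro y hy z hz
    constructor
    · rintro ⟨f, hf, h1, h2⟩; exact recOK_unique hM H hS hf h1 y z h2
    · rintro rfl; exact (IH y hy).2
  obtain ⟨Y, hY, hY'⟩ := hr.use hM.tr hT' H IH' (fun y hy => (IH y hy).1)
  have hg := hM.sep0 (fun M p => ∃ y ∈ M, ∃ w ∈ M, p = ZFSet.pair y w ∧ RecQ Step M y w)
    (hM.prod hT' hY)
  set g := ZFSet.sep (fun p => ∃ y ∈ M, ∃ w ∈ M, p = ZFSet.pair y w ∧ RecQ Step M y w)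
    (ZFSet.prod T' Y) with hgdef
  have mg : ∀ y w, ZFSet.pair y w ∈ g ↔ y ∈ T' ∧ w = H y := by
    intro y w
    rw [hgdef, ZFSet.mem_sep, ZFSet.pair_mem_prod]
    constructor
    · rintro ⟨⟨h1, h2⟩, a, ha, b, hb, h3, h4⟩
      obtain ⟨rfl, rfl⟩ := ZFSet.pair_inj.1 h3
      exact ⟨h1, (IH' y h1 w hb).1 h4⟩
    · rintro ⟨h1, rfl⟩
      exact ⟨⟨h1, (hY' _).2 ⟨y, h1, rfl⟩⟩, y, (mT y h1).1, _, (IH y h1).1, rfl, (IH y h1).2⟩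
  have hHx : H x ∈ M := hE x hx Y hY (fun y hy => (hY' _).2 ⟨y, hcl x hxT y hy, rfl⟩) g hg
    (fun y hy w => (mg y w).trans ⟨fun h => h.2, fun h => ⟨hcl x hxT y hy, h⟩⟩)
  refine ⟨hHx, insert (ZFSet.pair x (H x)) g, hM.insert (hM.opair hx hHx) hg, ?_, by simp⟩
  have hfM := hM.insert (hM.opair hx hHx) hg
  have mf : ∀ y ∈ T', ∀ w, ZFSet.pair y w ∈ insert (ZFSet.pair x (H x)) g ↔ w = H y := by
    intro y hy w
    rw [ZFSet.mem_insert_iff, mg, ZFSet.pair_inj]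
    constructor
    · rintro (⟨rfl, rfl⟩ | h)
      · rfl
      · exact h.2
    · intro h; exact .inr ⟨hy, h⟩
  intro a ha b hb hab
  have haT : a ∈ T ∧ b = H a := by
    rw [ZFSet.mem_insert_iff, mg, ZFSet.pair_inj] at hab
    rcases hab with ⟨rfl, rfl⟩ | h
    · exact ⟨hxT, rfl⟩
    · exact ⟨(mT a h.1).2.1, h.2⟩
  have h1 : ∀ y ∈ a, ∃ w ∈ M, ZFSet.pair y w ∈ insert (ZFSet.pair x (H x)) g := fun y hy =>
    ⟨H y, (IH y (hcl a haT.1 y hy)).1, (mf y (hcl a haT.1 y hy) _).2 rfl⟩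
  exact ⟨h1, (hS _ hfM a ha b hb h1 (fun y hy w hw h => (mf y (hcl a haT.1 y hy) w).1 h)).2 haT.2⟩
end

/-! ### levels and check names -/
noncomputable def Wl (M x : ZFSet.{u}) : ZFSet.{u} := ZFSet.sep (fun y => y.rank < x.rank) M
theorem mem_Wl {x y : ZFSet.{u}} : y ∈ Wl M x ↔ y ∈ M ∧ y.rank < x.rank := ZFSet.mem_sep
theorem mem_Wl' (hM : M.IsTransitive) {x y : ZFSet.{u}} : y ∈ Wl M x ↔ y ∈ M ∧ ∃ z ∈ x, y ⊆ Wl M z := by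
  rw [mem_Wl]
  refine and_congr_right fun hy => ?_
  rw [ZFSet.lt_rank_iff]
  refine exists_congr fun z => and_congr_right fun hz => ?_
  rw [ZFSet.rank_le_iff]
  exact ⟨fun h w hw => mem_Wl.2 ⟨trans_mem hM hw hy, h hw⟩, fun h w hw => (mem_Wl.1 (h hw)).2⟩

def StepW (M f x z : ZFSet.{u}) : Prop :=
  ∀ v ∈ M, v ∈ z ↔ ∃ y ∈ x, ∃ w ∈ M, ZFSet.pair y w ∈ f ∧ v ⊆ w
instance : UD3.{u} StepW := ⟨by unfold StepW; infer_instance⟩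

noncomputable def chk (x : ZFSet.{u}) : ZFSet.{u} :=
  ZFSet.range (fun y : {y // y ∈ x} => ZFSet.pair (chk y.1) ∅)
termination_by x
decreasing_by exact y.2
theorem mem_chk {x v : ZFSet.{u}} : v ∈ chk x ↔ ∃ y ∈ x, v = ZFSet.pair (chk y) ∅ := by
  rw [chk, ZFSet.mem_range]
  exact ⟨fun ⟨y, h⟩ => ⟨y.1, y.2, h.symm⟩, fun ⟨y, h, h'⟩ => ⟨⟨y, h⟩, h'.symm⟩⟩

def StepC (M f x z : ZFSet.{u}) : Prop :=
  ∀ v ∈ M, v ∈ z ↔ ∃ y ∈ x, ∃ w ∈ M, ZFSet.pair y w ∈ f ∧ ∃ e ∈ M, e = ∅ ∧ v = ZFSet.pair w e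
instance : UD3.{u} StepC := ⟨by unfold StepC; infer_instance⟩

/-- good models -/
structure FM (M : ZFSet.{u}) : Prop extends ZM M where
  tc : ∀ x ∈ M, ∃ T ∈ M, T.IsTransitive ∧ x ∈ T
  wl : ∀ x ∈ M, Wl M x ∈ M
  wq : ∀ x ∈ M, ∀ z ∈ M, RecQ StepW M x z ↔ z = Wl M x
  chk : ∀ x ∈ M, chk x ∈ M
  cq : ∀ x ∈ M, ∀ z ∈ M, RecQ StepC M x z ↔ z = CtmForcing.chk x

theorem FM.mk' (hM : ZM M) (h1 : Repl M (n := 0) (fm (n := 2) fun M v => TcQ.{u} M (v 0) (v 1)))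
    (h2 : Repl M (n := 0) (fm (n := 2) fun M v => RecQ.{u} StepW M (v 0) (v 1)))
    (h3 : Repl M (n := 0) (fm (n := 2) fun M v => RecQ.{u} StepC M (v 0) (v 1))) : FM M := by
  have tc : ∀ x ∈ M, ∃ T ∈ M, T.IsTransitive ∧ x ∈ T ∧ ∀ y ∈ T, y = x ∨ y.rank < x.rank := by
    intro x hx
    obtain ⟨T, hT, h, h'⟩ := tc_exists hM h1 x hx
    exact ⟨T, hT, h.1, h.2.1, h'⟩
  have A := rec_main hM tc h2 (Wl M) (by
    intro f hf x hx z hz hd hu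
    have key : ∀ v, (∃ y ∈ x, ∃ w ∈ M, ZFSet.pair y w ∈ f ∧ v ⊆ w) ↔ ∃ y ∈ x, v ⊆ Wl M y := by
      intro v
      constructor
      · rintro ⟨y, hy, w, hw, h, h'⟩
        exact ⟨y, hy, hu y hy w hw h ▸ h'⟩
      · rintro ⟨y, hy, h⟩
        obtain ⟨w, hw, h'⟩ := hd y hy
        exact ⟨y, hy, w, hw, h', (hu y hy w hw h').symm ▸ h⟩
    unfold StepW
    simp only [key]
    constructor
    · intro h
      ext v
      rw [mem_Wl' hM.tr]
      exact ⟨fun hv => ⟨trans_mem hM.tr hv hz, (h v (trans_mem hM.tr hv hz)).1 hv⟩, fun hv => (h v hv.1).2 hv.2⟩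
    · rintro rfl v hv
      rw [mem_Wl' hM.tr]; exact ⟨fun h => h.2, fun h => ⟨hv, h⟩⟩) (by
    intro x hx Y hY hY' f hf hff
    have := hM.sep2 (fun M f x v => ∃ y ∈ x, ∃ w ∈ M, ZFSet.pair y w ∈ f ∧ v ⊆ w) hf hx
      (hM.PM (hM.un _ hY))
    convert this using 1
    ext v
    rw [mem_Wl' hM.tr, ZFSet.mem_sep, mem_PM]
    constructor
    · rintro ⟨h1, y, hy, h2⟩
      refine ⟨⟨h1, fun a ha => ZFSet.mem_sUnion.2 ⟨_, hY' y hy, h2 ha⟩⟩, y, hy, Wl M y,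
        trans_mem hM.tr (hY' y hy) hY, (hff y hy _).2 rfl, h2⟩
    · rintro ⟨⟨h1, _⟩, y, hy, w, hw, h2, h3⟩
      exact ⟨h1, y, hy, (hff y hy w).1 h2 ▸ h3⟩)
  have B := rec_main hM tc h3 CtmForcing.chk (by
    intro f hf x hx z hz hd hu
    have key : ∀ v, (∃ y ∈ x, ∃ w ∈ M, ZFSet.pair y w ∈ f ∧ ∃ e ∈ M, e = ∅ ∧ v = ZFSet.pair w e) ↔
        v ∈ CtmForcing.chk x := by
      intro v
      rw [mem_chk]
      constructor
      · rintro ⟨y, hy, w, hw, h, e, he, rfl, rfl⟩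
        exact ⟨y, hy, by rw [hu y hy w hw h]⟩
      · rintro ⟨y, hy, h⟩
        obtain ⟨w, hw, h'⟩ := hd y hy
        exact ⟨y, hy, w, hw, h', ∅, hM.empty, rfl, (hu y hy w hw h').symm ▸ h⟩
    have key2 : ∀ v ∈ CtmForcing.chk x, v ∈ M := by
      intro v hv
      obtain ⟨y, hy, w, hw, h, e, he, rfl, rfl⟩ := (key v).2 hv
      exact hM.opair hw he
    unfold StepC
    simp only [key]
    constructor
    · intro h
      ext v
      exact ⟨fun hv => (h v (trans_mem hM.tr hv hz)).1 hv, fun hv => (h v (key2 v hv)).2 hv⟩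
    · rintro rfl v hv; rfl) (by
    intro x hx Y hY hY' f hf hff
    have := hM.sep2 (fun M f x v => ∃ y ∈ x, ∃ w ∈ M, ZFSet.pair y w ∈ f ∧ ∃ e ∈ M, e = ∅ ∧ v = ZFSet.pair w e) hf hx
      (hM.prod hY (hM.sing hM.empty))
    convert this using 1
    ext v
    rw [mem_chk, ZFSet.mem_sep]
    constructor
    · rintro ⟨y, hy, rfl⟩
      refine ⟨ZFSet.pair_mem_prod.2 ⟨hY' y hy, by simp⟩, y, hy, _, trans_mem hM.tr (hY' y hy) hY,
        (hff y hy _).2 rfl, ∅, hM.empty, rfl, rfl⟩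
    · rintro ⟨_, y, hy, w, hw, h2, e, he, rfl, rfl⟩
      exact ⟨y, hy, by rw [(hff y hy w).1 h2]⟩)
  exact ⟨hM, fun x hx => (tc x hx).imp fun T h => ⟨h.1, h.2.1, h.2.2.1⟩, fun x hx => (A x hx).1,
    fun x hx => (A x hx).2, fun x hx => (B x hx).1, fun x hx => (B x hx).2⟩
end Part5

section Part6
universe u
set_option linter.unusedVariables false
variable {M P G : ZFSet.{u}} 

/-! ### forcing equality and membership -/
def Half (M P : ZFSet.{u}) (R : ZFSet.{u} → ZFSet.{u} → ZFSet.{u} → Prop) (p σ τ : ZFSet.{u}) : Prop :=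
  ∀ a ∈ M, ∀ s ∈ P, ZFSet.pair a s ∈ σ → ∀ q ∈ P, p ⊆ q → s ⊆ q →
    ∃ r ∈ P, q ⊆ r ∧ ∃ b ∈ M, ∃ t ∈ P, ZFSet.pair b t ∈ τ ∧ t ⊆ r ∧ R r a b
def Bisim (M P R : ZFSet.{u}) : Prop :=
  ∀ p ∈ M, ∀ σ ∈ M, ∀ τ ∈ M, ZFSet.pair p (ZFSet.pair σ τ) ∈ R →
    ZFSet.pair p (ZFSet.pair τ σ) ∈ R ∧ Half M P (fun r a b => ZFSet.pair r (ZFSet.pair a b) ∈ R) p σ τ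
def FEq (M P p σ τ : ZFSet.{u}) : Prop :=
  ∃ R ∈ M, Bisim M P R ∧ ZFSet.pair p (ZFSet.pair σ τ) ∈ R
def FMem (M P p σ τ : ZFSet.{u}) : Prop :=
  ∀ q ∈ P, p ⊆ q → ∃ r ∈ P, q ⊆ r ∧ ∃ b ∈ M, ∃ t ∈ P, ZFSet.pair b t ∈ τ ∧ t ⊆ r ∧ FEq M P r σ b
def Bad (M P p σ τ : ZFSet.{u}) : Prop :=
  ∃ a ∈ M, ∃ s ∈ P, ZFSet.pair a s ∈ σ ∧ s ⊆ p ∧ ∀ q ∈ P, p ⊆ q → ∀ b ∈ M, ∀ t ∈ P,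
    ZFSet.pair b t ∈ τ → t ⊆ q → ¬ FEq M P q a b

section
variable {n : ℕ} {s t r q : ZFSet.{u} → (Fin n → ZFSet.{u}) → ZFSet.{u}}
instance udBisim [Proj s] [Proj t] : UD (fun M v => Bisim M (s M v) (t M v)) :=
  UD.app2 (Q := Bisim) <| by unfold Bisim Half; infer_instance
instance udFEq [Proj s] [Proj t] [Proj r] [Proj q] :
    UD (fun M v => FEq M (s M v) (t M v) (r M v) (q M v)) :=
  UD.app4 (Q := FEq) <| by unfold FEq; infer_instance
instance udHalfE [Proj s] [Proj t] [Proj r] [Proj q] :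
    UD (fun M v => Half M (s M v) (FEq M (s M v)) (t M v) (r M v) (q M v)) :=
  UD.app4 (Q := fun M a b c d => Half M a (FEq M a) b c d) <| by unfold Half; infer_instance
instance udFMem [Proj s] [Proj t] [Proj r] [Proj q] :
    UD (fun M v => FMem M (s M v) (t M v) (r M v) (q M v)) :=
  UD.app4 (Q := FMem) <| by unfold FMem; infer_instance
instance udBad [Proj s] [Proj t] [Proj r] [Proj q] :
    UD (fun M v => Bad M (s M v) (t M v) (r M v) (q M v)) :=
  UD.app4 (Q := Bad) <| by unfold Bad; infer_instance
end

theorem Half.imp {R S : ZFSet.{u} → ZFSet.{u} → ZFSet.{u} → Prop} {p σ τ : ZFSet.{u}}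
    (h : Half M P R p σ τ) (H : ∀ r a b, R r a b → S r a b) : Half M P S p σ τ := by
  intro a ha s hs has q hq hpq hsq
  obtain ⟨r, hr, hqr, b, hb, t, ht, hbt, htr, hR⟩ := h a ha s hs has q hq hpq hsq
  exact ⟨r, hr, hqr, b, hb, t, ht, hbt, htr, H _ _ _ hR⟩

theorem Half.mono {R : ZFSet.{u} → ZFSet.{u} → ZFSet.{u} → Prop} {p p' σ τ : ZFSet.{u}}
    (h : Half M P R p σ τ) (H : p ⊆ p') : Half M P R p' σ τ :=
  fun a ha s hs has q hq hpq => h a ha s hs has q hq (H.trans hpq)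

section
variable (hM : FM M) (hP : P ∈ M) {p q σ τ : ZFSet.{u}}

theorem FM.of3 (hM : FM M) {R a b c : ZFSet.{u}} (hR : R ∈ M) (h : ZFSet.pair a (ZFSet.pair b c) ∈ R) :
    a ∈ M ∧ b ∈ M ∧ c ∈ M := by
  obtain ⟨h1, h2⟩ := pair_mem_of hM.tr h hR
  exact ⟨h1, pair_mem_of hM.tr (z := {ZFSet.pair b c}) (by simp) (hM.sing h2)⟩

theorem feq_symm (hM : FM M) (h : FEq M P p σ τ) : FEq M P p τ σ := by
  obtain ⟨R, hR, hB, h⟩ := h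
  obtain ⟨h1, h2, h3⟩ := hM.of3 hR h
  exact ⟨R, hR, hB, (hB _ h1 _ h2 _ h3 h).1⟩

theorem feq_half (hM : FM M) (h : FEq M P p σ τ) : Half M P (FEq M P) p σ τ := by
  obtain ⟨R, hR, hB, h⟩ := h
  obtain ⟨h1, h2, h3⟩ := hM.of3 hR h
  exact (hB _ h1 _ h2 _ h3 h).2.imp fun r a b h => ⟨R, hR, hB, h⟩

theorem FM.tc2 (hM : FM M) {x y : ZFSet.{u}} (hx : x ∈ M) (hy : y ∈ M) :
    ∃ T ∈ M, T.IsTransitive ∧ x ∈ T ∧ y ∈ T := by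
  obtain ⟨T, hT, h1, h2⟩ := hM.tc _ (hM.pair x hx y hy)
  exact ⟨T, hT, h1, trans_mem h1 (by simp) h2, trans_mem h1 (by simp) h2⟩

theorem half_feq (hM : FM M) (hP : P ∈ M) (hp : p ∈ P) (hσ : σ ∈ M) (hτ : τ ∈ M)
    (h1 : Half M P (FEq M P) p σ τ) (h2 : Half M P (FEq M P) p τ σ) : FEq M P p σ τ := by
  obtain ⟨T, hT, hTt, hσT, hτT⟩ := hM.tc2 hσ hτ
  have hR := hM.sep1 (fun M P z => ∃ p ∈ M, ∃ σ ∈ M, ∃ τ ∈ M, ∃ w ∈ M, w = ZFSet.pair σ τ ∧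
    z = ZFSet.pair p w ∧ Half M P (FEq M P) p σ τ ∧ Half M P (FEq M P) p τ σ) hP
    (hM.prod hP (hM.prod hT hT))
  set R := ZFSet.sep _ _ with hRdef
  have mR : ∀ p σ τ, ZFSet.pair p (ZFSet.pair σ τ) ∈ R ↔ (p ∈ P ∧ σ ∈ T ∧ τ ∈ T) ∧
      Half M P (FEq M P) p σ τ ∧ Half M P (FEq M P) p τ σ := by
    intro p σ τ
    rw [hRdef, ZFSet.mem_sep, ZFSet.pair_mem_prod, ZFSet.pair_mem_prod]
    refine and_congr_right fun h => ⟨?_, ?_⟩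
    · rintro ⟨p', _, σ', _, τ', _, w, _, rfl, h3, h4⟩
      obtain ⟨rfl, h5⟩ := ZFSet.pair_inj.1 h3
      obtain ⟨rfl, rfl⟩ := ZFSet.pair_inj.1 h5
      exact h4
    · intro h4
      have a1 := trans_mem hM.tr h.2.1 hT
      have a2 := trans_mem hM.tr h.2.2 hT
      exact ⟨p, trans_mem hM.tr h.1 hP, σ, a1, τ, a2, _, hM.opair a1 a2, rfl, rfl, h4⟩
  refine ⟨R, hR, ?_, (mR _ _ _).2 ⟨⟨hp, hσT, hτT⟩, h1, h2⟩⟩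
  intro q hq σ' hσ' τ' hτ' h
  rw [mR] at h
  refine ⟨(mR _ _ _).2 ⟨⟨h.1.1, h.1.2.2, h.1.2.1⟩, h.2.2, h.2.1⟩, ?_⟩
  intro a ha s hs has q' hq' hqq' hsq'
  obtain ⟨r, hr, hqr, b, hb, t, ht, hbt, htr, hR⟩ := h.2.1 a ha s hs has q' hq' hqq' hsq'
  exact ⟨r, hr, hqr, b, hb, t, ht, hbt, htr, (mR _ _ _).2
    ⟨⟨hr, (pair_mem_of hTt has h.1.2.1).1, (pair_mem_of hTt hbt h.1.2.2).1⟩,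
      feq_half hM hR, feq_half hM (feq_symm hM hR)⟩⟩

theorem feq_mono (hM : FM M) (hP : P ∈ M) (h : FEq M P p σ τ) (hσ : σ ∈ M) (hτ : τ ∈ M) (hq : q ∈ P)
    (hpq : p ⊆ q) : FEq M P q σ τ :=
  half_feq hM hP hq hσ hτ ((feq_half hM h).mono hpq) ((feq_half hM (feq_symm hM h)).mono hpq)

theorem half_dense {R : ZFSet.{u} → ZFSet.{u} → ZFSet.{u} → Prop}
    (h : ∀ q ∈ P, p ⊆ q → ∃ r ∈ P, q ⊆ r ∧ Half M P R r σ τ) : Half M P R p σ τ := by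
  intro a ha s hs has q hq hpq hsq
  obtain ⟨r, hr, hqr, h1⟩ := h q hq hpq
  obtain ⟨r', hr', h2, h3⟩ := h1 a ha s hs has r hr (fun _ h => h) (hsq.trans hqr)
  exact ⟨r', hr', hqr.trans h2, h3⟩

theorem feq_dense (hM : FM M) (hP : P ∈ M) (hp : p ∈ P) (hσ : σ ∈ M) (hτ : τ ∈ M)
    (h : ∀ q ∈ P, p ⊆ q → ∃ r ∈ P, q ⊆ r ∧ FEq M P r σ τ) : FEq M P p σ τ := by
  refine half_feq hM hP hp hσ hτ (half_dense fun q hq hpq => ?_) (half_dense fun q hq hpq => ?_)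
  · obtain ⟨r, hr, h1, h2⟩ := h q hq hpq
    exact ⟨r, hr, h1, feq_half hM h2⟩
  · obtain ⟨r, hr, h1, h2⟩ := h q hq hpq
    exact ⟨r, hr, h1, feq_half hM (feq_symm hM h2)⟩

theorem fmem_dense (h : ∀ q ∈ P, p ⊆ q → ∃ r ∈ P, q ⊆ r ∧ FMem M P r σ τ) : FMem M P p σ τ := by
  intro q hq hpq
  obtain ⟨r, hr, h1, h2⟩ := h q hq hpq
  obtain ⟨r', hr', h3, h4⟩ := h2 r hr (fun _ h => h)
  exact ⟨r', hr', h1.trans h3, h4⟩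

theorem fmem_mono (h : FMem M P p σ τ) (hpq : p ⊆ q) : FMem M P q σ τ :=
  fun r hr hqr => h r hr (hpq.trans hqr)
end

/-! ### forcing formulas -/
def frel (M P p : ZFSet.{u}) {n : ℕ} (v : Fin n → ZFSet.{u}) : ∀ {l : ℕ}, memRel l →
    (Fin l → SetLang.Term (Empty ⊕ Fin n)) → Prop
  | _, .mem, ts => FMem M P p (v (tv (ts 0))) (v (tv (ts 1)))

def Fc (M P : ZFSet.{u}) : ∀ {n : ℕ}, BF n → ZFSet.{u} → (Fin n → ZFSet.{u}) → Prop
  | _, .falsum, _, _ => False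
  | _, .equal s t, p, v => FEq M P p (v (tv s)) (v (tv t))
  | _, .rel R ts, p, v => frel M P p v R ts
  | _, .imp φ ψ, p, v => ∀ q ∈ P, p ⊆ q → Fc M P φ q v → Fc M P ψ q v
  | _, .all φ, p, v => ∀ x ∈ M, Fc M P φ p (snc v x)

theorem udFc0 {n : ℕ} (φ : BF n) :
    UD.{u} (n := n + 2) fun M w => Fc M (w 0) φ (w 1) (fun i => w i.succ.succ) := by
  induction φ with
  | falsum => exact udFalse
  | equal s t => exact udFEq
  | rel R ts => cases R; exact udFMem
  | @imp n φ ψ h1 h2 =>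
    have e1 := h1.sub (n := n + 2 + 1) (fun i => Fin.cases (0 : Fin (n + 2)).castSucc
      (fun i => Fin.cases (Fin.last _) (fun j => j.succ.succ.castSucc) i) i)
    have e2 := h2.sub (n := n + 2 + 1) (fun i => Fin.cases (0 : Fin (n + 2)).castSucc
      (fun i => Fin.cases (Fin.last _) (fun j => j.succ.succ.castSucc) i) i)
    have e1' : UD.{u} (n := n + 2 + 1) fun M w => Fc M (w (0 : Fin (n + 2)).castSucc) φ (w (Fin.last _)) (fun i => w i.succ.succ.castSucc) := e1
    have e2' : UD.{u} (n := n + 2 + 1) fun M w => Fc M (w (0 : Fin (n + 2)).castSucc) ψ (w (Fin.last _)) (fun i => w i.succ.succ.castSucc) := e2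
    exact (inferInstance : UD.{u} (n := n + 2) fun M w => ∀ q ∈ w 0, w 1 ⊆ q →
      Fc M (w 0) φ q (fun i => w i.succ.succ) → Fc M (w 0) ψ q (fun i => w i.succ.succ))
  | @all n φ h =>
    refine udAll (n := n + 2) (R := fun M w x => Fc M (w 0) φ (w 1) (snc (fun i => w i.succ.succ) x)) (h := ?_)
    refine h.congr fun M _ w _ => ?_
    have : snc (fun i : Fin n => w (Fin.castSucc i.succ.succ)) (w (Fin.last _)) = fun i : Fin (n + 1) => w i.succ.succ := by
      funext i
      refine Fin.lastCases ?_ (fun i => ?_) i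
      · rw [snc_last]; rfl
      · simp [snc]
    rw [this]; rfl

theorem udFc {n m : ℕ} (φ : BF n) {s t : ZFSet.{u} → (Fin m → ZFSet.{u}) → ZFSet.{u}} [hs : Proj s]
    [ht : Proj t] (v : Fin n → ZFSet.{u} → (Fin m → ZFSet.{u}) → ZFSet.{u}) (hv : ∀ i, Proj (v i)) :
    UD (fun M w => Fc M (s M w) φ (t M w) (fun i => v i M w)) :=
  (udFc0 φ).app (fun i => Fin.cases s (fun i => Fin.cases t v i) i) (by
    intro i
    refine Fin.cases hs (fun i => Fin.cases ht hv i) i)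

section
variable {n : ℕ}
theorem fc_mono (hM : FM M) (hP : P ∈ M) (φ : BF n) {p q : ZFSet.{u}} {v : Fin n → ZFSet.{u}}
    (hv : ∀ i, v i ∈ M) (hq : q ∈ P) (hpq : p ⊆ q) (h : Fc M P φ p v) : Fc M P φ q v := by
  induction φ with
  | falsum => exact h
  | equal s t => exact feq_mono hM hP h (hv _) (hv _) hq hpq
  | rel R ts => cases R; exact fmem_mono h hpq
  | imp φ ψ h1 h2 => exact fun r hr hqr => h r hr (hpq.trans hqr)
  | all φ ih => exact fun x hx => ih (snc_mem hv hx) (h x hx)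

theorem fc_dense (hM : FM M) (hP : P ∈ M) (φ : BF n) {p : ZFSet.{u}} {v : Fin n → ZFSet.{u}}
    (hv : ∀ i, v i ∈ M) (hp : p ∈ P) (h : ∀ q ∈ P, p ⊆ q → ∃ r ∈ P, q ⊆ r ∧ Fc M P φ r v) :
    Fc M P φ p v := by
  induction φ generalizing p with
  | falsum => obtain ⟨r, _, _, h⟩ := h p hp (fun _ h => h); exact h
  | equal s t => exact feq_dense hM hP hp (hv _) (hv _) h
  | rel R ts => cases R; exact fmem_dense h
  | imp φ ψ h1 h2 =>
    intro q hq hpq hφ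
    refine h2 hv hq fun q' hq' hqq' => ?_
    obtain ⟨r, hr, h3, h4⟩ := h q' hq' (hpq.trans hqq')
    exact ⟨r, hr, h3, h4 r hr (fun _ h => h) (fc_mono hM hP φ hv hr (hqq'.trans h3) hφ)⟩
  | all φ ih =>
    intro x hx
    refine ih (snc_mem hv hx) hp fun q hq hpq => ?_
    obtain ⟨r, hr, h1, h2⟩ := h q hq hpq
    exact ⟨r, hr, h1, h2 x hx⟩
end

/-! ### generic filters -/
structure Gen (M P G : ZFSet.{u}) : Prop where
  sub : G ⊆ P
  emp : ∅ ∈ G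
  up : ∀ p ∈ G, ∀ q ∈ P, q ⊆ p → q ∈ G
  dir : ∀ p ∈ G, ∀ q ∈ G, ∃ r ∈ G, p ⊆ r ∧ q ⊆ r
  gen : ∀ D ∈ M, D ⊆ P → (∀ p ∈ P, ∃ q ∈ D, p ⊆ q) → ∃ p ∈ G, p ∈ D

theorem Gen.meet (hG : Gen M P G) (hM : FM M) (hP : P ∈ M) {Q : ZFSet.{u} → Prop}
    (hQ : ZFSet.sep Q P ∈ M) {p : ZFSet.{u}} (hp : p ∈ G)
    (h : ∀ q ∈ P, p ⊆ q → ∃ r ∈ P, q ⊆ r ∧ Q r) : ∃ r ∈ G, Q r := by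
  have hpM := trans_mem hM.tr (hG.sub hp) hP
  have hD := hM.sep3 (fun M P D p r => r ∈ D ∨ ∀ s ∈ P, p ⊆ s → ¬ r ⊆ s) hP hQ hpM hP
  obtain ⟨r, hr, hrD⟩ := hG.gen _ hD (ZFSet.sep_subset) (by
    intro q hq
    by_cases hc : ∀ s ∈ P, p ⊆ s → ¬ q ⊆ s
    · exact ⟨q, ZFSet.mem_sep.2 ⟨hq, .inr hc⟩, fun _ h => h⟩
    · push Not at hc
      obtain ⟨s, hs, h1, h2⟩ := hc
      obtain ⟨r, hr, h3, h4⟩ := h s hs h1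
      exact ⟨r, ZFSet.mem_sep.2 ⟨hr, .inl (ZFSet.mem_sep.2 ⟨hr, h4⟩)⟩, h2.trans h3⟩)
  obtain ⟨_, h1 | h1⟩ := ZFSet.mem_sep.1 hrD
  · exact ⟨r, hr, (ZFSet.mem_sep.1 h1).2⟩
  · obtain ⟨s, hs, h2, h3⟩ := hG.dir p hp r hr
    exact absurd h3 (h1 s (hG.sub hs) h2)

theorem Gen.meet0 (hG : Gen M P G) (hM : FM M) (hP : P ∈ M) {Q : ZFSet.{u} → Prop}
    (hQ : ZFSet.sep Q P ∈ M) (h : ∀ q ∈ P, ∃ r ∈ P, q ⊆ r ∧ Q r) : ∃ r ∈ G, Q r :=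
  hG.meet hM hP hQ hG.emp fun q hq _ => h q hq

theorem gen_exists (hc : M.toSet.Countable) (hP : P ∈ M) (hM : M.IsTransitive) (he : ∅ ∈ P)
    {p : ZFSet.{u}} (hp : p ∈ P) : ∃ G, Gen M P G ∧ p ∈ G := by
  classical
  have : Countable {x : ZFSet.{u} // x ∈ M} := hc.to_subtype
  have := Encodable.ofCountable {x : ZFSet.{u} // x ∈ M}
  let Pt := {x : ZFSet.{u} // x ∈ P}
  let _ : Preorder Pt := { le := fun a b => a.1 ⊆ b.1, le_refl := fun a => (fun _ h => h), le_trans := fun a b c h1 h2 => h1.trans h2 }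
  let I := {D : {x : ZFSet.{u} // x ∈ M} // D.1 ⊆ P ∧ ∀ p ∈ P, ∃ q ∈ D.1, p ⊆ q}
  have : Countable I := inferInstance
  have := Encodable.ofCountable I
  let 𝒟 : I → Order.Cofinal Pt := fun D => ⟨{x | x.1 ∈ D.1.1}, fun a => by
    obtain ⟨q, hq, h⟩ := D.2.2 a.1 a.2
    exact ⟨⟨q, D.2.1 hq⟩, hq, h⟩⟩
  let J := Order.idealOfCofinals (⟨p, hp⟩ : Pt) 𝒟
  refine ⟨ZFSet.sep (fun x => ∃ h : x ∈ P, (⟨x, h⟩ : Pt) ∈ J) P, ⟨ZFSet.sep_subset, ?_, ?_, ?_, ?_⟩, ?_⟩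
  · refine ZFSet.mem_sep.2 ⟨he, he, J.lower (a := ⟨p, hp⟩) ?_ (Order.mem_idealOfCofinals _ _)⟩
    exact ZFSet.empty_subset _
  · intro a ha b hb hab
    obtain ⟨h, h1, h2⟩ := ZFSet.mem_sep.1 ha
    exact ZFSet.mem_sep.2 ⟨hb, hb, J.lower (a := ⟨a, h⟩) hab h2⟩
  · intro a ha b hb
    obtain ⟨_, h1, h2⟩ := ZFSet.mem_sep.1 ha
    obtain ⟨_, h3, h4⟩ := ZFSet.mem_sep.1 hb
    obtain ⟨c, hc, h5, h6⟩ := J.directed _ h2 _ h4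
    exact ⟨c.1, ZFSet.mem_sep.2 ⟨c.2, c.2, hc⟩, h5, h6⟩
  · intro D hD h1 h2
    obtain ⟨x, h3, h4⟩ := Order.cofinal_meets_idealOfCofinals (⟨p, hp⟩ : Pt) 𝒟 ⟨⟨D, hD⟩, h1, h2⟩
    exact ⟨x.1, ZFSet.mem_sep.2 ⟨x.2, x.2, h4⟩, h3⟩
  · exact ZFSet.mem_sep.2 ⟨hp, hp, Order.mem_idealOfCofinals _ _⟩

/-! ### valuation -/
theorem rank_lt_of_pair {a p τ : ZFSet.{u}} (h : ZFSet.pair a p ∈ τ) : a.rank < τ.rank := by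
  refine lt_trans ?_ (ZFSet.rank_lt_of_mem h)
  refine lt_trans (ZFSet.rank_lt_of_mem (x := {a}) (ZFSet.mem_singleton.2 rfl)) (ZFSet.rank_lt_of_mem ?_)
  simp [ZFSet.pair]

noncomputable def val (G τ : ZFSet.{u}) : ZFSet.{u} :=
  ZFSet.range (fun y : {y : ZFSet.{u} // y ∈ ZFSet.sep (fun a => ∃ p ∈ G, ZFSet.pair a p ∈ τ)
    (ZFSet.sUnion (ZFSet.sUnion τ))} => val G y.1)
termination_by τ.rank
decreasing_by
  obtain ⟨_, p, _, h⟩ := ZFSet.mem_sep.1 y.2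
  exact rank_lt_of_pair h

theorem mem_val {x τ : ZFSet.{u}} : x ∈ val G τ ↔ ∃ a, ∃ p ∈ G, ZFSet.pair a p ∈ τ ∧ x = val G a := by
  rw [val, ZFSet.mem_range]
  constructor
  · rintro ⟨y, rfl⟩
    obtain ⟨_, p, hp, h⟩ := ZFSet.mem_sep.1 y.2
    exact ⟨y.1, p, hp, h, rfl⟩
  · rintro ⟨a, p, hp, h, rfl⟩
    refine ⟨⟨a, ZFSet.mem_sep.2 ⟨?_, p, hp, h⟩⟩, rfl⟩
    rw [ZFSet.mem_sUnion]
    exact ⟨{a, p}, ZFSet.mem_sUnion.2 ⟨_, h, by simp [ZFSet.pair]⟩, by simp⟩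

noncomputable def NG (M G : ZFSet.{u}) : ZFSet.{u} := ZFSet.range (fun x : {x : ZFSet.{u} // x ∈ M} => val G x.1)
theorem mem_NG {x : ZFSet.{u}} : x ∈ NG M G ↔ ∃ τ ∈ M, x = val G τ := by
  rw [NG, ZFSet.mem_range]
  exact ⟨fun ⟨y, h⟩ => ⟨y.1, y.2, h.symm⟩, fun ⟨τ, h, h'⟩ => ⟨⟨τ, h⟩, h'.symm⟩⟩

section
variable (hM : FM M) (hP : P ∈ M) (hG : Gen M P G)

theorem feq_val (hM : FM M) (hP : P ∈ M) (hG : Gen M P G) (σ : ZFSet.{u}) : ∀ τ, σ ∈ M → τ ∈ M → ∀ p ∈ G, FEq M P p σ τ → val G σ = val G τ := by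
  induction hα : σ.rank using WellFoundedLT.induction generalizing σ with
  | _ α ih =>
  subst hα
  have main : ∀ σ₁ τ₁, σ₁ ∈ M → τ₁ ∈ M → ∀ p ∈ G, FEq M P p σ₁ τ₁ →
      (∀ a b, ∀ r ∈ G, ∀ s t, ZFSet.pair a s ∈ σ₁ → ZFSet.pair b t ∈ τ₁ → a ∈ M → b ∈ M → FEq M P r a b → val G a = val G b) →
      val G σ₁ ⊆ val G τ₁ := by
    intro σ₁ τ₁ hσ hτ p hp h H x hx
    obtain ⟨a, s, hs, has, rfl⟩ := mem_val.1 hx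
    obtain ⟨p', hp', h1, h2⟩ := hG.dir p hp s hs
    have ha := (pair_mem_of hM.tr has hσ).1
    obtain ⟨r, hr, b, hb, t, ht, hbt, htr, hE⟩ := hG.meet hM hP (hM.sep3
      (fun M P a τ r => ∃ b ∈ M, ∃ t ∈ P, ZFSet.pair b t ∈ τ ∧ t ⊆ r ∧ FEq M P r a b) hP ha hτ hP) hp'
      (fun q hq hpq => feq_half hM h a ha s (hG.sub hs) has q hq (h1.trans hpq) (h2.trans hpq))
    rw [H a b r hr s t has hbt ha hb hE]
    exact mem_val.2 ⟨b, t, hG.up r hr t ht htr, hbt, rfl⟩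
  intro τ hσ hτ p hp h
  refine le_antisymm (α := ZFSet) (main σ τ hσ hτ p hp h ?_) (main τ σ hτ hσ p hp (feq_symm hM h) ?_)
  · intro a b r hr s t has hbt ha hb hE
    exact ih _ (rank_lt_of_pair has) a rfl b ha hb r hr hE
  · intro b a r hr s t hbt has hb ha hE
    exact (ih _ (rank_lt_of_pair has) a rfl b ha hb r hr (feq_symm hM hE)).symm

theorem not_half {p σ τ : ZFSet.{u}} (h : ¬ Half M P (FEq M P) p σ τ) :
    ∃ q ∈ P, p ⊆ q ∧ Bad M P q σ τ := by
  unfold Half at h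
  push Not at h
  obtain ⟨a, ha, s, hs, has, q, hq, hpq, hsq, h⟩ := h
  exact ⟨q, hq, hpq, a, ha, s, hs, has, hsq, fun r hr hqr b hb t ht hbt htr => h r hr hqr b hb t ht hbt htr⟩

theorem val_feq (hM : FM M) (hP : P ∈ M) (hG : Gen M P G) (σ : ZFSet.{u}) : ∀ τ, σ ∈ M → τ ∈ M → val G σ = val G τ → ∃ p ∈ G, FEq M P p σ τ := by
  induction hα : σ.rank using WellFoundedLT.induction generalizing σ with
  | _ α ih =>
  subst hα
  intro τ hσ hτ h
  obtain ⟨p, hp, h1 | h1 | h1⟩ := hG.meet0 hM hP (hM.sep3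
    (fun M P σ τ p => FEq M P p σ τ ∨ Bad M P p σ τ ∨ Bad M P p τ σ) hP hσ hτ hP) (by
      intro q hq
      by_cases c1 : Half M P (FEq M P) q σ τ
      · by_cases c2 : Half M P (FEq M P) q τ σ
        · exact ⟨q, hq, fun _ h => h, .inl (half_feq hM hP hq hσ hτ c1 c2)⟩
        · obtain ⟨r, hr, h1, h2⟩ := not_half c2
          exact ⟨r, hr, h1, .inr (.inr h2)⟩
      · obtain ⟨r, hr, h1, h2⟩ := not_half c1
        exact ⟨r, hr, h1, .inr (.inl h2)⟩)
  · exact ⟨p, hp, h1⟩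
  · obtain ⟨a, ha, s, hs, has, hsp, H⟩ := h1
    have : val G a ∈ val G τ := h ▸ mem_val.2 ⟨a, s, hG.up p hp s hs hsp, has, rfl⟩
    obtain ⟨b, t, ht, hbt, h2⟩ := mem_val.1 this
    have hb := (pair_mem_of hM.tr hbt hτ).1
    obtain ⟨p', hp', hE⟩ := ih _ (rank_lt_of_pair has) a rfl b ha hb h2
    obtain ⟨q, hq, e1, e2⟩ := hG.dir p hp p' hp'
    obtain ⟨r, hr, e3, e4⟩ := hG.dir q hq t ht
    exact absurd (feq_mono hM hP hE ha hb (hG.sub hr) (e2.trans e3))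
      (H r (hG.sub hr) (e1.trans e3) b hb t (hG.sub ht) hbt e4)
  · obtain ⟨b, hb, t, ht, hbt, htp, H⟩ := h1
    have : val G b ∈ val G σ := h ▸ mem_val.2 ⟨b, t, hG.up p hp t ht htp, hbt, rfl⟩
    obtain ⟨a, s, hs, has, h2⟩ := mem_val.1 this
    have ha := (pair_mem_of hM.tr has hσ).1
    obtain ⟨p', hp', hE⟩ := ih _ (rank_lt_of_pair has) a rfl b ha hb h2.symm
    obtain ⟨q, hq, e1, e2⟩ := hG.dir p hp p' hp'
    obtain ⟨r, hr, e3, e4⟩ := hG.dir q hq s hs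
    exact absurd (feq_symm hM (feq_mono hM hP hE ha hb (hG.sub hr) (e2.trans e3)))
      (H r (hG.sub hr) (e1.trans e3) a ha s (hG.sub hs) has e4)

theorem val_fmem (hM : FM M) (hP : P ∈ M) (hG : Gen M P G) {σ τ : ZFSet.{u}} (hσ : σ ∈ M) (hτ : τ ∈ M) :
    val G σ ∈ val G τ ↔ ∃ p ∈ G, FMem M P p σ τ := by
  constructor
  · intro h
    obtain ⟨b, t, ht, hbt, h2⟩ := mem_val.1 h
    have hb := (pair_mem_of hM.tr hbt hτ).1
    obtain ⟨p, hp, hE⟩ := val_feq hM hP hG σ b hσ hb h2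
    obtain ⟨r, hr, e1, e2⟩ := hG.dir p hp t ht
    refine ⟨r, hr, fun q hq hrq => ⟨q, hq, fun _ h => h, b, hb, t, hG.sub ht, hbt, e2.trans hrq, ?_⟩⟩
    exact feq_mono hM hP hE hσ hb hq (e1.trans hrq)
  · rintro ⟨p, hp, h⟩
    obtain ⟨r, hr, b, hb, t, ht, hbt, htr, hE⟩ := hG.meet hM hP (hM.sep3
      (fun M P a τ r => ∃ b ∈ M, ∃ t ∈ P, ZFSet.pair b t ∈ τ ∧ t ⊆ r ∧ FEq M P r a b) hP hσ hτ hP) hp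
      (fun q hq hpq => h q hq hpq)
    rw [feq_val hM hP hG σ b hσ hb r hr hE]
    exact mem_val.2 ⟨b, t, hG.up r hr t ht htr, hbt, rfl⟩

theorem ZM0.sepV (hM : ZM0 M) {n : ℕ} {R : ZFSet.{u} → (Fin n → ZFSet.{u}) → ZFSet.{u} → Prop} 
    (h : UD fun M (w : Fin (n + 1) → ZFSet.{u}) => R M (fun i => w (Fin.castSucc i)) (w (Fin.last n)))
    {v : Fin n → ZFSet.{u}} (hv : ∀ i, v i ∈ M) {a : ZFSet.{u}} (ha : a ∈ M) :
    ZFSet.sep (fun x => R M v x) a ∈ M := by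
  have := hM.sepU (h := h) hv ha
  simpa only [snc_cast, snc_last] using this

/-- environment with `P` in front -/
theorem cons_mem {n : ℕ} {P : ZFSet.{u}} (hP : P ∈ M) {v : Fin n → ZFSet.{u}} (hv : ∀ i, v i ∈ M) :
    ∀ i, (Fin.cons P v : Fin (n + 1) → ZFSet.{u}) i ∈ M := by
  intro i; refine Fin.cases ?_ (fun i => ?_) i
  · simpa using hP
  · simpa using hv i

theorem sep_imp (hM : FM M) (hP : P ∈ M) {n : ℕ} (φ ψ : BF n) {v : Fin n → ZFSet.{u}} (hv : ∀ i, v i ∈ M) :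
    ZFSet.sep (fun p => Fc M P (φ.imp ψ) p v ∨ (Fc M P φ p v ∧ ∀ q ∈ P, p ⊆ q → ¬ Fc M P ψ q v)) P ∈ M := by
  refine hM.sepV (R := fun M w p => Fc M (w 0) (φ.imp ψ) p (fun i => w i.succ) ∨ (Fc M (w 0) φ p (fun i => w i.succ) ∧ ∀ q ∈ w 0, p ⊆ q → ¬ Fc M (w 0) ψ q (fun i => w i.succ)))
    (v := Fin.cons P v) ?_ (cons_mem hP hv) hP
  have e1 : UD.{u} (n := n + 1 + 1) fun M w => Fc M (w (Fin.castSucc 0)) (φ.imp ψ) (w (Fin.last _)) (fun i => w i.succ.castSucc) := udFc _ _ inferInstance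
  have e2 : UD.{u} (n := n + 1 + 1) fun M w => Fc M (w (Fin.castSucc 0)) φ (w (Fin.last _)) (fun i => w i.succ.castSucc) := udFc _ _ inferInstance
  have e3 : UD.{u} (n := n + 1 + 1 + 1) fun M w => Fc M (w (Fin.castSucc (Fin.castSucc 0))) ψ (w (Fin.last _)) (fun i => w i.succ.castSucc.castSucc) := udFc _ _ inferInstance
  infer_instance

theorem sep_all (hM : FM M) (hP : P ∈ M) {n : ℕ} (φ : BF (n + 1)) {v : Fin n → ZFSet.{u}} (hv : ∀ i, v i ∈ M) :
    ZFSet.sep (fun p => Fc M P φ.all p v ∨ ∃ x ∈ M, ∀ q ∈ P, p ⊆ q → ¬ Fc M P φ q (snc v x)) P ∈ M := by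
  refine hM.sepV (R := fun M w p => Fc M (w 0) φ.all p (fun i => w i.succ) ∨ ∃ x ∈ M, ∀ q ∈ w 0, p ⊆ q → ¬ Fc M (w 0) φ q (snc (fun i => w i.succ) x))
    (v := Fin.cons P v) ?_ (cons_mem hP hv) hP
  have e1 : UD.{u} (n := n + 1 + 1) fun M w => Fc M (w (Fin.castSucc 0)) φ.all (w (Fin.last _)) (fun i => w i.succ.castSucc) := udFc _ _ inferInstance
  have e3 : UD.{u} (n := n + 1 + 1 + 1 + 1) fun M w => Fc M (w (Fin.castSucc (Fin.castSucc (Fin.castSucc 0)))) φ (w (Fin.last _)) (snc (fun i => w i.succ.castSucc.castSucc.castSucc) (w (Fin.castSucc (Fin.last _)))) := by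
    refine UD.congr (n := n + 1 + 1 + 1 + 1) (A := fun M w => Fc M (w (Fin.castSucc (Fin.castSucc (Fin.castSucc 0)))) φ (w (Fin.last _)) (fun i => Fin.lastCases (motive := fun _ => ZFSet.{u}) (w (Fin.castSucc (Fin.last _))) (fun i => w i.succ.castSucc.castSucc.castSucc) i))
      (h := udFc _ (fun i M w => Fin.lastCases (motive := fun _ => ZFSet.{u}) (w (Fin.castSucc (Fin.last _))) (fun i => w i.succ.castSucc.castSucc.castSucc) i) ?_) ?_
    · intro i
      refine Fin.lastCases ?_ (fun i => ?_) i
      · simp only [Fin.lastCases_last]; infer_instance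
      · simp only [Fin.lastCases_castSucc]; infer_instance
    · intro M _ w _
      apply iff_of_eq; congr 1
      funext i
      refine Fin.lastCases ?_ (fun i => ?_) i <;> simp [snc]
  infer_instance

theorem truth (hM : FM M) (hP : P ∈ M) (hG : Gen M P G) {n : ℕ} (φ : BF n) {v : Fin n → ZFSet.{u}} (hv : ∀ i, v i ∈ M) :
    Sat (NG M G) φ (fun i => val G (v i)) ↔ ∃ p ∈ G, Fc M P φ p v := by
  induction φ with
  | falsum => simp [Sat, Fc]
  | equal s t =>
    exact ⟨fun h => val_feq hM hP hG _ _ (hv _) (hv _) h, fun ⟨p, hp, h⟩ => feq_val hM hP hG _ _ (hv _) (hv _) p hp h⟩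
  | rel R ts =>
    cases R
    exact val_fmem hM hP hG (hv _) (hv _)
  | imp φ ψ h1 h2 =>
    have e : Sat (NG M G) (φ.imp ψ) (fun i => val G (v i)) ↔ ((∃ p ∈ G, Fc M P φ p v) → ∃ p ∈ G, Fc M P ψ p v) :=
      imp_congr (h1 hv) (h2 hv)
    rw [e]
    constructor
    · intro h
      obtain ⟨p, hp, h3 | ⟨h3, h4⟩⟩ := hG.meet0 hM hP (sep_imp hM hP φ ψ hv) (by
        intro p hp
        by_cases c : Fc M P (φ.imp ψ) p v
        · exact ⟨p, hp, fun _ h => h, .inl c⟩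
        · have : ∃ q ∈ P, p ⊆ q ∧ Fc M P φ q v ∧ ¬ Fc M P ψ q v := by
            by_contra hc
            push Not at hc
            exact c fun q hq hpq => hc q hq hpq
          obtain ⟨q, hq, hpq, c1, c2⟩ := this
          have : ∃ q' ∈ P, q ⊆ q' ∧ ∀ r ∈ P, q' ⊆ r → ¬ Fc M P ψ r v := by
            by_contra hc
            push Not at hc
            exact c2 (fc_dense hM hP ψ hv hq hc)
          obtain ⟨q', hq', h5, h6⟩ := this
          exact ⟨q', hq', hpq.trans h5, .inr ⟨fc_mono hM hP φ hv hq' h5 c1, h6⟩⟩)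
      · exact ⟨p, hp, h3⟩
      · obtain ⟨q, hq, h5⟩ := h ⟨p, hp, h3⟩
        obtain ⟨r, hr, h6, h7⟩ := hG.dir p hp q hq
        exact absurd (fc_mono hM hP ψ hv (hG.sub hr) h7 h5) (h4 r (hG.sub hr) h6)
    · rintro ⟨p, hp, h⟩ ⟨q, hq, h3⟩
      obtain ⟨r, hr, h6, h7⟩ := hG.dir p hp q hq
      exact ⟨r, hr, h r (hG.sub hr) h6 (fc_mono hM hP φ hv (hG.sub hr) h7 h3)⟩
  | all φ ih =>
    have e : Sat (NG M G) φ.all (fun i => val G (v i)) ↔ ∀ x ∈ M, ∃ p ∈ G, Fc M P φ p (snc v x) := by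
      have e0 : ∀ x, snc (fun i => val G (v i)) (val G x) = fun i => val G (snc v x i) := by
        intro x; funext i
        refine Fin.lastCases ?_ (fun i => ?_) i <;> simp [snc]
      constructor
      · intro h x hx
        refine (ih (snc_mem hv hx)).1 ?_
        rw [← e0]; exact h _ (mem_NG.2 ⟨x, hx, rfl⟩)
      · intro h y hy
        obtain ⟨x, hx, rfl⟩ := mem_NG.1 hy
        have := (ih (snc_mem hv hx)).2 (h x hx)
        rwa [← e0] at this
    rw [e]
    constructor
    · intro h
      obtain ⟨p, hp, h3 | ⟨x, hx, h4⟩⟩ := hG.meet0 hM hP (sep_all hM hP φ hv) (by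
        intro p hp
        by_cases c : Fc M P φ.all p v
        · exact ⟨p, hp, fun _ h => h, .inl c⟩
        · have : ∃ x ∈ M, ¬ Fc M P φ p (snc v x) := by
            by_contra hc
            push Not at hc
            exact c hc
          obtain ⟨x, hx, c2⟩ := this
          have : ∃ q' ∈ P, p ⊆ q' ∧ ∀ r ∈ P, q' ⊆ r → ¬ Fc M P φ r (snc v x) := by
            by_contra hc
            push Not at hc
            exact c2 (fc_dense hM hP φ (snc_mem hv hx) hp hc)
          obtain ⟨q', hq', h5, h6⟩ := this
          exact ⟨q', hq', h5, .inr ⟨x, hx, h6⟩⟩)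
      · exact ⟨p, hp, h3⟩
      · obtain ⟨q, hq, h5⟩ := h x hx
        obtain ⟨r, hr, h6, h7⟩ := hG.dir p hp q hq
        exact absurd (fc_mono hM hP φ (snc_mem hv hx) (hG.sub hr) h7 h5) (h4 r (hG.sub hr) h6)
    · rintro ⟨p, hp, h⟩ x hx
      exact ⟨p, hp, h x hx⟩
end
end Part6

section Part7
universe u
set_option linter.unusedVariables false
variable {M P G : ZFSet.{u}} 

section
variable {n m : ℕ} 
instance projSnc {u : Fin n → ZFSet.{u} → (Fin m → ZFSet.{u}) → ZFSet.{u}}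
    {x : ZFSet.{u} → (Fin m → ZFSet.{u}) → ZFSet.{u}} [hu : ∀ j, Proj (u j)] [hx : Proj x] (i : Fin (n + 1)) :
    Proj (fun M w => snc (fun j => u j M w) (x M w) i) := by
  refine Fin.lastCases ?_ (fun i => ?_) i
  · simp only [snc_last]; exact hx
  · simp only [snc, Fin.snoc_castSucc]; exact hu i

instance udFcI (φ : BF n) {s t : ZFSet.{u} → (Fin m → ZFSet.{u}) → ZFSet.{u}} [hs : Proj s]
    [ht : Proj t] {v : Fin n → ZFSet.{u} → (Fin m → ZFSet.{u}) → ZFSet.{u}} [hv : ∀ i, Proj (v i)] :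
    UD (fun M w => Fc M (s M w) φ (t M w) (fun i => v i M w)) := udFc φ v hv

example (φ : BF (n+1)) : UD.{u} (n := n + 2) fun M w => ∃ x ∈ M, ∃ p ∈ M, Fc M (w 0) φ p (snc (fun i => w i.succ.succ) x) :=
  inferInstance
end

/-- the name `{(σ,∅) : σ ∈ T}` -/
def box (T : ZFSet.{u}) : ZFSet.{u} := ZFSet.prod T {∅}
def n2 (a b : ZFSet.{u}) : ZFSet.{u} := {ZFSet.pair a ∅, ZFSet.pair b ∅}
def nop (a b : ZFSet.{u}) : ZFSet.{u} := n2 (n2 a a) (n2 a b)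

theorem FM.box (hM : FM M) {T : ZFSet.{u}} (hT : T ∈ M) : box T ∈ M := hM.prod hT (hM.sing hM.empty)
theorem FM.n2 (hM : FM M) {a b : ZFSet.{u}} (ha : a ∈ M) (hb : b ∈ M) : n2 a b ∈ M :=
  hM.pair _ (hM.opair ha hM.empty) _ (hM.opair hb hM.empty)
theorem FM.nop (hM : FM M) {a b : ZFSet.{u}} (ha : a ∈ M) (hb : b ∈ M) : nop a b ∈ M :=
  hM.n2 (hM.n2 ha ha) (hM.n2 ha hb)

section
variable (he : ∅ ∈ G)
theorem val_box (he : ∅ ∈ G) {T x : ZFSet.{u}} : x ∈ val G (box T) ↔ ∃ σ ∈ T, x = val G σ := by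
  simp only [mem_val, box, ZFSet.pair_mem_prod, ZFSet.mem_singleton]
  constructor
  · rintro ⟨a, p, _, ⟨h, rfl⟩, rfl⟩; exact ⟨a, h, rfl⟩
  · rintro ⟨a, h, rfl⟩; exact ⟨a, ∅, he, ⟨h, rfl⟩, rfl⟩
theorem val_n2 (he : ∅ ∈ G) {a b : ZFSet.{u}} : val G (n2 a b) = {val G a, val G b} := by
  ext x
  simp only [mem_val, n2, ZFSet.mem_pair, ZFSet.pair_inj]
  constructor
  · rintro ⟨c, p, _, ⟨rfl, rfl⟩ | ⟨rfl, rfl⟩, rfl⟩ <;> simp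
  · rintro (rfl | rfl)
    · exact ⟨a, ∅, he, .inl ⟨rfl, rfl⟩, rfl⟩
    · exact ⟨b, ∅, he, .inr ⟨rfl, rfl⟩, rfl⟩
theorem val_nop (he : ∅ ∈ G) {a b : ZFSet.{u}} : val G (nop a b) = ZFSet.pair (val G a) (val G b) := by
  rw [nop, val_n2 he, val_n2 he, val_n2 he]; simp [ZFSet.pair]
theorem val_chk (he : ∅ ∈ G) (x : ZFSet.{u}) : val G (chk x) = x := by
  induction x using ZFSet.inductionOn with
  | h x ih =>
  ext z
  simp only [mem_val, mem_chk]
  constructor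
  · rintro ⟨a, p, hp, ⟨y, hy, h⟩, rfl⟩
    obtain ⟨rfl, rfl⟩ := ZFSet.pair_inj.1 h
    rwa [ih y hy]
  · intro hz
    exact ⟨chk z, ∅, he, ⟨z, hz, rfl⟩, (ih z hz).symm⟩
end

theorem rank_val (τ : ZFSet.{u}) : (val G τ).rank ≤ τ.rank := by
  induction hα : τ.rank using WellFoundedLT.induction generalizing τ with
  | _ α ih =>
  subst hα
  rw [ZFSet.rank_le_iff]
  intro x hx
  obtain ⟨a, p, hp, h, rfl⟩ := mem_val.1 hx
  exact (ih _ (rank_lt_of_pair h) a rfl).trans_lt (rank_lt_of_pair h)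

theorem NG_mem {τ : ZFSet.{u}} (h : τ ∈ M) : val G τ ∈ NG M G := mem_NG.2 ⟨τ, h, rfl⟩

theorem NG_tr (hM : M.IsTransitive) : (NG M G).IsTransitive := by
  intro x hx y hy
  obtain ⟨τ, hτ, rfl⟩ := mem_NG.1 hx
  obtain ⟨a, p, hp, h, rfl⟩ := mem_val.1 hy
  exact NG_mem (pair_mem_of hM h hτ).1

theorem NG_countable (hc : M.toSet.Countable) : (NG M G).toSet.Countable := by
  refine (hc.image (val G)).mono ?_
  intro x hx
  obtain ⟨τ, hτ, rfl⟩ := mem_NG.1 (show x ∈ NG M G from hx)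
  exact ⟨τ, hτ, rfl⟩

theorem NG_sub (hM : FM M) (he : ∅ ∈ G) : M ⊆ NG M G := fun x hx => by
  rw [← val_chk he x]; exact NG_mem (hM.chk x hx)

theorem NG_ord (hM : FM M) {α : ZFSet.{u}} (hα : IsOrd α) (h : α ∈ NG M G) : α ∈ M := by
  obtain ⟨τ, hτ, rfl⟩ := mem_NG.1 h
  have ho := hM.sep0 (fun M z => IsOrd z) (hM.wl τ hτ)
  set o := ZFSet.sep _ _ with hodef
  have mo : ∀ z, z ∈ o ↔ (z ∈ M ∧ z.rank < τ.rank) ∧ IsOrd z := fun z => by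
    rw [hodef, ZFSet.mem_sep, mem_Wl]
  have e1 : ∀ x, IsOrd x → x.IsOrdinal := fun x hx => by
    rw [ZFSet.isOrdinal_iff_forall_mem_isTransitive]; exact hx
  have oo : IsOrd o := by
    refine ⟨fun x hx y hy => ?_, fun x hx => ((mo x).1 hx).2.1⟩
    obtain ⟨⟨h1, h2⟩, h3⟩ := (mo x).1 hx
    exact (mo y).2 ⟨⟨trans_mem hM.tr hy h1, (ZFSet.rank_lt_of_mem hy).trans h2⟩, h3.2 y hy,
      fun z hz => h3.2 z (trans_mem h3.1 hz hy)⟩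
  rcases ZFSet.IsOrdinal.mem_trichotomous (e1 _ hα) (e1 _ oo) with h1 | h1 | h1
  · exact trans_mem hM.tr h1 ho
  · rw [h1]; exact ho
  · exfalso
    exact ZFSet.mem_irrefl o ((mo o).2 ⟨⟨ho, (ZFSet.rank_lt_of_mem h1).trans_le (rank_val τ)⟩, oo⟩)

theorem NG_pair (hM : FM M) (he : ∅ ∈ G) : PairCl (NG M G) := by
  intro x hx y hy
  obtain ⟨σ, hσ, rfl⟩ := mem_NG.1 hx
  obtain ⟨τ, hτ, rfl⟩ := mem_NG.1 hy
  rw [← val_n2 he]; exact NG_mem (hM.n2 hσ hτ)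

section
variable (hM : FM M) (hP : P ∈ M) (hG : Gen M P G)

theorem val_snc {n : ℕ} (v : Fin n → ZFSet.{u}) (x : ZFSet.{u}) :
    snc (fun i => val G (v i)) (val G x) = fun i => val G (snc v x i) := by
  funext i
  refine Fin.lastCases ?_ (fun i => ?_) i <;> simp [snc]

theorem NG_sep (hM : FM M) (hP : P ∈ M) (hG : Gen M P G) (n : ℕ) (φ : BF (n + 1)) (v : Fin n → ZFSet.{u}) 
    (hv : ∀ i, v i ∈ NG M G) (a : ZFSet.{u}) (ha : a ∈ NG M G) :
    ZFSet.sep (fun x => Sat (NG M G) φ (snc v x)) a ∈ NG M G := by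
  choose t ht ht' using fun i => mem_NG.1 (hv i)
  obtain rfl : v = fun i => val G (t i) := funext ht'
  obtain ⟨τ, hτ, rfl⟩ := mem_NG.1 ha
  obtain ⟨T, hT, hTt, hτT⟩ := hM.tc τ hτ
  have hρ := hM.sepV (n := n + 1 + 1) (R := fun M w z => ∃ σ ∈ M, ∃ p ∈ M, z = ZFSet.pair σ p ∧ FMem M (w 0) p σ (w (Fin.succ 0)) ∧
    Fc M (w 0) φ p (snc (fun i => w i.succ.succ) σ)) inferInstance (v := Fin.cons P (Fin.cons τ t))
      (cons_mem hP (cons_mem hτ ht)) (hM.prod hT hP)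
  have hρ' : ZFSet.sep (fun z => ∃ σ ∈ M, ∃ p ∈ M, z = ZFSet.pair σ p ∧ FMem M P p σ τ ∧
    Fc M P φ p (snc t σ)) (ZFSet.prod T P) ∈ M := hρ
  refine mem_NG.2 ⟨_, hρ', ?_⟩
  ext x
  rw [ZFSet.mem_sep, mem_val (τ := ZFSet.sep _ _)]
  constructor
  · rintro ⟨h1, h2⟩
    obtain ⟨σ, s, hs, h, rfl⟩ := mem_val.1 h1
    have hσT := (pair_mem_of hTt h hτT).1
    have hσ := trans_mem hM.tr hσT hT
    rw [val_snc, truth hM hP hG φ (snc_mem ht hσ)] at h2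
    obtain ⟨p, hp, h3⟩ := h2
    obtain ⟨q, hq, h4⟩ := (val_fmem hM hP hG hσ hτ).1 h1
    obtain ⟨r, hr, e1, e2⟩ := hG.dir p hp q hq
    refine ⟨σ, r, hr, ZFSet.mem_sep.2 ⟨ZFSet.pair_mem_prod.2 ⟨hσT, hG.sub hr⟩, σ, hσ, r,
      trans_mem hM.tr (hG.sub hr) hP, rfl, fmem_mono h4 e2,
      fc_mono hM hP φ (snc_mem ht hσ) (hG.sub hr) e1 h3⟩, rfl⟩
  · rintro ⟨σ, p, hp, h, rfl⟩
    obtain ⟨_, σ', hσ, p', hp', h1, h2, h3⟩ := ZFSet.mem_sep.1 h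
    obtain ⟨rfl, rfl⟩ := ZFSet.pair_inj.1 h1
    rw [val_snc, truth hM hP hG φ (snc_mem ht hσ), val_fmem hM hP hG hσ hτ]
    exact ⟨⟨p, hp, h2⟩, p, hp, h3⟩

theorem NG_sepU (hM : FM M) (hP : P ∈ M) (hG : Gen M P G) {n : ℕ} {R : ZFSet.{u} → (Fin (n+1) → ZFSet.{u}) → Prop} [h : UD R]
    {v : Fin n → ZFSet.{u}} (hv : ∀ i, v i ∈ NG M G) {a : ZFSet.{u}} (ha : a ∈ NG M G) :
    ZFSet.sep (fun x => R (NG M G) (snc v x)) a ∈ NG M G := by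
  obtain ⟨φ, hφ⟩ := h.out
  have := NG_sep hM hP hG n φ v hv a ha
  convert this using 1
  ext x
  rw [ZFSet.mem_sep, ZFSet.mem_sep]
  refine and_congr_right fun hx => ?_
  exact (hφ _ (NG_tr hM.tr) _ (snc_mem hv (trans_mem (NG_tr hM.tr) hx ha))).symm

theorem NG_zm0 (hM : FM M) (hP : P ∈ M) (hG : Gen M P G) : ZM0 (NG M G) := by
  have he := hG.emp
  refine ⟨NG_tr hM.tr, NG_pair hM he, ?_, ?_, ?_, NG_sep hM hP hG⟩
  · intro x hx
    obtain ⟨τ, hτ, rfl⟩ := mem_NG.1 hx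
    obtain ⟨T, hT, hTt, hτT⟩ := hM.tc τ hτ
    have := NG_sepU hM hP hG (R := fun M (w : Fin (1 + 1) → ZFSet.{u}) => ∃ y ∈ w 0, w 1 ∈ y) (v := ![val G τ]) (by simpa using hx)
      (NG_mem (hM.box hT))
    convert this using 1
    ext z
    rw [ZFSet.mem_sep, ZFSet.mem_sUnion, val_box he]
    constructor
    · rintro ⟨y, hy, hz⟩
      refine ⟨?_, y, hy, hz⟩
      obtain ⟨σ, s, hs, h, rfl⟩ := mem_val.1 hy
      obtain ⟨a, t, ht, h', rfl⟩ := mem_val.1 hz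
      exact ⟨a, (pair_mem_of hTt h' (pair_mem_of hTt h hτT).1).1, rfl⟩
    · exact fun h => h.2
  · intro x hx
    obtain ⟨τ, hτ, rfl⟩ := mem_NG.1 hx
    obtain ⟨T, hT, hTt, hτT⟩ := hM.tc τ hτ
    have := NG_sepU hM hP hG (R := fun M (w : Fin (1 + 1) → ZFSet.{u}) => w 1 ⊆ w 0) (v := ![val G τ]) (by simpa using hx)
      (NG_mem (hM.box (hM.PM (hM.prod hT hP))))
    convert this using 1
    ext z
    rw [ZFSet.mem_sep, ZFSet.mem_sep, val_box he, ZFSet.mem_powerset]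
    constructor
    · rintro ⟨hz, hzN⟩
      refine ⟨?_, hz⟩
      obtain ⟨ρ, hρ, rfl⟩ := mem_NG.1 hzN
      have hρ' := hM.sep2 (fun M P ρ z => ∃ σ ∈ M, ∃ p ∈ M, z = ZFSet.pair σ p ∧ FMem M P p σ ρ) hP hρ (hM.prod hT hP)
      refine ⟨_, mem_PM.2 ⟨hρ', ZFSet.sep_subset⟩, ?_⟩
      ext x
      rw [mem_val (τ := ZFSet.sep _ _)]
      constructor
      · intro hx'
        obtain ⟨σ, s, hs, h, rfl⟩ := mem_val.1 (hz hx')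
        have hσT := (pair_mem_of hTt h hτT).1
        have hσ := trans_mem hM.tr hσT hT
        obtain ⟨p, hp, h1⟩ := (val_fmem hM hP hG hσ hρ).1 hx'
        exact ⟨σ, p, hp, ZFSet.mem_sep.2 ⟨ZFSet.pair_mem_prod.2 ⟨hσT, hG.sub hp⟩, σ, hσ, p,
          trans_mem hM.tr (hG.sub hp) hP, rfl, h1⟩, rfl⟩
      · rintro ⟨σ, p, hp, h, rfl⟩
        obtain ⟨_, σ', hσ, p', hp', h1, h2⟩ := ZFSet.mem_sep.1 h
        obtain ⟨rfl, rfl⟩ := ZFSet.pair_inj.1 h1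
        exact (val_fmem hM hP hG hσ hρ).2 ⟨p, hp, h2⟩
    · rintro ⟨⟨ρ, hρ, rfl⟩, h⟩
      exact ⟨h, NG_mem (mem_PM.1 hρ).1⟩
  · obtain ⟨x, hx, h⟩ := hM.inf
    exact ⟨x, NG_sub hM he hx, h⟩

/-- images of check names -/
def CK (M x z : ZFSet.{u}) : Prop := RecQ StepC M x z
instance udCK {n : ℕ} {s t : ZFSet.{u} → (Fin n → ZFSet.{u}) → ZFSet.{u}} [Proj s] [Proj t] :
    UD (fun M v => CK M (s M v) (t M v)) := udRecQ

theorem FM.chks (hM : FM M) {T : ZFSet.{u}} (hT : T ∈ M) : ∃ U ∈ M, ∀ x ∈ T, CtmForcing.chk x ∈ U := by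
  refine ⟨_, hM.un _ (hM.un _ (hM.chk T hT)), fun x hx => ?_⟩
  rw [ZFSet.mem_sUnion]
  refine ⟨{CtmForcing.chk x, ∅}, ZFSet.mem_sUnion.2 ⟨_, mem_chk.2 ⟨x, hx, rfl⟩, by simp [ZFSet.pair]⟩, by simp⟩

theorem NG_G (hM : FM M) (hP : P ∈ M) (hG : Gen M P G) : G ∈ NG M G := by
  obtain ⟨U, hU, hU'⟩ := hM.chks hP
  have h := hM.sep0 (fun M z => ∃ p ∈ M, ∃ c ∈ M, CK M p c ∧ z = ZFSet.pair c p) (hM.prod hU hP)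
  refine mem_NG.2 ⟨_, h, ?_⟩
  ext x
  rw [mem_val]
  constructor
  · intro hx
    have hxP := hG.sub hx
    have hxM := trans_mem hM.tr hxP hP
    refine ⟨chk x, x, hx, ZFSet.mem_sep.2 ⟨ZFSet.pair_mem_prod.2 ⟨hU' x hxP, hxP⟩, x, hxM, _, hM.chk x hxM, 
      (hM.cq x hxM _ (hM.chk x hxM)).2 rfl, rfl⟩, (val_chk hG.emp x).symm⟩
  · rintro ⟨a, p, hp, h, rfl⟩
    obtain ⟨_, p', hp', c, hc, h1, h2⟩ := ZFSet.mem_sep.1 h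
    obtain ⟨rfl, rfl⟩ := ZFSet.pair_inj.1 h2
    rw [(hM.cq _ hp' _ hc).1 h1, val_chk hG.emp]; exact hp

instance udn2 {n : ℕ} {s t r : ZFSet.{u} → (Fin n → ZFSet.{u}) → ZFSet.{u}} [Proj s] [Proj t] [Proj r] :
    UD (fun M v => s M v = n2 (t M v) (r M v)) :=
  UD.app3 (Q := fun _ x y z => x = n2 y z) <|
    UD.congr (n := 3) (A := fun M v => ∃ c ∈ v 0, ∃ d ∈ v 0, ∃ f ∈ c, ∃ e ∈ f, e = ∅ ∧ c = ZFSet.pair (v 1) e ∧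
      d = ZFSet.pair (v 2) e ∧ v 0 = {c, d}) (by
      intro M hM v _
      constructor
      · intro h; rw [h]
        exact ⟨_, ZFSet.mem_pair.2 (.inl rfl), _, ZFSet.mem_pair.2 (.inr rfl), {v 1, ∅}, by simp [ZFSet.pair], ∅, by simp, rfl, rfl, rfl, rfl⟩
      · rintro ⟨c, _, d, _, f, _, e, _, rfl, rfl, rfl, h⟩; exact h)

theorem NG_graph (hM : FM M) (he : ∅ ∈ G) {T : ZFSet.{u}} (hT : T ∈ M) :
    ∃ e ∈ NG M G, ∀ z, z ∈ e ↔ ∃ σ ∈ T, z = ZFSet.pair σ (val G σ) := by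
  obtain ⟨U, hU, hU'⟩ := hM.chks hT
  have h := hM.sep1 (fun M T z => ∃ σ ∈ T, ∃ c ∈ M, CK M σ c ∧ ∃ a ∈ M, ∃ b ∈ M, a = n2 c c ∧ b = n2 c σ ∧ 
    z = n2 a b) hT (hM.PM (hM.prod (hM.PM (hM.prod (hM.union hU hT) (hM.sing hM.empty))) (hM.sing hM.empty)))
  set E := ZFSet.sep _ _ with hE
  have n2sub : ∀ {a b X}, a ∈ X → b ∈ X → n2 a b ⊆ ZFSet.prod X {∅} := by
    intro a b X ha hb z hz
    rcases ZFSet.mem_pair.1 hz with rfl | rfl <;> simp [*]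
  have mE : ∀ z, z ∈ E ↔ ∃ σ ∈ T, z = nop (chk σ) σ := by
    intro z
    rw [hE, ZFSet.mem_sep]
    constructor
    · rintro ⟨_, σ, hσ, c, hc, h1, a, ha, b, hb, rfl, rfl, rfl⟩
      refine ⟨σ, hσ, ?_⟩
      rw [(hM.cq σ (trans_mem hM.tr hσ hT) c hc).1 h1]; rfl
    · rintro ⟨σ, hσ, rfl⟩
      have hσM := trans_mem hM.tr hσ hT
      have hcM := hM.chk σ hσM
      have a1 : chk σ ∈ U ∪ T := by simp [hU' σ hσ]
      have a2 : σ ∈ U ∪ T := by simp [hσ]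
      refine ⟨mem_PM.2 ⟨hM.nop hcM hσM, n2sub ?_ ?_⟩, σ, hσ, _, hcM, (hM.cq σ hσM _ hcM).2 rfl, _, hM.n2 hcM hcM, _, 
        hM.n2 hcM hσM, rfl, rfl, rfl⟩
      · exact mem_PM.2 ⟨hM.n2 hcM hcM, n2sub a1 a1⟩
      · exact mem_PM.2 ⟨hM.n2 hcM hσM, n2sub a1 a2⟩
  refine ⟨val G (box E), NG_mem (hM.box h), fun z => ?_⟩
  rw [val_box he]
  constructor
  · rintro ⟨ρ, hρ, rfl⟩
    obtain ⟨σ, hσ, rfl⟩ := (mE _).1 hρ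
    exact ⟨σ, hσ, by rw [val_nop he, val_chk he]⟩
  · rintro ⟨σ, hσ, rfl⟩
    exact ⟨_, (mE _).2 ⟨σ, hσ, rfl⟩, by rw [val_nop he, val_chk he]⟩

theorem NG_zm (hM : FM M) (hP : P ∈ M) (hG : Gen M P G) : ZM (NG M G) := by
  have hN := NG_zm0 hM hP hG
  have he := hG.emp
  refine ⟨hN, fun x hx => ?_⟩
  rcases ZFSet.eq_empty_or_nonempty x with rfl | ⟨x0, hx0⟩
  · refine ⟨∅, hx, ⟨fun x hx => by simp at hx, fun x hx => by simp at hx⟩, ∅, hx, ?_⟩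
    refine ⟨?_, ?_, ?_, ?_⟩ <;> intros <;> simp_all
  obtain ⟨τ, hτ, rfl⟩ := mem_NG.1 hx
  obtain ⟨T, hT, hTt, hτT⟩ := hM.tc τ hτ
  obtain ⟨α, hα, hαo, f, hf, hfs⟩ := hM.ac T hT
  obtain ⟨e, heN, hee⟩ := NG_graph hM he hT
  have hαN := NG_sub hM he hα
  have hfN := NG_sub hM he hf
  have hx0N := trans_mem hN.tr hx0 hx
  have h1 := hN.sep4 (fun M f e x x0 z => ∃ b ∈ M, ∃ y ∈ M, z = ZFSet.pair b y ∧ ((∃ s ∈ M, ZFSet.pair b s ∈ f ∧ ZFSet.pair s y ∈ e) ∨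
    (y = x0 ∧ ∀ y' ∈ x, ∀ s ∈ M, ZFSet.pair b s ∈ f → ¬ ZFSet.pair s y' ∈ e))) hfN heN hx hx0N (hN.prod hαN hx)
  set g := ZFSet.sep _ _ with hg
  obtain ⟨f1, f2, f3, f4⟩ := hfs
  have key : ∀ s y, ZFSet.pair s y ∈ e ↔ s ∈ T ∧ y = val G s := by
    intro s y
    rw [hee]
    constructor
    · rintro ⟨σ, hσ, h⟩
      obtain ⟨rfl, rfl⟩ := ZFSet.pair_inj.1 h
      exact ⟨hσ, rfl⟩
    · rintro ⟨h, rfl⟩; exact ⟨s, h, rfl⟩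
  have mg : ∀ b y, ZFSet.pair b y ∈ g ↔ b ∈ α ∧ y ∈ val G τ ∧ ((∃ s ∈ T, ZFSet.pair b s ∈ f ∧ y = val G s) ∨
      (y = x0 ∧ ∀ s ∈ T, ZFSet.pair b s ∈ f → val G s ∉ val G τ)) := by
    intro b y
    rw [hg, ZFSet.mem_sep, ZFSet.pair_mem_prod, and_assoc]
    refine and_congr_right fun hb => and_congr_right fun hy => ?_
    constructor
    · rintro ⟨b', _, y', _, h, h'⟩
      obtain ⟨rfl, rfl⟩ := ZFSet.pair_inj.1 h
      refine h'.imp ?_ ?_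
      · rintro ⟨s, hs, h2, h3⟩
        exact ⟨s, ((key _ _).1 h3).1, h2, ((key _ _).1 h3).2⟩
      · rintro ⟨rfl, h⟩
        exact ⟨rfl, fun s hs h2 h3 => h _ h3 s (NG_sub hM he (trans_mem hM.tr hs hT)) h2 ((key _ _).2 ⟨hs, rfl⟩)⟩
    · intro h'
      refine ⟨b, trans_mem hN.tr hb hαN, y, trans_mem hN.tr hy hx, rfl, h'.imp ?_ ?_⟩
      · rintro ⟨s, hs, h2, rfl⟩
        exact ⟨s, NG_sub hM he (trans_mem hM.tr hs hT), h2, (key _ _).2 ⟨hs, rfl⟩⟩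
      · rintro ⟨rfl, h⟩
        refine ⟨rfl, fun y' hy' s _ h2 h3 => ?_⟩
        obtain ⟨h4, rfl⟩ := (key _ _).1 h3
        exact h s h4 h2 hy'
  refine ⟨α, hαN, hαo, g, h1, ?_, ?_, ?_, ?_⟩
  · intro z hz
    exact ZFSet.mem_prod.1 (ZFSet.mem_sep.1 hz).1
  · intro b hb
    obtain ⟨s, hs, hbs⟩ := f2 b hb
    by_cases c : val G s ∈ val G τ
    · exact ⟨_, c, (mg _ _).2 ⟨hb, c, .inl ⟨s, hs, hbs, rfl⟩⟩⟩
    · exact ⟨x0, hx0, (mg _ _).2 ⟨hb, hx0, .inr ⟨rfl, fun s' hs' h' => f3 _ _ _ hbs h' ▸ c⟩⟩⟩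
  · intro b y y' h2 h3
    obtain ⟨hb, hy, h4⟩ := (mg _ _).1 h2
    obtain ⟨_, hy', h5⟩ := (mg _ _).1 h3
    rcases h4 with ⟨s, hs, a1, rfl⟩ | ⟨rfl, a⟩ <;> rcases h5 with ⟨s', hs', a2, rfl⟩ | ⟨rfl, a'⟩
    · rw [f3 _ _ _ a1 a2]
    · exact absurd hy (a' _ hs a1)
    · exact absurd hy' (a _ hs' a2)
    · rfl
  · intro y hy
    obtain ⟨σ, s, hs, h, rfl⟩ := mem_val.1 hy
    have hσT := (pair_mem_of hTt h hτT).1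
    obtain ⟨b, hb, hbf⟩ := f4 σ hσT
    exact ⟨b, hb, (mg _ _).2 ⟨hb, hy, .inl ⟨σ, hσT, hbf, rfl⟩⟩⟩

/-! ### replacement -/
def LvQ {n : ℕ} (φ : BF (n + 2)) (M P : ZFSet.{u}) (v : Fin n → ZFSet.{u}) (σ p z : ZFSet.{u}) : Prop :=
  (∃ y ∈ M, RecQ StepW M y z) ∧ ∃ ρ ∈ z, Fc M P φ p (snc (snc v σ) ρ)
def RpQ {n : ℕ} (φ : BF (n + 2)) (M P : ZFSet.{u}) (v : Fin n → ZFSet.{u}) (x z : ZFSet.{u}) : Prop :=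
  ∃ σ ∈ M, ∃ p ∈ M, x = ZFSet.pair σ p ∧ LvQ φ M P v σ p z ∧ ∀ z' ∈ M, LvQ φ M P v σ p z' → z ⊆ z'
instance udRpQ {n : ℕ} (φ : BF (n + 2)) : UD.{u} (n := n + 1 + 2) fun M w =>
    RpQ φ M (w 0) (fun i => w i.succ.castSucc.castSucc) (w (Fin.castSucc (Fin.last _))) (w (Fin.last _)) := by
  unfold RpQ LvQ; infer_instance
noncomputable def FF : (Σ n : ℕ, BF (n + 2)) → (Σ n : ℕ, BF (n + 2)) := fun p =>
  ⟨p.1 + 1, fm.{u} (n := p.1 + 1 + 2) fun M w =>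
    RpQ p.2 M (w 0) (fun i => w i.succ.castSucc.castSucc) (w (Fin.castSucc (Fin.last _))) (w (Fin.last _))⟩

theorem NG_repl (hM : FM M) (hP : P ∈ M) (hG : Gen M P G) {n : ℕ} (φ : BF (n + 2))
    (h : Repl M (FF.{u} ⟨n, φ⟩).2) : Repl (NG M G) φ := by
  have hN := NG_zm0 hM hP hG
  intro v hv A hA hfun
  choose t ht ht' using fun i => mem_NG.1 (hv i)
  obtain rfl : v = fun i => val G (t i) := funext ht'
  obtain ⟨τ, hτ, rfl⟩ := mem_NG.1 hA
  obtain ⟨T, hT, hTt, hτT⟩ := hM.tc τ hτ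
  have key : ∀ x ∈ M, ∀ z ∈ M, Sat M (FF.{u} ⟨n, φ⟩).2 (snc (snc (Fin.cons P t) x) z) ↔ RpQ φ M P t x z := by
    intro x hx z hz
    have e := fm_spec.{u} (n := n + 1 + 2) (fun M w =>
      RpQ φ M (w 0) (fun i => w i.succ.castSucc.castSucc) (w (Fin.castSucc (Fin.last _))) (w (Fin.last _))) hM.tr
      (snc_mem (snc_mem (cons_mem hP ht) hx) hz)
    refine e.trans ?_
    have e0 : snc (snc (Fin.cons P t) x) z (0 : Fin (n + 1 + 2)) = P := by
      have : (0 : Fin (n + 1 + 2)) = Fin.castSucc (Fin.castSucc 0) := rfl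
      rw [this]; simp [snc]
    have e1 : (fun i : Fin n => snc (snc (Fin.cons P t) x) z i.succ.castSucc.castSucc) = t := by
      funext i
      rw [snc, Fin.snoc_castSucc, snc, Fin.snoc_castSucc, Fin.cons_succ]
    rw [e0, e1, snc, Fin.snoc_castSucc, snc, Fin.snoc_last, Fin.snoc_last]
  obtain ⟨Z, hZ, hZ'⟩ := h (Fin.cons P t) (cons_mem hP ht) (ZFSet.prod T P) (hM.prod hT hP) (by
    intro x hx y hy y' hy' h1 h2
    have hxM := trans_mem hM.tr hx (hM.prod hT hP)
    rw [key x hxM y hy] at h1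
    rw [key x hxM y' hy'] at h2
    obtain ⟨σ, hσ, p, hp, rfl, h3, h4⟩ := h1
    obtain ⟨σ', hσ', p', hp', h5, h6, h7⟩ := h2
    obtain ⟨rfl, rfl⟩ := ZFSet.pair_inj.1 h5
    exact le_antisymm (α := ZFSet) (h4 _ hy' h6) (h7 _ hy h3))
  have hS := NG_mem (G := G) (hM.box (hM.un _ hZ))
  have := hN.sepV (n := n + 1) (R := fun M w y => ∃ x ∈ w 0, Sat M φ (snc (snc (fun i => w i.succ) x) y))
    (by
      have : UD.{u} (n := n + 1 + 1 + 1) fun M w => Sat M φ (snc (snc (fun i : Fin n => w i.succ.castSucc.castSucc) (w (Fin.last _))) (w (Fin.castSucc (Fin.last _)))) := by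
        have e : UD.{u} (n := n + 2) fun M w => Sat M φ w := ⟨φ, fun _ _ _ _ => Iff.rfl⟩
        exact e.app (fun i M w => snc (snc (fun i : Fin n => w i.succ.castSucc.castSucc) (w (Fin.last _))) (w (Fin.castSucc (Fin.last _))) i) inferInstance
      infer_instance)
    (v := Fin.cons (val G τ) (fun i => val G (t i))) (cons_mem hA hv) hS
  refine ⟨_, this, fun y => ?_⟩
  rw [ZFSet.mem_sep]
  constructor
  · rintro ⟨h1, h2⟩
    exact ⟨trans_mem hN.tr h1 hS, h2⟩
  · rintro ⟨hy, x, hx, h1⟩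
    refine ⟨?_, x, hx, h1⟩
    have hx0 := hx
    obtain ⟨σ, s, hs, hσ', rfl⟩ := mem_val.1 hx
    have hσT := (pair_mem_of hTt hσ' hτT).1
    have hσ := trans_mem hM.tr hσT hT
    obtain ⟨ρ, hρ, rfl⟩ := mem_NG.1 hy
    have h2 := h1
    rw [val_snc, val_snc, truth hM hP hG φ (snc_mem (snc_mem ht hσ) hρ)] at h2
    obtain ⟨p, hp, h3⟩ := h2
    have hpM := trans_mem hM.tr (hG.sub hp) hP
    have lv : ∀ z, LvQ φ M P t σ p z ↔ ∃ y ∈ M, z = Wl M y ∧ ∃ ρ ∈ z, Fc M P φ p (snc (snc t σ) ρ) := by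
      intro z
      constructor
      · rintro ⟨⟨y, hy, h4⟩, h5⟩
        have hz : z ∈ M := by
          obtain ⟨f, hf, _, h⟩ := h4
          exact (pair_mem_of hM.tr h hf).2
        exact ⟨y, hy, (hM.wq y hy z hz).1 h4, h5⟩
      · rintro ⟨y, hy, rfl, h5⟩
        exact ⟨⟨y, hy, (hM.wq y hy _ (hM.wl y hy)).2 rfl⟩, h5⟩
    have ex : ∃ α : Ordinal.{u}, ∃ y ∈ M, y.rank = α ∧ ∃ ρ ∈ Wl M y, Fc M P φ p (snc (snc t σ) ρ) :=
      ⟨_, {ρ}, hM.sing hρ, rfl, ρ, mem_Wl.2 ⟨hρ, ZFSet.rank_lt_of_mem (ZFSet.mem_singleton.2 rfl)⟩, h3⟩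
    obtain ⟨y, hyM, hyr, ρ', hρ', h4⟩ := WellFounded.min_mem wellFounded_lt _ ex
    have hρ'M := (mem_Wl.1 hρ').1
    have hz : RpQ φ M P t (ZFSet.pair σ p) (Wl M y) := by
      refine ⟨σ, hσ, p, hpM, rfl, (lv _).2 ⟨y, hyM, rfl, ρ', hρ', h4⟩, fun z' _ hz' w hw => ?_⟩
      obtain ⟨y', hy', rfl, h6⟩ := (lv _).1 hz'
      have := WellFounded.not_lt_min wellFounded_lt {α : Ordinal.{u} | ∃ y ∈ M, y.rank = α ∧ ∃ ρ ∈ Wl M y, Fc M P φ p (snc (snc t σ) ρ)} 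
        (x := y'.rank) ⟨y', hy', rfl, h6⟩
      have hle : y.rank ≤ y'.rank := by rw [hyr]; exact not_lt.1 this
      rw [mem_Wl] at hw ⊢
      exact ⟨hw.1, hw.2.trans_le hle⟩
    have hWZ : Wl M y ∈ Z := (hZ' _).2 ⟨hM.wl y hyM, _, ZFSet.pair_mem_prod.2 ⟨hσT, hG.sub hp⟩, (key _ (hM.opair hσ hpM) _ (hM.wl y hyM)).2 hz⟩
    have h5 : Sat (NG M G) φ (snc (snc (fun i => val G (t i)) (val G σ)) (val G ρ')) := by
      rw [val_snc, val_snc, truth hM hP hG φ (snc_mem (snc_mem ht hσ) hρ'M)]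
      exact ⟨p, hp, h4⟩
    rw [hfun _ hx0 _ hy _ (NG_mem hρ'M) h1 h5, val_box hG.emp]
    exact ⟨ρ', ZFSet.mem_sUnion.2 ⟨_, hWZ, hρ'⟩, rfl⟩
end
end Part7

section Part8
universe u
set_option linter.unusedVariables false
variable {M P G : ZFSet.{u}} 

/-- pairwise incompatible finite conditions of bounded size are finite in number -/
theorem anti {α ι : Type*} (C : α → α → Prop) (hC : ∀ a, {b | C a b}.Finite) (n : ℕ) :
    ∀ (J : Set ι) (f : ι → Finset α), (∀ i ∈ J, (f i).card ≤ n ∧ ∀ a ∈ f i, ∀ b ∈ f i, ¬ C a b) →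
    (∀ i ∈ J, ∀ j ∈ J, i ≠ j → ∃ a ∈ f i, ∃ b ∈ f j, C a b) → J.Finite := by
  classical
  induction n with
  | zero =>
    intro J f h1 h2
    refine Set.Subsingleton.finite fun i hi j hj => ?_
    by_contra hne
    obtain ⟨a, ha, _⟩ := h2 i hi j hj hne
    have := (h1 i hi).1
    simp at this
    simp [this] at ha
  | succ n ih =>
    intro J f h1 h2
    rcases J.eq_empty_or_nonempty with rfl | ⟨i0, hi0⟩
    · exact Set.finite_empty
    have key : ∀ b, {j | j ∈ J ∧ b ∈ f j}.Finite := by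
      intro b
      refine ih _ (fun j => (f j).erase b) ?_ ?_
      · rintro i ⟨hi, hb⟩
        refine ⟨?_, fun a ha c hc => (h1 i hi).2 a (Finset.mem_of_mem_erase ha) c (Finset.mem_of_mem_erase hc)⟩
        rw [Finset.card_erase_of_mem hb]
        have := (h1 i hi).1
        omega
      · rintro i ⟨hi, hbi⟩ j ⟨hj, hbj⟩ hne
        obtain ⟨a, ha, c, hc, hac⟩ := h2 i hi j hj hne
        refine ⟨a, Finset.mem_erase.2 ⟨?_, ha⟩, c, Finset.mem_erase.2 ⟨?_, hc⟩, hac⟩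
        · rintro rfl; exact (h1 j hj).2 _ hbj _ hc hac
        · rintro rfl; exact (h1 i hi).2 _ ha _ hbi hac
    have hfin : (insert i0 (⋃ a ∈ (f i0 : Set α), ⋃ b ∈ {b | C a b}, {j | j ∈ J ∧ b ∈ f j})).Finite :=
      ((f i0).finite_toSet.biUnion fun a _ => (hC a).biUnion fun b _ => key b).insert _
    refine hfin.subset fun j hj => ?_
    by_cases hne : i0 = j
    · exact Set.mem_insert_iff.2 (.inl hne.symm)
    · obtain ⟨a, ha, b, hb, hab⟩ := h2 i0 hi0 j hj hne
      refine Set.mem_insert_iff.2 (.inr ?_)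
      simp only [Set.mem_iUnion]
      exact ⟨a, ha, b, hab, hj, hb⟩

/-- diagonalisation -/
def OkQ (M w R x k : ZFSet.{u}) : Prop :=
  ∀ S ∈ M, ZFSet.pair x S ∈ R → ∃ j ∈ w, ¬ (ZFSet.pair x j ∈ S ↔ j = k)
instance udOkQ {n : ℕ} {s t r q : ZFSet.{u} → (Fin n → ZFSet.{u}) → ZFSet.{u}} [Proj s] [Proj t] [Proj r] [Proj q] :
    UD (fun M v => OkQ M (s M v) (t M v) (r M v) (q M v)) :=
  UD.app4 (Q := OkQ) <| by unfold OkQ; infer_instance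

theorem no_cover (hM : ZM0 M) {X R : ZFSet.{u}} (hX : X ∈ M) (hR : R ∈ M)
    (hfin : ∀ x ∈ X, {S | ZFSet.pair x S ∈ R}.Finite)
    (hcov : ∀ S ∈ PM M (ZFSet.prod X om), ∃ x ∈ X, ZFSet.pair x S ∈ R) : False := by
  classical
  have hD := hM.sep2 (fun M w R z => ∃ x ∈ M, ∃ k ∈ M, z = ZFSet.pair x k ∧ OkQ M w R x k ∧ ∀ j ∈ k, ¬ OkQ M w R x j)
    hM.om hR (hM.prod hX hM.om)
  set D := ZFSet.sep _ _ with hDD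
  obtain ⟨x, hx, hxD⟩ := hcov D (mem_PM.2 ⟨hD, ZFSet.sep_subset⟩)
  have hxM := trans_mem hM.tr hx hX
  have mD : ∀ k, ZFSet.pair x k ∈ D ↔ k ∈ om ∧ OkQ M om R x k ∧ ∀ j ∈ k, ¬ OkQ M om R x j := by
    intro k
    rw [hDD, ZFSet.mem_sep, ZFSet.pair_mem_prod]
    constructor
    · rintro ⟨⟨_, hk⟩, x', _, k', _, h, h'⟩
      obtain ⟨rfl, rfl⟩ := ZFSet.pair_inj.1 h
      exact ⟨hk, h'⟩
    · rintro ⟨hk, h'⟩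
      exact ⟨⟨hx, hk⟩, x, hxM, k, trans_mem hM.tr hk hM.om, rfl, h'⟩
  -- some value is fine
  have hex : ∃ k : ℕ, OkQ M om R x (nn k) := by
    by_contra hcon
    push Not at hcon
    simp only [OkQ] at hcon
    push Not at hcon
    choose S hSM hSR hS using hcon
    have hinj : Function.Injective S := by
      intro i j hij
      have h1 : ZFSet.pair x (nn i) ∈ S i := (hS i (nn i) (nn_mem_om i)).2 rfl
      rw [hij] at h1
      exact nn_inj ((hS j (nn i) (nn_mem_om i)).1 h1)
    exact Set.infinite_of_injective_forall_mem hinj (fun k => hSR k) (hfin x hx)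
  have hmin := Nat.find_spec hex
  have hlt : ∀ j < Nat.find hex, ¬ OkQ M om R x (nn j) := fun j hj => Nat.find_min hex hj
  set k := Nat.find hex with hk
  obtain ⟨j, hj, hj'⟩ := hmin D hD hxD
  obtain ⟨i, rfl⟩ := mem_om.1 hj
  apply hj'
  rw [mD]
  constructor
  · rintro ⟨_, h1, h2⟩
    rcases lt_trichotomy i k with h | h | h
    · exact absurd h1 (hlt i h)
    · rw [h]
    · exact absurd hmin (h2 _ (nn_mem_nn.2 h))
  · intro h
    obtain rfl := nn_inj h
    refine ⟨hj, hmin, fun y hy => ?_⟩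
    obtain ⟨l, hl, rfl⟩ := mem_nn.1 hy
    exact hlt l hl

/-! ### Cohen conditions -/
def SzQ (M n p : ZFSet.{u}) : Prop :=
  ∃ f ∈ M, (∀ x ∈ p, ∃ y ∈ n, ZFSet.pair x y ∈ f) ∧
    ∀ x ∈ p, ∀ x' ∈ p, ∀ y ∈ n, ZFSet.pair x y ∈ f → ZFSet.pair x' y ∈ f → x = x'
instance udSzQ {n : ℕ} {s t : ZFSet.{u} → (Fin n → ZFSet.{u}) → ZFSet.{u}} [Proj s] [Proj t] :
    UD (fun M v => SzQ M (s M v) (t M v)) :=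
  UD.app2 (Q := SzQ) <| by unfold SzQ; infer_instance

theorem sz_fin {k : ℕ} {p : ZFSet.{u}} (h : SzQ M (nn k) p) : ∃ s : Finset ZFSet.{u}, (∀ x, x ∈ s ↔ x ∈ p) ∧ s.card ≤ k := by
  classical
  obtain ⟨f, hf, h1, h2⟩ := h
  have h1' : ∀ x : {x // x ∈ p}, ∃ j : Fin k, ZFSet.pair x.1 (nn j) ∈ f := by
    rintro ⟨x, hx⟩
    obtain ⟨y, hy, h⟩ := h1 x hx
    obtain ⟨j, hj, rfl⟩ := mem_nn.1 hy
    exact ⟨⟨j, hj⟩, h⟩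
  choose e he using h1'
  have hinj : Function.Injective e := by
    rintro ⟨x, hx⟩ ⟨y, hy⟩ hxy
    have a := he ⟨x, hx⟩
    rw [hxy] at a
    exact Subtype.ext (h2 x hx y hy _ (nn_mem_nn.2 (e ⟨y, hy⟩).2) a (he ⟨y, hy⟩))
  have := Finite.of_injective e hinj
  have := Fintype.ofFinite {x // x ∈ p}
  refine ⟨Finset.univ.image (fun x : {x // x ∈ p} => x.1), fun x => by simp, ?_⟩
  refine Finset.card_image_le.trans ?_
  rw [Finset.card_univ]
  simpa using Fintype.card_le_of_injective e hinj

theorem fin_sz (hM : ZM0 M) {p : ZFSet.{u}} (hp : p ∈ M) (s : Finset ZFSet.{u}) (hs : ∀ x, x ∈ s ↔ x ∈ p) :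
    SzQ M (nn s.card) p := by
  classical
  let e := s.equivFin
  obtain ⟨f, hf, hf'⟩ := hM.finset (s.attach.image fun x => ZFSet.pair x.1 (nn (e x))) (by
    intro z hz
    obtain ⟨x, _, rfl⟩ := Finset.mem_image.1 hz
    exact hM.opair (trans_mem hM.tr ((hs _).1 x.2) hp) (hM.nn _))
  have mf : ∀ x y, ZFSet.pair x y ∈ f ↔ ∃ h : x ∈ s, y = nn (e ⟨x, h⟩) := by
    intro x y
    rw [hf', Finset.mem_image]
    constructor
    · rintro ⟨⟨x', hx'⟩, _, h⟩
      obtain ⟨rfl, rfl⟩ := ZFSet.pair_inj.1 h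
      exact ⟨hx', rfl⟩
    · rintro ⟨h, rfl⟩
      exact ⟨⟨x, h⟩, by simp, rfl⟩
  refine ⟨f, hf, fun x hx => ⟨_, nn_mem_nn.2 (e ⟨x, (hs x).2 hx⟩).2, (mf _ _).2 ⟨_, rfl⟩⟩, ?_⟩
  intro x _ x' _ y _ h1 h2
  obtain ⟨h, rfl⟩ := (mf _ _).1 h1
  obtain ⟨h', h3⟩ := (mf _ _).1 h2
  have := e.injective (Fin.ext (nn_inj h3))
  exact congrArg Subtype.val this

def Cf (a b : ZFSet.{u}) : Prop :=
  ∃ x, (a = ZFSet.pair x ∅ ∧ b = ZFSet.pair x {∅}) ∨ (a = ZFSet.pair x {∅} ∧ b = ZFSet.pair x ∅)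
theorem Cf.symm {a b : ZFSet.{u}} (h : Cf a b) : Cf b a := by
  obtain ⟨x, h | h⟩ := h
  · exact ⟨x, .inr h.symm⟩
  · exact ⟨x, .inl h.symm⟩
theorem Cf_fin (a : ZFSet.{u}) : {b | Cf a b}.Finite := by
  classical
  by_cases h : ∃ x y, a = ZFSet.pair x y
  · obtain ⟨x, y, rfl⟩ := h
    refine (Set.toFinite {ZFSet.pair x ∅, ZFSet.pair x {∅}}).subset ?_
    rintro b ⟨z, ⟨h1, h2⟩ | ⟨h1, h2⟩⟩ <;> obtain ⟨rfl, -⟩ := ZFSet.pair_inj.1 h1 <;> simp [h2]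
  · refine Set.Finite.subset Set.finite_empty ?_
    rintro b ⟨z, ⟨h1, h2⟩ | ⟨h1, h2⟩⟩ <;> exact (h ⟨_, _, h1⟩).elim

noncomputable def Pc (M I : ZFSet.{u}) : ZFSet.{u} :=
  ZFSet.sep (fun p => (∃ n ∈ om, SzQ M n p) ∧ ∀ x ∈ ZFSet.prod I om, ¬ (ZFSet.pair x ∅ ∈ p ∧ ZFSet.pair x {∅} ∈ p))
    (PM M (ZFSet.prod (ZFSet.prod I om) {∅, {∅}}))

section
variable {I : ZFSet.{u}}
theorem Pc_mem (hM : ZM0 M) (hI : I ∈ M) : Pc M I ∈ M := by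
  have := hM.sep4 (fun M w J z o p => (∃ n ∈ w, SzQ M n p) ∧ ∀ x ∈ J, ¬ (ZFSet.pair x z ∈ p ∧ ZFSet.pair x o ∈ p))
    hM.om (hM.prod hI hM.om) hM.empty (hM.sing hM.empty)
    (hM.PM (hM.prod (hM.prod hI hM.om) (hM.pair _ hM.empty _ (hM.sing hM.empty))))
  exact this

theorem ne01 : (∅ : ZFSet.{u}) ≠ {∅} := by
  intro h
  have : (∅ : ZFSet.{u}) ∈ ({∅} : ZFSet.{u}) := by simp
  rw [← h] at this
  simp at this

theorem mem_Pc (hM : ZM0 M) (hI : I ∈ M) {p : ZFSet.{u}} : p ∈ Pc M I ↔ (∃ s : Finset ZFSet.{u}, ∀ x, x ∈ s ↔ x ∈ p) ∧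
    (p ⊆ ZFSet.prod (ZFSet.prod I om) {∅, {∅}}) ∧ ∀ a ∈ p, ∀ b ∈ p, ¬ Cf a b := by
  have hM2 := (hM.prod (hM.prod hI hM.om) (hM.pair _ hM.empty _ (hM.sing hM.empty)))
  rw [Pc, ZFSet.mem_sep, mem_PM]
  constructor
  · rintro ⟨⟨h1, h2⟩, ⟨n, hn, h3⟩, h4⟩
    obtain ⟨k, rfl⟩ := mem_om.1 hn
    obtain ⟨s, hs, _⟩ := sz_fin h3
    refine ⟨⟨s, hs⟩, h2, ?_⟩
    rintro a ha b hb ⟨x, ⟨rfl, rfl⟩ | ⟨rfl, rfl⟩⟩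
    · exact h4 x (ZFSet.pair_mem_prod.1 (h2 ha)).1 ⟨ha, hb⟩
    · exact h4 x (ZFSet.pair_mem_prod.1 (h2 ha)).1 ⟨hb, ha⟩
  · rintro ⟨⟨s, hs⟩, h2, h3⟩
    have hp : p ∈ M := by
      obtain ⟨q, hq, hq'⟩ := hM.finset s (fun x hx => trans_mem hM.tr (h2 ((hs x).1 hx)) hM2)
      obtain rfl : p = q := by ext x; rw [hq', hs]
      exact hq
    exact ⟨⟨hp, h2⟩, ⟨_, nn_mem_om _, fin_sz hM hp s hs⟩, fun x _ h => h3 _ h.1 _ h.2 ⟨x, .inl ⟨rfl, rfl⟩⟩⟩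

theorem Pc_empty (hM : ZM0 M) (hI : I ∈ M) : ∅ ∈ Pc M I :=
  (mem_Pc hM hI).2 ⟨⟨∅, by simp⟩, ZFSet.empty_subset _, by simp⟩

theorem Pc_union (hM : ZM0 M) (hI : I ∈ M) {p q : ZFSet.{u}} (hp : p ∈ Pc M I) (hq : q ∈ Pc M I)
    (h : ∀ a ∈ p, ∀ b ∈ q, ¬ Cf a b) : p ∪ q ∈ Pc M I := by
  classical
  obtain ⟨⟨s, hs⟩, h1, h2⟩ := (mem_Pc hM hI).1 hp
  obtain ⟨⟨t, ht⟩, h3, h4⟩ := (mem_Pc hM hI).1 hq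
  refine (mem_Pc hM hI).2 ⟨⟨s ∪ t, fun x => by simp [hs, ht]⟩, ?_, ?_⟩
  · intro x hx
    rcases ZFSet.mem_union.1 hx with h | h
    · exact h1 h
    · exact h3 h
  · intro a ha b hb
    rcases ZFSet.mem_union.1 ha with ha | ha <;> rcases ZFSet.mem_union.1 hb with hb | hb
    · exact h2 a ha b hb
    · exact h a ha b hb
    · exact fun hc => h b hb a ha hc.symm
    · exact h4 a ha b hb

theorem sub_union_l (p q : ZFSet.{u}) : p ⊆ p ∪ q := fun _ h => ZFSet.mem_union.2 (.inl h)
theorem sub_union_r (p q : ZFSet.{u}) : q ⊆ p ∪ q := fun _ h => ZFSet.mem_union.2 (.inr h)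

/-! ### covering -/
def FnQ (M A B g : ZFSet.{u}) : Prop :=
  ∀ a ∈ A, ∀ b ∈ B, ∀ b' ∈ B, ZFSet.pair a b ∈ g → ZFSet.pair a b' ∈ g → b = b'
instance udFnQ {n : ℕ} {s t r : ZFSet.{u} → (Fin n → ZFSet.{u}) → ZFSet.{u}} [Proj s] [Proj t] [Proj r] :
    UD (fun M v => FnQ M (s M v) (t M v) (r M v)) :=
  UD.app3 (Q := FnQ) <| by unfold FnQ; infer_instance

def CvQ (M P p0 γ a n b p : ZFSet.{u}) : Prop :=
  p0 ⊆ p ∧ SzQ M n p ∧ ∃ c ∈ M, c = ZFSet.pair a b ∧ ∃ d ∈ M, CK M c d ∧ FMem M P p d γ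

theorem cover (hM : FM M) (hc : M.toSet.Countable) (hI : I ∈ M) (hG : Gen M (Pc M I) G) {g A B : ZFSet.{u}}
    (hg : g ∈ NG M G) (hA : A ∈ M) (hB : B ∈ M) (hfun : FnQ (NG M G) A B g)
    (hon : ∀ b ∈ B, ∃ a ∈ A, ZFSet.pair a b ∈ g) :
    ∃ R ∈ M, (∀ x ∈ ZFSet.prod A om, {b | ZFSet.pair x b ∈ R}.Finite) ∧ ∀ b ∈ B, ∃ x ∈ ZFSet.prod A om, ZFSet.pair x b ∈ R := by
  classical
  have hP := Pc_mem hM.toZM0 hI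
  obtain ⟨γ, hγ, rfl⟩ := mem_NG.1 hg
  have hv : ∀ i, (![chk A, chk B, γ] : Fin 3 → ZFSet.{u}) i ∈ M := by
    intro i; fin_cases i
    · exact hM.chk A hA
    · exact hM.chk B hB
    · exact hγ
  have hsat : ∀ G, Gen M (Pc M I) G → (FnQ (NG M G) A B (val G γ) ↔ ∃ p ∈ G, Fc M (Pc M I) (fm (n := 3) fun M v => FnQ M (v 0) (v 1) (v 2)) p ![chk A, chk B, γ]) := by
    intro G hG
    rw [← truth hM hP hG _ hv, fm_spec _ (NG_tr hM.tr) (fun i => NG_mem (hv i))]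
    have e1 := val_chk hG.emp A
    have e2 := val_chk hG.emp B
    simp only [Matrix.cons_val_zero, Matrix.cons_val_one, Matrix.cons_val, e1, e2]
  obtain ⟨p0, hp0, hF⟩ := (hsat G hG).1 hfun
  have hp0M := trans_mem hM.tr (hG.sub hp0) hP
  have hR := hM.sepV (n := 3) (R := fun M w z => ∃ a ∈ M, ∃ n ∈ M, ∃ b ∈ M, ∃ x ∈ M, x = ZFSet.pair a n ∧ z = ZFSet.pair x b ∧
    ∃ p ∈ w 0, CvQ M (w 0) (w 1) (w 2) a n b p) (by unfold CvQ; infer_instance) (v := ![Pc M I, p0, γ]) (by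
      intro i; fin_cases i
      · exact hP
      · exact hp0M
      · exact hγ) (hM.prod (hM.prod hA hM.om) hB)
  set R := ZFSet.sep _ _ with hRd
  have mR : ∀ a n b, ZFSet.pair (ZFSet.pair a n) b ∈ R ↔ a ∈ A ∧ n ∈ om ∧ b ∈ B ∧ ∃ p ∈ Pc M I, p0 ⊆ p ∧ SzQ M n p ∧
      FMem M (Pc M I) p (chk (ZFSet.pair a b)) γ := by
    intro a n b
    rw [hRd, ZFSet.mem_sep, ZFSet.pair_mem_prod, ZFSet.pair_mem_prod]
    constructor
    · rintro ⟨⟨⟨ha, hn⟩, hb⟩, a', _, n', _, b', _, x, _, rfl, h, p, hp, h1, h2, c, hcM, rfl, d, hd, h3, h4⟩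
      obtain ⟨h5, rfl⟩ := ZFSet.pair_inj.1 h
      obtain ⟨rfl, rfl⟩ := ZFSet.pair_inj.1 h5
      rw [(hM.cq _ hcM _ hd).1 h3] at h4
      exact ⟨ha, hn, hb, p, hp, h1, h2, h4⟩
    · rintro ⟨ha, hn, hb, p, hp, h1, h2, h4⟩
      have haM := trans_mem hM.tr ha hA
      have hbM := trans_mem hM.tr hb hB
      have hnM := trans_mem hM.tr hn hM.om
      have hcM := hM.opair haM hbM
      have hd := hM.chk _ hcM
      exact ⟨⟨⟨ha, hn⟩, hb⟩, a, haM, n, hnM, b, hbM, _, hM.opair haM hnM, rfl, rfl, p, hp, h1, h2, _, hcM, rfl, _, hd, 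
        (hM.cq _ hcM _ hd).2 rfl, h4⟩
  refine ⟨R, hR, ?_, ?_⟩
  · intro x hx
    obtain ⟨a, ha, n, hn, rfl⟩ := ZFSet.mem_prod.1 hx
    obtain ⟨k, rfl⟩ := mem_om.1 hn
    have h1 : ∀ b : ZFSet.{u}, ∃ p : ZFSet.{u}, ∃ s : Finset ZFSet.{u}, ZFSet.pair (ZFSet.pair a (nn k)) b ∈ R → b ∈ B ∧ p ∈ Pc M I ∧ p0 ⊆ p ∧
        (∀ x, x ∈ s ↔ x ∈ p) ∧ s.card ≤ k ∧ FMem M (Pc M I) p (chk (ZFSet.pair a b)) γ := by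
      intro b
      by_cases h : ZFSet.pair (ZFSet.pair a (nn k)) b ∈ R
      · obtain ⟨_, _, hb, p, hp, h1, h2, h3⟩ := (mR _ _ _).1 h
        obtain ⟨s, hs, hk⟩ := sz_fin h2
        exact ⟨p, s, fun _ => ⟨hb, hp, h1, hs, hk, h3⟩⟩
      · exact ⟨∅, ∅, fun h' => absurd h' h⟩
    choose p s hps using h1
    refine anti Cf Cf_fin k _ s ?_ ?_
    · intro b hb
      obtain ⟨h1, h2, h3, h4, h5, h6⟩ := hps b hb
      exact ⟨h5, fun x hx y hy => ((mem_Pc hM.toZM0 hI).1 h2).2.2 x ((h4 _).1 hx) y ((h4 _).1 hy)⟩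
    · intro b hb b' hb' hne
      obtain ⟨h1, h2, h3, h4, h5, h6⟩ := hps b hb
      obtain ⟨i1, i2, i3, i4, i5, i6⟩ := hps b' hb'
      by_contra hcon
      apply hne
      have hu : p b ∪ p b' ∈ Pc M I := Pc_union hM.toZM0 hI h2 i2 fun x hx y hy h =>
        hcon ⟨x, (h4 _).2 hx, y, (i4 _).2 hy, h⟩
      obtain ⟨H, hH, hHu⟩ := gen_exists hc hP hM.tr (Pc_empty hM.toZM0 hI) hu
      have j1 := hH.up _ hHu _ h2 (sub_union_l _ _)
      have j2 := hH.up _ hHu _ i2 (sub_union_r _ _)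
      have j3 := hH.up _ j1 _ (hG.sub hp0) h3
      have hFn := (hsat H hH).2 ⟨p0, j3, hF⟩
      have haM := trans_mem hM.tr ha hA
      have e1 := (val_fmem hM hP hH (hM.chk _ (hM.opair haM (trans_mem hM.tr h1 hB))) hγ).2 ⟨_, j1, h6⟩
      have e2 := (val_fmem hM hP hH (hM.chk _ (hM.opair haM (trans_mem hM.tr i1 hB))) hγ).2 ⟨_, j2, i6⟩
      rw [val_chk hH.emp] at e1 e2
      exact hFn a ha b h1 b' i1 e1 e2
  · intro b hb
    obtain ⟨a, ha, hab⟩ := hon b hb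
    have haM := trans_mem hM.tr ha hA
    rw [← val_chk hG.emp (ZFSet.pair a b)] at hab
    obtain ⟨p, hp, h1⟩ := (val_fmem hM hP hG (hM.chk _ (hM.opair haM (trans_mem hM.tr hb hB))) hγ).1 hab
    obtain ⟨r, hr, e1, e2⟩ := hG.dir p hp p0 hp0
    obtain ⟨_, ⟨n, hn, hs⟩, _⟩ := ZFSet.mem_sep.1 (hG.sub hr)
    exact ⟨ZFSet.pair a n, ZFSet.pair_mem_prod.2 ⟨ha, hn⟩, (mR _ _ _).2 ⟨ha, hn, hb, r, hG.sub hr, e2, hs, fmem_mono h1 e1⟩⟩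

theorem no_onto (hM : FM M) (hc : M.toSet.Countable) (hI : I ∈ M) (hG : Gen M (Pc M I) G) {g A : ZFSet.{u}}
    (hg : g ∈ NG M G) (hA : A ∈ M) (hfun : FnQ (NG M G) A (PM M (ZFSet.prod (ZFSet.prod A om) om)) g)
    (hon : ∀ b ∈ PM M (ZFSet.prod (ZFSet.prod A om) om), ∃ a ∈ A, ZFSet.pair a b ∈ g) : False := by
  have hX := hM.prod hA hM.om
  obtain ⟨R, hR, h1, h2⟩ := cover hM hc hI hG hg hA (hM.PM (hM.prod hX hM.om)) hfun hon
  exact no_cover hM.toZM0 hX hR h1 h2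
end
end Part8

section Part9
universe u
set_option linter.unusedVariables false
variable {M P G I : ZFSet.{u}} 

theorem Pc_dense (hM : FM M) (hI : I ∈ M) {i j : ZFSet.{u}} (hi : i ∈ I) (hj : j ∈ I) (hij : i ≠ j) {p : ZFSet.{u}}
    (hp : p ∈ Pc M I) : ∃ r ∈ Pc M I, p ⊆ r ∧ ∃ k ∈ om, ZFSet.pair (ZFSet.pair i k) ∅ ∈ r ∧ ZFSet.pair (ZFSet.pair j k) {∅} ∈ r := by
  classical
  obtain ⟨⟨s, hs⟩, h1, h2⟩ := (mem_Pc hM.toZM0 hI).1 hp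
  obtain ⟨k, hk⟩ : ∃ k : ℕ, ∀ l y, ZFSet.pair (ZFSet.pair l (nn k)) y ∉ p := by
    by_contra hcon
    push Not at hcon
    choose l y hly using hcon
    refine Set.infinite_of_injective_forall_mem (f := fun k => ZFSet.pair (ZFSet.pair (l k) (nn k)) (y k)) (s := (s : Set ZFSet.{u})) ?_ ?_ s.finite_toSet
    · intro a b hab
      exact nn_inj (ZFSet.pair_inj.1 (ZFSet.pair_inj.1 hab).1).2
    · intro a; exact (hs _).2 (hly a)
  have hne : ZFSet.pair i (nn k) ≠ ZFSet.pair j (nn k) := fun h => hij (ZFSet.pair_inj.1 h).1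
  have hq : ({ZFSet.pair (ZFSet.pair i (nn k)) ∅, ZFSet.pair (ZFSet.pair j (nn k)) {∅}} : ZFSet.{u}) ∈ Pc M I := by
    refine (mem_Pc hM.toZM0 hI).2 ⟨⟨{ZFSet.pair (ZFSet.pair i (nn k)) ∅, ZFSet.pair (ZFSet.pair j (nn k)) {∅}}, by simp⟩, ?_, ?_⟩
    · intro z hz
      rcases ZFSet.mem_pair.1 hz with rfl | rfl
      · exact ZFSet.pair_mem_prod.2 ⟨ZFSet.pair_mem_prod.2 ⟨hi, nn_mem_om k⟩, by simp⟩
      · exact ZFSet.pair_mem_prod.2 ⟨ZFSet.pair_mem_prod.2 ⟨hj, nn_mem_om k⟩, by simp⟩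
    · rintro a ha b hb ⟨x, ⟨rfl, rfl⟩ | ⟨rfl, rfl⟩⟩ <;>
        simp only [ZFSet.mem_pair, ZFSet.pair_inj, ne01, ne01.symm, and_true, and_false, or_false, false_or] at ha hb
      · exact hij (ha.symm.trans hb |> ZFSet.pair_inj.1).1
      · exact hij (hb.symm.trans ha |> ZFSet.pair_inj.1).1
  refine ⟨_, Pc_union hM.toZM0 hI hp hq ?_, sub_union_l _ _, nn k, nn_mem_om k, ?_, ?_⟩
  · rintro a ha b hb ⟨x, ⟨rfl, rfl⟩ | ⟨rfl, rfl⟩⟩ <;>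
      simp only [ZFSet.mem_pair, ZFSet.pair_inj, ne01, ne01.symm, and_true, and_false, or_false, false_or] at hb <;>
      subst hb <;> exact hk _ _ ha
  · exact ZFSet.mem_union.2 (.inr (by simp))
  · exact ZFSet.mem_union.2 (.inr (by simp))

theorem isOrdinal_of {x : ZFSet.{u}} (h : IsOrd x) : x.IsOrdinal :=
  ZFSet.isOrdinal_iff_forall_mem_isTransitive.2 ⟨h.1, fun y hy => h.2 y hy⟩

theorem not_ch (hM : FM M) (hc : M.toSet.Countable) : ∃ P ∈ M, ∅ ∈ P ∧ ∀ G, Gen M P G → ¬ Rz (NG M G) chSent default := by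
  have hω := hM.om
  have hB := hM.PM (hM.prod (hM.prod hω hω) hω)
  obtain ⟨μ, hμ, hμo, h, hh, hs⟩ := hM.ac _ hB
  have hI := hM.PM (hM.prod (hM.prod hμ hω) hω)
  refine ⟨_, Pc_mem hM.toZM0 hI, Pc_empty hM.toZM0 hI, fun G hG hch => ?_⟩
  set B := PM M (ZFSet.prod (ZFSet.prod om om) om) with hBd
  set I := PM M (ZFSet.prod (ZFSet.prod μ om) om) with hId
  have hP := Pc_mem hM.toZM0 hI
  have hN := NG_zm0 hM hP hG
  have hsub := NG_sub hM hG.emp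
  obtain ⟨w, hw, c, hcN, a, ha, f, hf, hwo, hcd, ⟨⟨ao, _⟩, acnt⟩, ⟨f1, f2, f3, f4⟩, finj⟩ := rz_ch (NG_tr hM.tr) hN.pair hch
  obtain rfl := hwo.eq_om
  -- `μ` is not countable in the extension
  have hncount : ¬ ∃ g ∈ NG M G, Surj g om μ := by
    rintro ⟨g, hg, g1, g2, g3, g4⟩
    obtain ⟨s1, s2, s3, s4⟩ := hs
    have hk := hN.sep3 (fun M μ g h z => ∃ n ∈ M, ∃ b ∈ M, z = ZFSet.pair n b ∧ ∃ m ∈ μ, ZFSet.pair n m ∈ g ∧ ZFSet.pair m b ∈ h)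
      (hsub hμ) hg (hsub hh) (hN.prod (hsub hω) (hsub hB))
    refine no_onto hM hc hI hG hk hω ?_ ?_
    · rintro n hn b hb b' hb' h1 h2
      obtain ⟨_, n1, _, b1, _, e1, m1, hm1, a1, a2⟩ := ZFSet.mem_sep.1 h1
      obtain ⟨_, n2, _, b2, _, e2, m2, hm2, a3, a4⟩ := ZFSet.mem_sep.1 h2
      obtain ⟨rfl, rfl⟩ := ZFSet.pair_inj.1 e1
      obtain ⟨rfl, rfl⟩ := ZFSet.pair_inj.1 e2
      obtain rfl := g3 _ _ _ a1 a3
      exact s3 _ _ _ a2 a4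
    · intro b hb
      obtain ⟨m, hm, hmb⟩ := s4 b hb
      obtain ⟨n, hn, hnm⟩ := g4 m hm
      exact ⟨n, hn, ZFSet.mem_sep.2 ⟨ZFSet.pair_mem_prod.2 ⟨hn, hb⟩, n, hsub (trans_mem hM.tr hn hω), b,
        hsub (trans_mem hM.tr hb hB), rfl, m, hm, hnm, hmb⟩⟩
  have haμ : a ⊆ μ := by
    rcases ZFSet.IsOrdinal.mem_trichotomous (isOrdinal_of ao) (isOrdinal_of hμo) with h1 | h1 | h1
    · exact hμo.1 a h1
    · rw [h1]
    · exfalso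
      rcases acnt μ h1 with h2 | h2
      · obtain ⟨m, hm, _⟩ := hs.2.2.2 ∅ (mem_PM.2 ⟨hM.empty, ZFSet.empty_subset _⟩)
        rw [h2] at hm; simp at hm
      · exact hncount h2
  -- the generic reals
  have hGN := NG_G hM hP hG
  have hr := hN.sep2 (fun M G o z => ∃ p ∈ G, ZFSet.pair z o ∈ p) hGN (hsub (hM.sing hM.empty)) (hN.prod (hsub hI) (hsub hω))
  set r := ZFSet.sep _ _ with hrd
  have mr : ∀ i k, ZFSet.pair i k ∈ r ↔ (i ∈ I ∧ k ∈ om) ∧ ∃ p ∈ G, ZFSet.pair (ZFSet.pair i k) {∅} ∈ p := by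
    intro i k; rw [hrd, ZFSet.mem_sep, ZFSet.pair_mem_prod]
  have hdist : ∀ i ∈ I, ∀ j ∈ I, i ≠ j → ∃ k ∈ om, ZFSet.pair i k ∉ r ∧ ZFSet.pair j k ∈ r := by
    intro i hi j hj hij
    have hQ := hM.sep4 (fun M w z o x p => ∃ i ∈ M, ∃ j ∈ M, x = ZFSet.pair i j ∧ ∃ k ∈ w, ZFSet.pair (ZFSet.pair i k) z ∈ p ∧ ZFSet.pair (ZFSet.pair j k) o ∈ p)
      hω hM.empty (hM.sing hM.empty) (hM.opair (trans_mem hM.tr hi hI) (trans_mem hM.tr hj hI)) hP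
    obtain ⟨p, hp, i', _, j', _, e, k, hk, h1, h2⟩ := hG.meet0 hM hP hQ (by
      intro q hq
      obtain ⟨r, hr, h1, h2⟩ := Pc_dense hM hI hi hj hij hq
      exact ⟨r, hr, h1, i, trans_mem hM.tr hi hI, j, trans_mem hM.tr hj hI, rfl, h2⟩)
    obtain ⟨rfl, rfl⟩ := ZFSet.pair_inj.1 e
    refine ⟨k, hk, fun h3 => ?_, (mr _ _).2 ⟨⟨hj, hk⟩, p, hp, h2⟩⟩
    obtain ⟨_, q, hq, h4⟩ := (mr _ _).1 h3
    obtain ⟨t, ht, e1, e2⟩ := hG.dir p hp q hq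
    exact ((mem_Pc hM.toZM0 hI).1 (hG.sub ht)).2.2 _ (e1 h1) _ (e2 h4) ⟨_, .inl ⟨rfl, rfl⟩⟩
  have hg := hN.sep4 (fun M w c f r z => ∃ α ∈ M, ∃ i ∈ M, z = ZFSet.pair α i ∧ ∃ x ∈ c, ZFSet.pair x α ∈ f ∧ ∀ k ∈ w, k ∈ x ↔ ZFSet.pair i k ∈ r)
    hw hcN hf hr (hN.prod (hsub hμ) (hsub hI))
  refine no_onto hM hc hI hG hg hμ ?_ ?_
  · rintro n hn b hb b' hb' h1 h2
    obtain ⟨_, n1, _, b1, _, e1, x1, hx1, a1, a2⟩ := ZFSet.mem_sep.1 h1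
    obtain ⟨_, n2, _, b2, _, e2, x2, hx2, a3, a4⟩ := ZFSet.mem_sep.1 h2
    obtain ⟨rfl, rfl⟩ := ZFSet.pair_inj.1 e1
    obtain ⟨rfl, rfl⟩ := ZFSet.pair_inj.1 e2
    obtain rfl := finj _ _ _ a1 a3
    by_contra hne
    obtain ⟨k, hk, h3, h4⟩ := hdist _ hb _ hb' hne
    exact h3 ((a2 k hk).1 ((a4 k hk).2 h4))
  · intro i hi
    have hiN := hsub (trans_mem hM.tr hi hI)
    have hx := hN.sep2 (fun M r i k => ZFSet.pair i k ∈ r) hr hiN hw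
    generalize hxd : ZFSet.sep (fun k => ZFSet.pair i k ∈ r) om = x at hx
    have hxc : x ∈ c := (hcd x).2 ⟨hx, by rw [← hxd]; exact ZFSet.sep_subset⟩
    obtain ⟨α, hα, hxα⟩ := f2 x hxc
    refine ⟨α, haμ hα, ZFSet.mem_sep.2 ⟨ZFSet.pair_mem_prod.2 ⟨haμ hα, hi⟩, α, hsub (trans_mem hM.tr (haμ hα) hμ), i, hiN, rfl, x, hxc, hxα, ?_⟩⟩
    intro k hk
    rw [← hxd, ZFSet.mem_sep]
    exact and_iff_right hk

def lead : ∀ {n : ℕ}, BF n → ℕ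
  | _, .all φ => lead φ + 1
  | _, _ => 0

theorem lead_alls : ∀ {n : ℕ} (φ : BF n), lead (n := 0) φ.alls = n + lead φ
  | 0, φ => by simp [BoundedFormula.alls]
  | n + 1, φ => by
    rw [BoundedFormula.alls, lead_alls, lead]; omega

theorem lead_repl {n : ℕ} (φ : BF (n + 2)) : lead (n := 0) (replAx φ) = n + 1 := by
  rw [replAx, lead_alls, lead]; rfl

theorem repl_inf : {s : SetLang.Sentence | ∃ p : Σ n : ℕ, BF (n + 2), s = replAx p.2}.Infinite := by
  refine Set.infinite_of_injective_forall_mem (f := fun n : ℕ => replAx (n := n) BoundedFormula.falsum) ?_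
    (fun n => ⟨⟨n, BoundedFormula.falsum⟩, rfl⟩)
  intro a b h
  have := congrArg (lead (n := 0)) h
  simpa only [lead_repl, Nat.add_right_cancel_iff] using this

theorem omega_exists {S : Set SetLang.Sentence} (hS : S.Infinite) (a b c : SetLang.Sentence) (ha : a ∈ S) (hb : b ∈ S) (hc : c ∈ S) :
    ∃ Ω : Finset SetLang.Sentence, Ω.card = 21 ∧ (∀ s ∈ Ω, s ∈ S) ∧ a ∈ Ω ∧ b ∈ Ω ∧ c ∈ Ω := by
  classical
  let Ω₀ : Finset SetLang.Sentence := {a, b, c}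
  have h3 : Ω₀.card ≤ 3 := Finset.card_le_three
  have hinf : (S \ (Ω₀ : Set SetLang.Sentence)).Infinite := hS.sdiff Ω₀.finite_toSet
  obtain ⟨t, ht, htc⟩ := hinf.exists_subset_card_eq (21 - Ω₀.card)
  refine ⟨Ω₀ ∪ t, ?_, ?_, by simp [Ω₀], by simp [Ω₀], by simp [Ω₀]⟩
  · rw [Finset.card_union_of_disjoint, htc]
    · omega
    · rw [Finset.disjoint_left]
      intro x hx hx'
      exact (ht hx').2 hx
  · intro s hs
    rcases Finset.mem_union.1 hs with h | h
    · simp only [Ω₀, Finset.mem_insert, Finset.mem_singleton] at h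
      rcases h with rfl | rfl | rfl <;> assumption
    · exact (ht h).1
end Part9

/-- there are twenty-one replacement instances `Ω` and a map `F` on formulas
such that any ctm of `ZC ∪ {Replacement(F(φ)) : φ ∈ Φ} ∪ Ω` has a countable transitive
extension with the same ordinals satisfying `ZC ∪ {Replacement(φ) : φ ∈ Φ} ∪ {¬CH}`. -/
theorem ctm_of_not_CH :
    ∃ (Ω : Finset SetLang.Sentence)
      (F : (Σ n : ℕ, BF (n + 2)) → (Σ n : ℕ, BF (n + 2))),
      Ω.card = 21 ∧
      (∀ s ∈ Ω, ∃ p : Σ n : ℕ, BF (n + 2), s = replAx p.2) ∧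
      ∀ (Φ : Set (Σ n : ℕ, BF (n + 2))) (M : ZFSet),
        M.toSet.Countable → M.IsTransitive →
        ZModels M (ZC ∪ (fun p => replAx (F p).2) '' Φ ∪ ↑Ω) →
        ∃ N : ZFSet, M ⊆ N ∧ N.toSet.Countable ∧ N.IsTransitive ∧
          (∀ α : ZFSet, IsOrd α → (α ∈ M ↔ α ∈ N)) ∧
          ZModels N (ZC ∪ (fun p : Σ n : ℕ, BF (n + 2) => replAx p.2) '' Φ ∪ {chSent.not}) := by
  obtain ⟨Ω, hΩ, hΩs, o1, o2, o3⟩ := omega_exists repl_inf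
    (replAx (n := 0) (fm (n := 2) fun M v => TcQ M (v 0) (v 1)))
    (replAx (n := 0) (fm (n := 2) fun M v => RecQ StepW M (v 0) (v 1)))
    (replAx (n := 0) (fm (n := 2) fun M v => RecQ StepC M (v 0) (v 1)))
    ⟨⟨0, _⟩, rfl⟩ ⟨⟨0, _⟩, rfl⟩ ⟨⟨0, _⟩, rfl⟩
  refine ⟨Ω, FF, hΩ, hΩs, ?_⟩
  intro Φ M hc htr hmod
  have hrz := (zmodels_iff _ _).1 hmod
  have hZ : ZM M := (ZM.iff htr).1 fun φ hφ => hmod φ (.inl (.inl hφ))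
  have hFM : FM M := FM.mk' hZ ((rz_repl htr _).1 (hrz _ (.inr o1))) ((rz_repl htr _).1 (hrz _ (.inr o2)))
    ((rz_repl htr _).1 (hrz _ (.inr o3)))
  obtain ⟨P, hP, he, hch⟩ := not_ch hFM hc
  obtain ⟨G, hG, -⟩ := gen_exists hc hP htr he he
  have hN := NG_zm hFM hP hG
  refine ⟨NG M G, NG_sub hFM hG.emp, NG_countable hc, hN.tr,
    fun α hα => ⟨fun h => NG_sub hFM hG.emp h, fun h => NG_ord hFM hα h⟩, ?_⟩
  rintro φ ((hφ | ⟨p, hp, rfl⟩) | hφ)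
  · exact (ZM.iff hN.tr).2 hN φ hφ
  · refine (zmodels_iff _ {replAx p.2}).2 ?_ _ rfl
    rintro _ rfl
    exact (rz_repl hN.tr _).2 (NG_repl hFM hP hG p.2
      ((rz_repl htr _).1 (hrz _ (.inl (.inr ⟨p, hp, rfl⟩)))))
  · obtain rfl := hφ
    refine (zmodels_iff _ {chSent.not}).2 ?_ _ rfl
    rintro _ rfl
    exact (rz_not _ _).2 (hch G hG)

end CtmForcing
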